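/- For every graph H, there exists a positive integer N such that every odd H-minor free graph G has a 3-coloring with weak diameter in G at most N. -/

import Mathlib

open SimpleGraph

universe u v

/-- `a` and `b` lie in a common monochromatic component of the coloring `c`
restricted to the set `S` of colored vertices. -/
def MonoReach {β : Type*} {α : Type*} (G : SimpleGraph β) (S : Set β) (c : β → α)
    (a b : β) : Prop :=
  ∃ w : G.Walk a b, ∀ v ∈ w.support, v ∈ S ∧ c v = c a

/-- The coloring `c` (with domain `S`) has weak diameter in `G` at most `N`. -/
def HasWeakDiamLE {β : Type*} {α : Type*} (G : SimpleGraph β) (S : Set β) (c : β → α)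
    (N : ℕ) : Prop :=
  ∀ a b : β, MonoReach G S c a b → G.dist a b ≤ N

/-- `H` is an odd minor of `G`: there are pairwise disjoint branch sets (one for each
vertex of `H`), each carrying a subtree `F w` of `G` spanning it, together with a
2-coloring `col` that is proper on each of these trees, such that every edge of `H`
is realized by an edge of `G` joining two branch sets whose endpoints receive the
same color. -/
def IsOddMinor {W : Type*} {V : Type*} (H : SimpleGraph W) (G : SimpleGraph V) : Prop :=
  ∃ (B : W → Set V) (F : W → SimpleGraph V) (col : V → Bool),
    (∀ w, (B w).Nonempty) ∧
    (∀ w, F w ≤ G) ∧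
    (∀ w, ∀ ⦃x y⦄, (F w).Adj x y → x ∈ B w ∧ y ∈ B w) ∧
    (∀ w, ((F w).induce (B w)).Connected) ∧
    (∀ w, (F w).IsAcyclic) ∧
    (∀ w₁ w₂, w₁ ≠ w₂ → Disjoint (B w₁) (B w₂)) ∧
    (∀ w, ∀ ⦃x y⦄, (F w).Adj x y → col x ≠ col y) ∧
    (∀ ⦃w₁ w₂⦄, H.Adj w₁ w₂ →
      ∃ x ∈ B w₁, ∃ y ∈ B w₂, G.Adj x y ∧ col x = col y)

namespace OddMinorColoring

section Near

variable {V : Type*} {G : SimpleGraph V} {A B P : Set V} {n m : ℕ} {x y z : V}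

/-- `x` and `y` are joined by a walk of length at most `n` inside `A`. -/
def Near (G : SimpleGraph V) (A : Set V) (n : ℕ) (x y : V) : Prop :=
  ∃ w : G.Walk x y, w.length ≤ n ∧ ∀ v ∈ w.support, v ∈ A

/-- `x` and `y` lie in the same component of the subgraph induced by `A`. -/
def Linked (G : SimpleGraph V) (A : Set V) (x y : V) : Prop :=
  ∃ n, Near G A n x y

lemma Near.refl (hx : x ∈ A) (n : ℕ) : Near G A n x x := ⟨.nil, by simp, by simpa⟩

lemma Near.symm (h : Near G A n x y) : Near G A n y x := by
  obtain ⟨w, h1, h2⟩ := h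
  exact ⟨w.reverse, by simpa, by simpa using h2⟩

lemma Near.trans (h : Near G A n x y) (h' : Near G A m y z) : Near G A (n + m) x z := by
  obtain ⟨w, h1, h2⟩ := h
  obtain ⟨w', h1', h2'⟩ := h'
  refine ⟨w.append w', by simp; omega, fun v hv => ?_⟩
  rw [Walk.mem_support_append_iff] at hv
  exact hv.elim (h2 v) (h2' v)

lemma Near.mono (h : Near G A n x y) (hAB : A ⊆ B) (hnm : n ≤ m) : Near G B m x y := by
  obtain ⟨w, h1, h2⟩ := h
  exact ⟨w, h1.trans hnm, fun v hv => hAB (h2 v hv)⟩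

lemma Near.mem_left (h : Near G A n x y) : x ∈ A := by
  obtain ⟨w, h1, h2⟩ := h
  exact h2 _ w.start_mem_support

lemma Near.mem_right (h : Near G A n x y) : y ∈ A := h.symm.mem_left

lemma Near.of_adj (h : G.Adj x y) (hx : x ∈ A) (hy : y ∈ A) : Near G A 1 x y :=
  ⟨.cons h .nil, by simp, by simp [hx, hy]⟩

lemma Near.snoc (h : Near G A n x y) (hyz : G.Adj y z) (hz : z ∈ A) : Near G A (n + 1) x z :=
  h.trans (.of_adj hyz h.mem_right hz)

lemma Near.cons (hxy : G.Adj x y) (hx : x ∈ A) (h : Near G A n y z) : Near G A (n + 1) x z :=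
  (h.symm.snoc hxy.symm hx).symm

lemma Near.zero_eq (h : Near G A 0 x y) : x = y := by
  obtain ⟨w, h1, -⟩ := h
  exact Walk.eq_of_length_eq_zero (Nat.le_zero.1 h1)

lemma Near.succ_cases (h : Near G A (n + 1) x y) :
    Near G A n x y ∨ ∃ z, Near G A n x z ∧ G.Adj z y := by
  obtain ⟨w, h1, h2⟩ := h.symm
  cases w with
  | nil => exact .inl (.refl h.mem_left _)
  | cons hab w' =>
    simp only [Walk.length_cons, Walk.support_cons, List.mem_cons, forall_eq_or_imp] at h1 h2
    exact .inr ⟨_, Near.symm ⟨w', by omega, h2.2⟩, hab.symm⟩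

lemma Near.dist_le (h : Near G A n x y) : G.dist x y ≤ n := by
  obtain ⟨w, h1, -⟩ := h
  exact (SimpleGraph.dist_le w).trans h1

/-- Induction along a short walk. -/
lemma Near.induct {Q : ℕ → V → Prop} (h : Near G A n x y) (h0 : x ∈ A → Q 0 x)
    (hm : ∀ k a, Q k a → Q (k + 1) a)
    (hs : ∀ k a b, k < n → Near G A k x a → Q k a → G.Adj a b → b ∈ A → Q (k + 1) b) : Q n y := by
  induction n generalizing y with
  | zero => obtain rfl := h.zero_eq; exact h0 h.mem_left
  | succ n ih =>
    rcases h.succ_cases with h' | ⟨z, h', hz⟩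
    · exact hm _ _ (ih h' fun k a b hk => hs k a b (by omega))
    · exact hs _ _ _ (by omega) h' (ih h' fun k a b hk => hs k a b (by omega)) hz h.mem_right

/-- The last exit of a walk from a set. -/
lemma Near.last_exit (h : Near G A n x y) (hx : x ∈ P) (hy : y ∉ P) :
    ∃ a b, ∃ k l : ℕ, Near G A k x a ∧ a ∈ P ∧ b ∉ P ∧ G.Adj a b ∧ Near G (A \ P) l b y ∧
      k + l + 1 ≤ n := by
  have := h.induct (Q := fun j y => y ∉ P → ∃ a b, ∃ k l : ℕ, Near G A k x a ∧ a ∈ P ∧ b ∉ P ∧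
      G.Adj a b ∧ Near G (A \ P) l b y ∧ k + l + 1 ≤ j) (fun _ h => (h hx).elim)
    (fun k a h1 h2 => by
      obtain ⟨a', b, k', l, h3, h4, h5, h6, h7, h8⟩ := h1 h2
      exact ⟨a', b, k', l, h3, h4, h5, h6, h7, by omega⟩)
    (fun j a b hj hxa ih hab hb hbP => by
      by_cases haP : a ∈ P
      · exact ⟨a, b, j, 0, hxa, haP, hbP, hab, Near.refl (Set.mem_sdiff_of_mem hb hbP) _, by omega⟩
      · obtain ⟨a', b', k', l, h3, h4, h5, h6, h7, h8⟩ := ih haP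
        exact ⟨a', b', k', l + 1, h3, h4, h5, h6, h7.snoc hab ⟨hb, hbP⟩, by omega⟩)
  exact this hy

lemma Linked.refl (hx : x ∈ A) : Linked G A x x := ⟨0, .refl hx 0⟩
lemma Linked.symm (h : Linked G A x y) : Linked G A y x := h.imp fun _ h => h.symm
lemma Linked.trans (h : Linked G A x y) (h' : Linked G A y z) : Linked G A x z := by
  obtain ⟨n, h⟩ := h
  obtain ⟨m, h'⟩ := h'
  exact ⟨_, h.trans h'⟩
lemma Linked.mono (h : Linked G A x y) (hAB : A ⊆ B) : Linked G B x y :=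
  h.imp fun _ h => h.mono hAB le_rfl
lemma Linked.mem_left (h : Linked G A x y) : x ∈ A := h.choose_spec.mem_left
lemma Linked.mem_right (h : Linked G A x y) : y ∈ A := h.choose_spec.mem_right
lemma Linked.of_adj (h : G.Adj x y) (hx : x ∈ A) (hy : y ∈ A) : Linked G A x y :=
  ⟨1, .of_adj h hx hy⟩
lemma Linked.snoc (h : Linked G A x y) (hyz : G.Adj y z) (hz : z ∈ A) : Linked G A x z :=
  h.trans (.of_adj hyz h.mem_right hz)

lemma Linked.induct {Q : V → Prop} (h : Linked G A x y) (h0 : Q x)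
    (hs : ∀ a b, a ∈ A → Q a → G.Adj a b → b ∈ A → Q b) : Q y := by
  obtain ⟨n, h⟩ := h
  exact h.induct (Q := fun _ y => Q y) (fun _ => h0) (fun _ _ h => h)
    fun k a b _ ha hQ hab hb => hs a b ha.mem_right hQ hab hb

lemma Linked.exit (h : Linked G A x y) (hx : x ∈ P) (hy : y ∉ P) :
    ∃ a b, a ∈ A ∧ a ∈ P ∧ b ∈ A ∧ b ∉ P ∧ G.Adj a b ∧ Linked G (A \ P) b y := by
  obtain ⟨n, h⟩ := h
  obtain ⟨a, b, k, l, h1, h2, h3, h4, h5, -⟩ := h.last_exit hx hy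
  exact ⟨a, b, h1.mem_right, h2, h5.mem_left.1, h3, h4, l, h5⟩

lemma Linked.exit' (h : Linked G A x y) (hx : x ∈ P) (hy : y ∉ P) :
    ∃ a b, a ∈ A ∧ a ∈ P ∧ b ∈ A ∧ b ∉ P ∧ G.Adj a b ∧ Linked G (A ∩ P) x a := by
  obtain ⟨a, b, h1, h2, h3, h4, h5, h6⟩ := h.symm.exit (P := Pᶜ) hy (by simpa)
  refine ⟨b, a, h3, by simpa using h4, h1, h2, h5.symm, ?_⟩
  simpa [Set.sdiff_compl] using h6.symm

/-- `A` induces a connected (or empty) subgraph. -/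
def ConnSet (G : SimpleGraph V) (A : Set V) : Prop :=
  ∀ x ∈ A, ∀ y ∈ A, Linked G A x y

lemma ConnSet.of_base (hb : ∀ y ∈ A, Linked G A x y) : ConnSet G A :=
  fun y hy z hz => (hb y hy).symm.trans (hb z hz)

lemma Linked.component (h : Linked G A x y) : Linked G {z | Linked G A x z} x y := by
  refine h.induct (.refl (.refl h.mem_left)) fun a b _ ih hab hb => ?_
  exact ih.snoc hab (Linked.snoc ih.mem_right hab hb)

lemma connSet_component : ConnSet G {z | Linked G A x z} :=
  .of_base fun _ hy => Linked.component hy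

end Near

section BddCol

variable {V α : Type*} {G : SimpleGraph V} {A B S T : Set V} {r r' : V → V → Prop} {c : V → α}
  {n m : ℕ} {x y z : V}

/-- Monochromatic chains in `S` with respect to the relation `r`. -/
def Chain (r : V → V → Prop) (S : Set V) (c : V → α) : V → V → Prop :=
  Relation.ReflTransGen fun x y => x ∈ S ∧ y ∈ S ∧ c x = c y ∧ r x y

/-- Monochromatic chains in `S` have both ends at distance at most `N` in `A`. -/
def BddCol (G : SimpleGraph V) (A : Set V) (r : V → V → Prop) (S : Set V) (c : V → α)
    (N : ℕ) : Prop :=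
  ∀ x ∈ S, ∀ y, Chain r S c x y → Near G A N x y

/-- `S` has asymptotic dimension at most one in `A` with control function `D`. -/
def OneDim (G : SimpleGraph V) (A S : Set V) (D : ℕ → ℕ) : Prop :=
  ∀ s, ∃ c : V → Bool, BddCol G A (Near G A s) S c (D s)

lemma Chain.mem (h : Chain r S c x y) (hx : x ∈ S) : y ∈ S := by
  induction h with
  | refl => exact hx
  | tail _ h _ => exact h.2.1

lemma Chain.color (h : Chain r S c x y) : c x = c y := by
  induction h with
  | refl => rfl
  | tail _ h ih => exact ih.trans h.2.2.1

lemma Chain.mono {α' : Type*} {c' : V → α'} (h : Chain r S c x y) (hST : S ⊆ T)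
    (hr : ∀ x ∈ S, ∀ y ∈ S, c x = c y → r x y → r' x y)
    (hc : ∀ x ∈ S, ∀ y ∈ S, c x = c y → c' x = c' y) : Chain r' T c' x y := by
  induction h with
  | refl => exact .refl
  | tail _ h ih =>
    exact ih.tail ⟨hST h.1, hST h.2.1, hc _ h.1 _ h.2.1 h.2.2.1, hr _ h.1 _ h.2.1 h.2.2.1 h.2.2.2⟩

lemma BddCol.mono {α' : Type*} {c' : V → α'} (h : BddCol G A r T c n) (hST : S ⊆ T) (hAB : A ⊆ B)
    (hnm : n ≤ m)
    (hr : ∀ x ∈ S, ∀ y ∈ S, c' x = c' y → r' x y → r x y)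
    (hc : ∀ x ∈ S, ∀ y ∈ S, c' x = c' y → c x = c y) : BddCol G B r' S c' m :=
  fun x hx y hxy => (h x (hST hx) y (hxy.mono hST hr hc)).mono hAB hnm

/-- Gluing a set with bounded chains to a set with bounded chains at a larger scale. -/
lemma BddCol.union {X0 X1 : Set V} {N0 N1 e s : ℕ} (h0 : BddCol G A r X0 c N0)
    (h1 : BddCol G A (Near G A s) X1 c N1)
    (hr : ∀ x ∈ X0 ∪ X1, ∀ y ∈ X0 ∪ X1, c x = c y → r x y → Near G A e x y)
    (hs : N0 + 2 * e ≤ s) : BddCol G A r (X0 ∪ X1) c (N1 + 2 * (N0 + e)) := by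
  intro x hx y hxy
  have key : (x ∈ X0 ∧ Chain r X0 c x y) ∨ ∃ u v, u ∈ X1 ∧ Near G A (N0 + e) x u ∧
      Chain (Near G A s) X1 c u v ∧ c v = c y ∧ (y = v ∨ ∃ z, z ∈ X0 ∧ c v = c z ∧ r v z ∧
        Chain r X0 c z y) := by
    induction hxy with
    | refl =>
      by_cases hx0 : x ∈ X0
      · exact .inl ⟨hx0, .refl⟩
      · have hx1 : x ∈ X1 := hx.resolve_left hx0
        have : Near G A N1 x x := h1 x hx1 x .refl
        exact .inr ⟨x, x, hx1, .refl this.mem_left _, .refl, rfl, .inl rfl⟩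
    | @tail y z hxy hyz ih =>
      have hyz' := hr y hyz.1 z hyz.2.1 hyz.2.2.1 hyz.2.2.2
      by_cases hz0 : z ∈ X0
      · rcases ih with ⟨hx0, ih⟩ | ⟨u, v, hu, hxu, huv, hvy, ih⟩
        · exact .inl ⟨hx0, ih.tail ⟨ih.mem hx0, hz0, hyz.2.2⟩⟩
        · refine .inr ⟨u, v, hu, hxu, huv, hvy.trans hyz.2.2.1, .inr ?_⟩
          rcases ih with rfl | ⟨z', hz'0, hcz', hvz', hch⟩
          · exact ⟨z, hz0, hyz.2.2.1, hyz.2.2.2, .refl⟩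
          · exact ⟨z', hz'0, hcz', hvz', hch.tail ⟨hch.mem hz'0, hz0, hyz.2.2⟩⟩
      · have hz1 : z ∈ X1 := hyz.2.1.resolve_left hz0
        rcases ih with ⟨hx0, ih⟩ | ⟨u, v, hu, hxu, huv, hvy, ih⟩
        · exact .inr ⟨z, z, hz1, (h0 x hx0 y ih).trans hyz', .refl, rfl, .inl rfl⟩
        · refine .inr ⟨u, z, hu, hxu, huv.tail ⟨huv.mem hu, hz1, hvy.trans hyz.2.2.1, ?_⟩,
            rfl, .inl rfl⟩
          rcases ih with rfl | ⟨z', hz'0, hcz', hvz', hch⟩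
          · exact hyz'.mono subset_rfl (by omega)
          · have h3 := hr v (.inr (huv.mem hu)) z' (.inl hz'0) hcz' hvz'
            exact ((h3.trans (h0 z' hz'0 y hch)).trans hyz').mono subset_rfl (by omega)
  rcases key with ⟨hx0, h⟩ | ⟨u, v, hu, hxu, huv, hvy, rfl | ⟨z, hz, hcz, hvz, hch⟩⟩
  · exact (h0 x hx0 y h).mono subset_rfl (by omega)
  · exact (hxu.trans (h1 u hu _ huv)).mono subset_rfl (by omega)
  · have h3 := hr v (.inr (huv.mem hu)) z (.inl hz) hcz hvz
    exact ((hxu.trans (h1 u hu _ huv)).trans (h3.trans (h0 z hz y hch))).mono subset_rfl (by omega)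

lemma OneDim.mono {D D' : ℕ → ℕ} (h : OneDim G A S D) (hTS : T ⊆ S) (hD : ∀ s, D s ≤ D' s) :
    OneDim G A T D' := fun s => by
  obtain ⟨c, hc⟩ := h s
  exact ⟨c, hc.mono hTS subset_rfl (hD s) (fun _ _ _ _ _ h => h) fun _ _ _ _ h => h⟩

/-- Control function for a thickened set. -/
def thick (q : ℕ) (D : ℕ → ℕ) (s : ℕ) : ℕ := D (s + 2 * q) + 2 * q

lemma OneDim.thick {D : ℕ → ℕ} (h : OneDim G A S D) (q : ℕ) :
    OneDim G A {x | ∃ y ∈ S, Near G A q x y} (thick q D) := fun s => by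
  classical
  obtain ⟨c, hc⟩ := h (s + 2 * q)
  choose! f hf using fun x (hx : x ∈ {x | ∃ y ∈ S, Near G A q x y}) => hx
  refine ⟨c ∘ f, fun x hx y hxy => ?_⟩
  have key : Chain (Near G A (s + 2 * q)) S c (f x) (f y) ∧ y ∈ {x | ∃ y ∈ S, Near G A q x y} := by
    induction hxy with
    | refl => exact ⟨.refl, hx⟩
    | tail _ h ih =>
      refine ⟨ih.1.tail ⟨(hf _ h.1).1, (hf _ h.2.1).1, h.2.2.1, ?_⟩, h.2.1⟩
      exact (((hf _ h.1).2.symm.trans h.2.2.2).trans (hf _ h.2.1).2).mono subset_rfl (by omega)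
  exact (((hf _ hx).2.trans (hc _ (hf _ hx).1 _ key.1)).trans (hf _ key.2).2.symm).mono subset_rfl
    (by simp only [OddMinorColoring.thick]; omega)

/-- Control function for `OneDim.extend`. -/
def extendCtl (D1 D2 : ℕ → ℕ) (s : ℕ) : ℕ :=
  thick s D1 (D2 s + 2 * s) + 2 * (D2 s + s)

lemma OneDim.extend {S1 S2 : Set V} {D1 D2 : ℕ → ℕ} (h1 : OneDim G A S1 D1)
    (h2 : OneDim G (A \ S1) S2 D2) : OneDim G A (S1 ∪ S2) (extendCtl D1 D2) := fun s => by
  classical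
  obtain ⟨c1, hc1⟩ := h1.thick s (D2 s + 2 * s)
  obtain ⟨c2, hc2⟩ := h2 s
  set X := {x | ∃ y ∈ S1, Near G A s x y} with hX
  by_cases hS1 : S1 ⊆ A
  swap
  · exfalso
    obtain ⟨x, hx, hxA⟩ := Set.not_subset.1 hS1
    obtain ⟨c, hc⟩ := h1 0
    exact hxA (hc x hx x .refl).mem_left
  have hS1X : S1 ⊆ X := fun x hx => ⟨x, hx, .refl (hS1 hx) _⟩
  refine ⟨fun x => if x ∈ X then c1 x else c2 x, ?_⟩
  have e : S1 ∪ S2 = (S2 \ X) ∪ ((S1 ∪ S2) ∩ X) := by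
    ext x; have := @hS1X x; simp only [Set.mem_union, Set.mem_sdiff, Set.mem_inter_iff]; tauto
  have H0 : BddCol G A (Near G A s) (S2 \ X) (fun x => if x ∈ X then c1 x else c2 x) (D2 s) := by
    refine hc2.mono Set.sdiff_subset Set.sdiff_subset le_rfl (fun x hx y hy _ hxy => ?_)
      fun x hx y hy h => by simpa [hx.2, hy.2] using h
    obtain ⟨w, hw, hw'⟩ := hxy
    refine ⟨w, hw, fun v hv => ⟨hw' v hv, fun hv1 => hx.2 ⟨v, hv1, w.takeUntil v hv, ?_, ?_⟩⟩⟩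
    · exact (w.length_takeUntil_le_length hv).trans hw
    · exact fun u hu => hw' u (w.support_takeUntil_subset_support hv hu)
  have H1 : BddCol G A (Near G A (D2 s + 2 * s)) ((S1 ∪ S2) ∩ X)
      (fun x => if x ∈ X then c1 x else c2 x) (OddMinorColoring.thick s D1 (D2 s + 2 * s)) :=
    hc1.mono Set.inter_subset_right subset_rfl le_rfl (fun _ _ _ _ _ h => h)
      fun x hx y hy h => by simpa [hx.2, hy.2] using h
  rw [e]
  exact H0.union H1 (fun _ _ _ _ _ h => h) le_rfl

/-- A set carrying an injective index which is Lipschitz in `A`, such as a geodesic. -/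
lemma OneDim.of_index {ι : V → ℕ} (hSA : S ⊆ A) (hι : Set.InjOn ι S)
    (h : ∀ s, ∀ x ∈ S, ∀ y ∈ S, Near G A s x y → ι x ≤ ι y + s) :
    OneDim G A S (fun s => s * s) := fun s => by
  refine ⟨fun x => decide (ι x / (s + 1) % 2 = 0), fun x hx y hxy => ?_⟩
  let K : SimpleGraph V := SimpleGraph.fromRel fun a b =>
    a ∈ S ∧ b ∈ S ∧ Near G A s a b ∧ ι a / (s + 1) = ι b / (s + 1)
  have hK : ∀ {a b}, K.Adj a b → a ∈ S ∧ b ∈ S ∧ Near G A s a b ∧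
      ι a / (s + 1) = ι b / (s + 1) := fun {a b} hab => by
    rcases hab with ⟨-, h | h⟩
    · exact h
    · exact ⟨h.2.1, h.1, h.2.2.1.symm, h.2.2.2.symm⟩
  have hreach : K.Reachable x y := by
    induction hxy with
    | refl => exact .rfl
    | @tail a b _ hab ih =>
      refine ih.trans ?_
      by_cases hne : a = b
      · rw [hne]
      refine (show K.Adj a b from ⟨hne, .inl ⟨hab.1, hab.2.1, hab.2.2.2, ?_⟩⟩).reachable
      have h1 := h s a hab.1 b hab.2.1 hab.2.2.2
      have h2 := h s b hab.2.1 a hab.1 hab.2.2.2.symm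
      have h3 := hab.2.2.1
      have h4 : ι a / (s + 1) ≤ ι b / (s + 1) + 1 := by
        rw [← Nat.add_div_right _ (by omega)]; exact Nat.div_le_div_right (by omega)
      have h5 : ι b / (s + 1) ≤ ι a / (s + 1) + 1 := by
        rw [← Nat.add_div_right _ (by omega)]; exact Nat.div_le_div_right (by omega)
      have h6 : (ι a / (s + 1) % 2 = 0) ↔ (ι b / (s + 1) % 2 = 0) := by simpa using h3
      omega
  classical
  obtain ⟨w, hw⟩ := hreach.exists_isPath
  have hmem : ∀ {a b} (w : K.Walk a b), a ∈ S → ∀ v ∈ w.support,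
      v ∈ S ∧ ι v / (s + 1) = ι a / (s + 1) := by
    intro a b w
    induction w with
    | nil => intro ha v hv; simp at hv; subst hv; exact ⟨ha, rfl⟩
    | cons hab w ih =>
      intro ha v hv
      simp only [Walk.support_cons, List.mem_cons] at hv
      rcases hv with rfl | hv
      · exact ⟨ha, rfl⟩
      · have := ih (hK hab).2.1 v hv
        exact ⟨this.1, this.2.trans (hK hab).2.2.2.symm⟩
  have hnear : ∀ {a b} (w : K.Walk a b), a ∈ S → Near G A (w.length * s) a b := by
    intro a b w
    induction w with
    | nil => intro ha; exact .refl (hSA ha) _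
    | cons hab w ih =>
      intro ha
      exact ((hK hab).2.2.1.trans (ih (hK hab).2.1)).mono subset_rfl
        (by rw [Walk.length_cons, add_mul]; omega)
  refine (hnear w hx).mono subset_rfl (Nat.mul_le_mul_right _ ?_)
  have hnd := hw.support_nodup
  have hinj : Set.InjOn ι (w.support.toFinset : Set V) := fun a ha b hb hab =>
    hι (hmem w hx a (by simpa using ha)).1 (hmem w hx b (by simpa using hb)).1 hab
  have hcard : w.support.toFinset.card ≤
      (Finset.Ico (ι x / (s + 1) * (s + 1)) ((ι x / (s + 1) + 1) * (s + 1))).card := by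
    refine Finset.card_le_card_of_injOn ι (fun a ha => ?_) hinj
    have h1 := (hmem w hx a (by simpa using ha)).2
    have h2 := Nat.div_add_mod (ι a) (s + 1)
    have h3 := Nat.mod_lt (ι a) (show 0 < s + 1 by omega)
    rw [h1, mul_comm] at h2
    rw [Finset.coe_Ico, Set.mem_Ico, add_mul, one_mul]
    generalize ι x / (s + 1) * (s + 1) = t at *
    omega
  rw [List.toFinset_card_of_nodup hnd, Walk.length_support, Nat.card_Ico, add_mul (ι x / (s + 1)),
    one_mul] at hcard
  omega

end BddCol

section Holes

variable {V : Type*}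

/-- Vertices of `D` are at distance more than `q` from the second component of `e`. -/
def Far (G : SimpleGraph V) (q : ℕ) (e : Set V × Set V) (D : Set V) : Prop :=
  ∀ y ∈ e.2, ∀ x ∈ D, ¬ Near G (e.1 ∪ e.2) q y x

/-- A part of a graph which remains to be colored: a set `K` with boundary in `p`, considered in an
ambient set `A`, together with a stack `tl` of previously separated sets. -/
structure Hole (V : Type*) where
  /-- the vertices to be colored -/
  K : Set V
  /-- the boundary -/
  p : Set V
  /-- the ambient set -/
  A : Set V
  /-- the remaining stack -/
  tl : List (Set V × Set V)

/-- The vertices covered by a family of holes. -/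
def holeUnion (H : Set (Hole V)) : Set V := {x | ∃ h ∈ H, x ∈ h.K}

/-- The holes are pairwise disjoint and nonadjacent. -/
def Sep (G : SimpleGraph V) (H : Set (Hole V)) : Prop :=
  ∀ h ∈ H, ∀ h' ∈ H, ∀ x ∈ h.K, ∀ y ∈ h'.K, (x = y ∨ G.Adj x y) → h = h'

/-- `h` is a hole in the set `C` with stack `L` and ambient set `A`. -/
structure HoleOn (G : SimpleGraph V) (D : ℕ → ℕ) (C : Set V) (L : List (Set V × Set V))
    (A : Set V) (h : Hole V) : Prop where
  sub : h.K ⊆ C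
  bdry : ∀ x ∈ h.K, ∀ y ∈ C, G.Adj x y → y ∉ h.K → y ∈ h.p
  subA : h.K ∪ h.p ⊆ h.A
  ambient : h.A ⊆ A
  oneDim : OneDim G h.A h.p D
  tl_ne : h.tl ≠ []
  suffix : ∃ pre, L = pre ++ h.tl ∧ ∀ e ∈ pre, Far G 4 e h.K

/-- Recursive decompositions of the head of a stack. -/
inductive Good (G : SimpleGraph V) (M : ℕ) (D : ℕ → ℕ) :
    List (Set V × Set V) → Set V → Prop
  | node (C p : Set V) (rest : List (Set V × Set V)) (A W : Set V) (kids : Set (Hole V))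
      (len : rest.length + 1 ≤ M) (hW : W.Nonempty) (hWC : W ⊆ C) (hCA : C ⊆ A)
      (cover : ∀ x ∈ C, x ∉ W → x ∈ holeUnion kids)
      (sep : Sep G kids)
      (hole : ∀ h ∈ kids, HoleOn G D C ((C, p) :: rest) A h)
      (hKW : ∀ h ∈ kids, ∀ x ∈ h.K, x ∉ W)
      (hpW : ∀ h ∈ kids, h.p ⊆ W)
      (good : ∀ h ∈ kids, Good G M D ((h.K, h.p) :: h.tl) h.A)
      (color : OneDim G A W D ∨ ((∃ g : V → Bool, ∀ x ∈ W, ∀ y ∈ W, G.Adj x y → g x ≠ g y) ∧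
        ∀ h ∈ kids, h.p.Subsingleton)) :
      Good G M D ((C, p) :: rest) A

/-- Adjacency, or joint attachment to a hole at bounded distance. -/
def hrel (G : SimpleGraph V) (d : ℕ) (H : Set (Hole V)) (x y : V) : Prop :=
  G.Adj x y ∨ ∃ h ∈ H, (∃ k ∈ h.K, G.Adj x k) ∧ (∃ k ∈ h.K, G.Adj y k) ∧ Near G h.A d x y

variable {G : SimpleGraph V} {d : ℕ} {H : Set (Hole V)} {x y : V}

lemma hrel.symm (h : hrel G d H x y) : hrel G d H y x := by
  rcases h with h | ⟨h, hh, h1, h2, h3⟩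
  · exact .inl h.symm
  · exact .inr ⟨h, hh, h2, h1, h3.symm⟩

lemma Chain.reverse {α : Type*} {r : V → V → Prop} {S : Set V} {c : V → α}
    (hr : ∀ x y, r x y → r y x) (h : Chain r S c x y) : Chain r S c y x := by
  induction h with
  | refl => exact .refl
  | tail _ h ih => exact .head ⟨h.2.1, h.1, h.2.2.1.symm, hr _ _ h.2.2.2⟩ ih

/-- A coloring of a hole `h` leaving the holes `O`; either nothing is colored, or chains are bounded
and those starting at the boundary are confined to distance `d₀`. -/
def SubColored (G : SimpleGraph V) (C : Set V) (d d₀ N : ℕ) (h : Hole V) (O : Set (Hole V))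
    (f : V → Fin 3) : Prop :=
  O = {h} ∨ ((∀ h' ∈ O, h'.K ⊆ h.K ∧ ∀ x ∈ h'.K, ∀ y ∈ C, G.Adj x y → y ∈ h.K) ∧
    BddCol G h.A (hrel G d O) (h.K \ holeUnion O) f N ∧
    ∀ x ∈ h.K \ holeUnion O, (∃ y ∈ h.p, G.Adj y x) →
      ∀ y, Chain (hrel G d O) (h.K \ holeUnion O) f x y → Near G h.A d₀ x y)

open Classical in
/-- Coloring the holes of a partially colored graph. -/
lemma BddCol.glue {C A : Set V} {N N' d₀ : ℕ} {cb : V → Fin 3} (O : Hole V → Set (Hole V))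
    (f : Hole V → V → Fin 3) (hd : d = d₀ + 2) (sep : Sep G H)
    (bdry : ∀ h ∈ H, ∀ x ∈ h.K, ∀ y ∈ C, G.Adj x y → y ∉ h.K → y ∈ h.p)
    (hpA : ∀ h ∈ H, h.K ∪ h.p ⊆ h.A) (hA : ∀ h ∈ H, h.A ⊆ A)
    (base : BddCol G A (hrel G d H) (C \ holeUnion H) cb N')
    (sub : ∀ h ∈ H, SubColored G C d d₀ N h (O h) (f h)) :
    BddCol G A (hrel G d {h' | ∃ h ∈ H, h' ∈ O h})
      (C \ holeUnion {h' | ∃ h ∈ H, h' ∈ O h})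
      (fun x => if hx : ∃ h ∈ H, x ∈ h.K then f hx.choose x else cb x)
      (max N (N' + 2 * (d₀ + 1))) := by
  set OO := {h' | ∃ h ∈ H, h' ∈ O h} with hOO
  set c : V → Fin 3 := fun x => if hx : ∃ h ∈ H, x ∈ h.K then f hx.choose x else cb x with hc
  set X := C \ holeUnion OO with hX
  have c_hole : ∀ h ∈ H, ∀ x ∈ h.K, c x = f h x := by
    intro h hh x hx
    have hex : ∃ h ∈ H, x ∈ h.K := ⟨h, hh, hx⟩
    have : hex.choose = h := sep _ hex.choose_spec.1 _ hh x hex.choose_spec.2 x hx (.inl rfl)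
    simp only [hc, dif_pos hex, this]
  have c_base : ∀ x ∈ C \ holeUnion H, c x = cb x := fun x hx => dif_neg hx.2
  have mem_X_hole : ∀ h ∈ H, ∀ x ∈ X, x ∈ h.K → x ∈ h.K \ holeUnion (O h) :=
    fun h hh x hx hxh => ⟨hxh, fun ⟨h', h1, h2⟩ => hx.2 ⟨h', ⟨h, hh, h1⟩, h2⟩⟩
  have not_outer : ∀ h ∈ H, ∀ x ∈ X, x ∈ h.K → O h ≠ {h} := fun h hh x hx hxh e =>
    (mem_X_hole h hh x hx hxh).2 ⟨h, by rw [e]; rfl, hxh⟩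
  have step_base : ∀ x ∈ X, ∀ y ∈ X, x ∉ holeUnion H → hrel G d OO x y →
      G.Adj x y ∨ hrel G d H x y := by
    rintro x hx y hy hxH (h | ⟨h', ⟨h, hh, hh'⟩, ⟨k, hk, hxk⟩, h2, h3⟩)
    · exact .inl h
    · rcases sub h hh with e | ⟨h4, -⟩
      · rw [e] at hh'
        obtain rfl : h' = h := hh'
        exact .inr (.inr ⟨h', hh, ⟨k, hk, hxk⟩, h2, h3⟩)
      · exact (hxH ⟨h, hh, (h4 h' hh').2 k hk x hx.1 hxk.symm⟩).elim
  have step_hole : ∀ h ∈ H, ∀ x ∈ X, ∀ y ∈ X, x ∈ h.K → hrel G d OO x y →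
      G.Adj x y ∨ (y ∈ h.K ∧ hrel G d (O h) x y) := by
    rintro h hh x hx y hy hxh (h0 | ⟨h', ⟨h1, hh1, hh'⟩, ⟨k, hk, hxk⟩, ⟨k', hk', hyk'⟩, h3⟩)
    · exact .inl h0
    · rcases sub h1 hh1 with e | ⟨h4, -⟩
      · rw [e] at hh'
        obtain rfl : h' = h1 := hh'
        obtain rfl := sep h hh h' hh1 x hxh k hk (.inr hxk)
        exact (not_outer h hh x hx hxh e).elim
      · obtain rfl := sep h hh h1 hh1 x hxh x ((h4 h' hh').2 k hk x hx.1 hxk.symm) (.inl rfl)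
        exact .inr ⟨(h4 h' hh').2 k' hk' y hy.1 hyk'.symm,
          .inr ⟨h', hh', ⟨k, hk, hxk⟩, ⟨k', hk', hyk'⟩, h3⟩⟩
  have step_hole' : ∀ h ∈ H, ∀ x ∈ X, ∀ y ∈ X, x ∈ h.K → hrel G d OO x y →
      (y ∈ h.K ∧ hrel G d (O h) x y) ∨ (y ∉ holeUnion H ∧ y ∈ h.p ∧ G.Adj x y) := by
    intro h hh x hx y hy hxh hxy
    rcases step_hole h hh x hx y hy hxh hxy with h1 | h1
    · by_cases hyH : y ∈ holeUnion H
      · obtain ⟨h', hh', hyh'⟩ := hyH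
        obtain rfl := sep h hh h' hh' x hxh y hyh' (.inr h1)
        exact .inl ⟨hyh', .inl h1⟩
      · exact .inr ⟨hyH, bdry h hh x hxh y hy.1 h1 fun h2 => hyH ⟨h, hh, h2⟩, h1⟩
    · exact .inl h1
  let CB := Chain (hrel G d H) (C \ holeUnion H) cb
  let CH := fun h => Chain (hrel G d (O h)) (h.K \ holeUnion (O h)) (f h)
  let R : V → V → Prop := fun z y => (y ∈ C \ holeUnion H ∧ CB z y) ∨
    ∃ h ∈ H, ∃ z' y₀, y ∈ h.K ∧ z' ∈ C \ holeUnion H ∧ CB z z' ∧ y₀ ∈ h.K ∧ y₀ ∈ X ∧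
      G.Adj z' y₀ ∧ z' ∈ h.p ∧ c z' = c y₀ ∧ CH h y₀ y
  have R_step : ∀ z y y', R z y → y ∈ X → y' ∈ X → c y = c y' → hrel G d OO y y' → R z y' := by
    rintro z y y' (⟨hyH, hzy⟩ | ⟨h, hh, z', y₀, hyh, hz', hzz', hy₀, hy₀X, hadj, hz'p, hcz', hch⟩)
      hy hy' hcc hr
    · by_cases hy'H : y' ∈ holeUnion H
      · obtain ⟨h, hh, hy'h⟩ := hy'H
        rcases step_hole' h hh y' hy' y hy hy'h hr.symm with h1 | ⟨-, h2, h3⟩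
        · exact (hyH.2 ⟨h, hh, h1.1⟩).elim
        · exact .inr ⟨h, hh, y, y', hy'h, hyH, hzy, hy'h, hy', h3.symm, h2, hcc, .refl⟩
      · refine .inl ⟨⟨hy'.1, hy'H⟩, hzy.tail ⟨hyH, ⟨hy'.1, hy'H⟩, ?_, ?_⟩⟩
        · rwa [c_base y hyH, c_base y' ⟨hy'.1, hy'H⟩] at hcc
        · exact (step_base y hy y' hy' hyH.2 hr).elim .inl id
    · rcases step_hole' h hh y hy y' hy' hyh hr with ⟨h1, h2⟩ | ⟨h1, h2, h3⟩
      · refine .inr ⟨h, hh, z', y₀, h1, hz', hzz', hy₀, hy₀X, hadj, hz'p, hcz', hch.tail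
          ⟨mem_X_hole h hh y hy hyh, mem_X_hole h hh y' hy' h1, ?_, h2⟩⟩
        rwa [← c_hole h hh y hyh, ← c_hole h hh y' h1]
      · refine .inl ⟨⟨hy'.1, h1⟩, hzz'.tail ⟨hz', ⟨hy'.1, h1⟩, ?_, .inr ⟨h, hh, ⟨y₀, hy₀, hadj⟩,
          ⟨y, hyh, h3.symm⟩, ?_⟩⟩⟩
        · rw [← c_base z' hz', ← c_base y' ⟨hy'.1, h1⟩, ← hcc, hcz', c_hole h hh y hyh,
            c_hole h hh y₀ hy₀]
          exact hch.color
        · rcases sub h hh with e | ⟨-, -, h6⟩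
          · exact (not_outer h hh y hy hyh e).elim
          · have := h6 y₀ (mem_X_hole h hh y₀ hy₀X hy₀) ⟨z', hz'p, hadj⟩ y hch
            exact ((this.cons hadj (hpA h hh (.inr hz'p))).snoc h3 (hpA h hh (.inr h2))).mono
              subset_rfl (by omega)
  have R_near : ∀ z y, z ∈ C \ holeUnion H → R z y → Near G A (N' + (d₀ + 1)) z y := by
    rintro z y hz (⟨hyH, hzy⟩ | ⟨h, hh, z', y₀, hyh, hz', hzz', hy₀, hy₀X, hadj, hz'p, hcz', hch⟩)
    · exact (base z hz y hzy).mono subset_rfl (by omega)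
    · have h1 := base z hz z' hzz'
      rcases sub h hh with e | ⟨-, -, h6⟩
      · exact (not_outer h hh y₀ hy₀X hy₀ e).elim
      · have := h6 y₀ (mem_X_hole h hh y₀ hy₀X hy₀) ⟨z', hz'p, hadj⟩ y hch
        exact h1.trans ((this.cons hadj (hpA h hh (.inr hz'p))).mono (hA h hh) le_rfl)
  intro x hx y hxy
  by_cases hxH : x ∈ holeUnion H
  · obtain ⟨h, hh, hxh⟩ := hxH
    have key : (y ∈ h.K ∧ y ∈ X ∧ CH h x y) ∨
        ∃ z, z ∈ C \ holeUnion H ∧ Near G A (d₀ + 1) x z ∧ R z y := by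
      induction hxy with
      | refl => exact .inl ⟨hxh, hx, .refl⟩
      | @tail y y' _ hyy ih =>
        rcases ih with ⟨hyh, -, hch⟩ | ⟨z, hz, hxz, hR⟩
        · rcases step_hole' h hh y hyy.1 y' hyy.2.1 hyh hyy.2.2.2 with ⟨h1, h2⟩ | ⟨h1, h2, h3⟩
          · refine .inl ⟨h1, hyy.2.1, hch.tail
              ⟨mem_X_hole h hh y hyy.1 hyh, mem_X_hole h hh y' hyy.2.1 h1, ?_, h2⟩⟩
            rw [← c_hole h hh y hyh, ← c_hole h hh y' h1]
            exact hyy.2.2.1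
          · refine .inr ⟨y', ⟨hyy.2.1.1, h1⟩, ?_, .inl ⟨⟨hyy.2.1.1, h1⟩, .refl⟩⟩
            rcases sub h hh with e | ⟨-, -, h6⟩
            · exact (not_outer h hh y hyy.1 hyh e).elim
            · have := h6 y (mem_X_hole h hh y hyy.1 hyh) ⟨y', h2, h3.symm⟩ x
                (hch.reverse fun _ _ => hrel.symm)
              exact (this.symm.snoc h3 (hpA h hh (.inr h2))).mono (hA h hh) le_rfl
        · exact .inr ⟨z, hz, hxz, R_step z y y' hR hyy.1 hyy.2.1 hyy.2.2.1 hyy.2.2.2⟩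
    rcases key with ⟨hyh, hyX, hch⟩ | ⟨z, hz, hxz, hR⟩
    · rcases sub h hh with e | ⟨-, h5, -⟩
      · exact (not_outer h hh x hx hxh e).elim
      · exact (h5 x (mem_X_hole h hh x hx hxh) y hch).mono (hA h hh) (le_max_left _ _)
    · exact (hxz.trans (R_near z y hz hR)).mono subset_rfl (le_max_of_le_right (by omega))
  · have key : R x y := by
      induction hxy with
      | refl => exact .inl ⟨⟨hx.1, hxH⟩, .refl⟩
      | @tail y y' _ hyy ih => exact R_step x y y' ih hyy.1 hyy.2.1 hyy.2.2.1 hyy.2.2.2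
    exact (R_near x y ⟨hx.1, hxH⟩ key).mono subset_rfl (le_max_of_le_right (by omega))

end Holes

section Barrier

variable {V : Type*} {G : SimpleGraph V} {D : ℕ → ℕ} {K p A : Set V} {H : Set (Hole V)}
  {n m : ℕ} {x y : V}

/-- Vertices at distance at most `n` from `p` in `K ∪ p`. -/
def Lev (G : SimpleGraph V) (K p : Set V) (n : ℕ) (x : V) : Prop :=
  ∃ y ∈ p, Near G (K ∪ p) n y x

lemma Lev.mono (h : Lev G K p n x) (hnm : n ≤ m) : Lev G K p m x := by
  obtain ⟨y, hy, h⟩ := h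
  exact ⟨y, hy, h.mono subset_rfl hnm⟩

lemma Lev.step (h : Lev G K p n x) (hxy : G.Adj x y) (hy : y ∈ K) : Lev G K p (n + 1) y := by
  obtain ⟨z, hz, h⟩ := h
  exact ⟨z, hz, h.snoc hxy (.inl hy)⟩

lemma not_lev_of_far {q : ℕ} {Z : Set V} (h : Far G q (K, p) Z) (hx : x ∈ Z) : ¬ Lev G K p q x :=
  fun ⟨y, hy, hyx⟩ => h y hy x hx hyx

/-- The distance within which chains starting at the boundary are confined. -/
def barD (D : ℕ → ℕ) : ℕ := thick 3 D 1

/-- The distance used for joint attachment to holes. -/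
def relD (D : ℕ → ℕ) : ℕ := barD D + 2

/-- The bound obtained by inserting a barrier. -/
def barrierBound (D : ℕ → ℕ) (N : ℕ) : ℕ :=
  thick 3 D (max (barD D) N + 2 * relD D) + 2 * (max (barD D) N + relD D)

open Classical in
/-- Recoloring the first three levels confines the chains that start at the boundary. -/
lemma exists_barrier {c' : V → Fin 3} {N : ℕ} (hKpA : K ∪ p ⊆ A) (hp : OneDim G A p D)
    (hHK : ∀ h ∈ H, h.K ⊆ K) (hfar : ∀ h ∈ H, Far G 4 (K, p) h.K) (hA : ∀ h ∈ H, h.A ⊆ A)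
    (hc' : BddCol G A (hrel G (relD D) H) (K \ holeUnion H) c' N) :
    ∃ c : V → Fin 3, BddCol G A (hrel G (relD D) H) (K \ holeUnion H) c (barrierBound D N) ∧
      ∀ (X : Set V) (O : Set (Hole V)) (c₂ : V → Fin 3), X ⊆ K →
        (∀ x ∈ X, Lev G K p 3 x → c₂ x = c x) → (∀ h ∈ O, h.K ⊆ K ∧ Far G 4 (K, p) h.K) →
        ∀ x ∈ X, (∃ y ∈ p, G.Adj y x) → ∀ y, Chain (hrel G (relD D) O) X c₂ x y →
          Near G A (barD D) x y := by
  obtain ⟨l, hl⟩ := hp.thick 3 1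
  obtain ⟨l', hl'⟩ := hp.thick 3 (max (barD D) N + 2 * relD D)
  set L := Lev G K p with hL
  have lev_thick : ∀ x, L 3 x → x ∈ {x | ∃ y ∈ p, Near G A 3 x y} := fun x ⟨y, hy, h⟩ =>
    ⟨y, hy, h.symm.mono hKpA le_rfl⟩
  set c : V → Fin 3 := fun x => if L 1 x then (if l x then 2 else 1) else
    if L 2 x then (if l x then 0 else 1) else if L 3 x then (if l' x then 2 else 0) else c' x
    with hc
  have hlow : ∀ x y, L 2 x → L 2 y → c x = c y → l x = l y := by
    intro x y hx hy hxy
    simp only [hc, hx, hy, if_true] at hxy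
    by_cases h1 : L 1 x <;> by_cases h2 : L 1 y <;> simp only [h1, h2, if_true, if_false] at hxy <;>
    cases h3 : l x <;> cases h4 : l y <;> simp [h3, h4] at hxy <;> rfl
  have hmid : ∀ x y, L 3 x → ¬ L 2 x → L 3 y → ¬ L 2 y → c x = c y → l' x = l' y := by
    intro x y hx hx' hy hy' hxy
    have h1 : ¬ L 1 x := fun h => hx' (h.mono (by omega))
    have h2 : ¬ L 1 y := fun h => hy' (h.mono (by omega))
    simp only [hc, hx, hy, hx', hy', h1, h2, if_true, if_false] at hxy
    cases h3 : l' x <;> cases h4 : l' y <;> simp [h3, h4] at hxy <;> rfl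
  have hhigh : ∀ x, ¬ L 3 x → c x = c' x := by
    intro x hx
    have h1 : ¬ L 1 x := fun h => hx (h.mono (by omega))
    have h2 : ¬ L 2 x := fun h => hx (h.mono (by omega))
    simp only [hc, hx, h1, h2, if_false]
  have adj_of_hrel : ∀ (O : Set (Hole V)), (∀ h ∈ O, h.K ⊆ K ∧ Far G 4 (K, p) h.K) → ∀ x y,
      L 3 x → hrel G (relD D) O x y → G.Adj x y := by
    rintro O hO x y ⟨z, hz, hzx⟩ (h | ⟨h, hh, ⟨k, hk, hxk⟩, -⟩)
    · exact h
    · exact ((hO h hh).2 z hz k hk (hzx.snoc hxk (.inl ((hO h hh).1 hk)))).elim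
  refine ⟨c, ?_, ?_⟩
  · set X := K \ holeUnion H with hX
    have eX : X = {x ∈ X | L 2 x ∨ ¬ L 3 x} ∪ {x ∈ X | L 3 x ∧ ¬ L 2 x} := by
      ext x; simp only [Set.mem_union, Set.mem_ofPred_eq]; tauto
    have H0 : BddCol G A (hrel G (relD D) H) {x ∈ X | L 2 x ∨ ¬ L 3 x} c (max (barD D) N) := by
      intro x hx y hxy
      have key : (L 2 x ∧ L 2 y ∧ Chain (Near G A 1) {x | ∃ y ∈ p, Near G A 3 x y} l x y) ∨
          (¬ L 3 x ∧ ¬ L 3 y ∧ Chain (hrel G (relD D) H) X c' x y) := by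
        induction hxy with
        | refl =>
          by_cases h : L 2 x
          · exact .inl ⟨h, h, .refl⟩
          · exact .inr ⟨hx.2.resolve_left h, hx.2.resolve_left h, .refl⟩
        | @tail y z _ hyz ih =>
          rcases ih with ⟨h1, h2, h3⟩ | ⟨h1, h2, h3⟩
          · have hadj := adj_of_hrel H (fun h hh => ⟨hHK h hh, hfar h hh⟩) y z
              (h2.mono (by omega)) hyz.2.2.2
            have hz3 : L 3 z := h2.step hadj hyz.2.1.1.1
            have hz2 : L 2 z := hyz.2.1.2.resolve_right (not_not.2 hz3)
            exact .inl ⟨h1, hz2, h3.tail ⟨lev_thick _ (h2.mono (by omega)), lev_thick _ hz3,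
              hlow y z h2 hz2 hyz.2.2.1,
              .of_adj hadj (hKpA (.inl hyz.1.1.1)) (hKpA (.inl hyz.2.1.1.1))⟩⟩
          · have hz3 : ¬ L 3 z := by
              intro hz3
              have hz2 : L 2 z := hyz.2.1.2.resolve_right (not_not.2 hz3)
              have hadj := adj_of_hrel H (fun h hh => ⟨hHK h hh, hfar h hh⟩) z y hz3
                hyz.2.2.2.symm
              exact h2 (hz2.step hadj hyz.1.1.1)
            refine .inr ⟨h1, hz3, h3.tail ⟨hyz.1.1, hyz.2.1.1, ?_, hyz.2.2.2⟩⟩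
            rw [← hhigh y h2, ← hhigh z hz3]
            exact hyz.2.2.1
      rcases key with ⟨h1, h2, h3⟩ | ⟨h1, h2, h3⟩
      · exact (hl x (lev_thick x (h1.mono (by omega))) y h3).mono subset_rfl (le_max_left _ _)
      · exact (hc' x hx.1 y h3).mono subset_rfl (le_max_right _ _)
    have H1 : BddCol G A (Near G A (max (barD D) N + 2 * relD D)) {x ∈ X | L 3 x ∧ ¬ L 2 x} c
        (thick 3 D (max (barD D) N + 2 * relD D)) :=
      hl'.mono (fun x hx => lev_thick x hx.2.1) subset_rfl le_rfl (fun _ _ _ _ _ h => h)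
        fun x hx y hy h => hmid x y hx.2.1 hx.2.2 hy.2.1 hy.2.2 h
    have := H0.union (e := relD D) H1 ?_ le_rfl
    · rwa [← eX] at this
    · rw [← eX]
      rintro x hx y hy - (h | ⟨h, hh, -, -, h3⟩)
      · exact (Near.of_adj h (hKpA (.inl hx.1)) (hKpA (.inl hy.1))).mono subset_rfl
          (by simp [relD])
      · exact h3.mono (hA h hh) le_rfl
  · rintro X O c₂ hXK hcc hO x hx ⟨y₀, hy₀, hadj⟩ y hxy
    have hx1 : L 1 x := ⟨y₀, hy₀, .of_adj hadj (.inr hy₀) (.inl (hXK hx))⟩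
    have key : L 2 y ∧ (c y = 1 ∨ c y = 2) ∧
        Chain (Near G A 1) {x | ∃ y ∈ p, Near G A 3 x y} l x y := by
      induction hxy with
      | refl =>
        refine ⟨hx1.mono (by omega), ?_, .refl⟩
        simp only [hc, hx1, if_true]
        cases l x <;> simp
      | @tail y z _ hyz ih =>
        obtain ⟨h1, h2, h3⟩ := ih
        have hadj := adj_of_hrel O hO y z (h1.mono (by omega)) hyz.2.2.2
        have hz3 : L 3 z := h1.step hadj (hXK hyz.2.1)
        have hyz' : c y = c z := by
          rw [← hcc y hyz.1 (h1.mono (by omega)), ← hcc z hyz.2.1 hz3]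
          exact hyz.2.2.1
        have hz2 : L 2 z := by
          by_contra hz2
          have hz1 : ¬ L 1 z := fun h => hz2 (h.mono (by omega))
          have hy1 : ¬ L 1 y := fun h => hz2 (h.step hadj (hXK hyz.2.1))
          simp only [hc, hz1, hz2, hz3, hy1, h1, if_true, if_false] at hyz' h2
          cases e1 : l y <;> cases e2 : l' z <;> simp [e1, e2] at hyz' h2
        exact ⟨hz2, hyz' ▸ h2, h3.tail ⟨lev_thick _ (h1.mono (by omega)), lev_thick _ hz3,
          hlow y z h1 hz2 hyz',
          .of_adj hadj (hKpA (.inl (hXK hyz.1))) (hKpA (.inl (hXK hyz.2.1)))⟩⟩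
    exact hl x (lev_thick x (hx1.mono (by omega))) y key.2.2

end Barrier

section PartialColoring

variable {V : Type*} {G : SimpleGraph V} {D : ℕ → ℕ} {M N N' : ℕ} {C K p A B : Set V}
  {H : Set (Hole V)} {e : Set V × Set V} {rest : List (Set V × Set V)}

/-- A bounded partial coloring of `C`, leaving holes attached further down in the stack. -/
def PartialCol (G : SimpleGraph V) (M : ℕ) (D : ℕ → ℕ) (N : ℕ) (C p : Set V)
    (rest : List (Set V × Set V)) (A : Set V) : Prop :=
  ∃ (H : Set (Hole V)) (c : V → Fin 3), (∀ h ∈ H, HoleOn G D C rest A h ∧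
    Good G M D ((h.K, h.p) :: h.tl) h.A ∧ Far G 4 (C, p) h.K) ∧ Sep G H ∧
    (∃ w ∈ C, w ∉ holeUnion H) ∧ BddCol G A (hrel G (relD D) H) (C \ holeUnion H) c N

/-- A bounded partial coloring of `K`, such that moreover chains starting at the boundary are
confined and the holes avoid the neighborhood of the boundary of the next stack entry. -/
def InnerCol (G : SimpleGraph V) (M : ℕ) (D : ℕ → ℕ) (N : ℕ) (K p : Set V) (e : Set V × Set V)
    (rest : List (Set V × Set V)) (B : Set V) : Prop :=
  ∃ (H : Set (Hole V)) (c : V → Fin 3), (∀ h ∈ H, HoleOn G D K rest B h ∧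
    Good G M D ((h.K, h.p) :: h.tl) h.A ∧ Far G 4 (K, p) h.K ∧ Far G 4 e h.K) ∧ Sep G H ∧
    BddCol G B (hrel G (relD D) H) (K \ holeUnion H) c N ∧
    ∀ x ∈ K \ holeUnion H, (∃ y ∈ p, G.Adj y x) →
      ∀ y, Chain (hrel G (relD D) H) (K \ holeUnion H) c x y → Near G B (barD D) x y

/-- Fill those holes whose stack starts with `e`. -/
lemma exists_fill {cb : V → Fin 3}
    (hole : ∀ h ∈ H, HoleOn G D C (e :: rest) A h ∧ Good G M D ((h.K, h.p) :: h.tl) h.A)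
    (sep : Sep G H)
    (base : BddCol G A (hrel G (relD D) H) (C \ holeUnion H) cb N')
    (inner : ∀ h ∈ H, h.tl = e :: rest → InnerCol G M D N h.K h.p e rest h.A) :
    ∃ (O : Set (Hole V)) (c : V → Fin 3), (∀ h ∈ O, HoleOn G D C rest A h ∧
      Good G M D ((h.K, h.p) :: h.tl) h.A ∧ Far G 4 e h.K ∧ ∃ h₀ ∈ H, h.K ⊆ h₀.K) ∧ Sep G O ∧
      BddCol G A (hrel G (relD D) O) (C \ holeUnion O) c (max N (N' + 2 * (barD D + 1))) ∧
      ∀ x ∈ C \ holeUnion H, c x = cb x := by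
  classical
  have ex : ∀ h ∈ H, ∃ (O : Set (Hole V)) (f : V → Fin 3),
      SubColored G C (relD D) (barD D) N h O f ∧ Sep G O ∧
      ∀ h' ∈ O, HoleOn G D C rest A h' ∧ Good G M D ((h'.K, h'.p) :: h'.tl) h'.A ∧
        Far G 4 e h'.K ∧ h'.K ⊆ h.K := by
    intro h hh
    have ho := (hole h hh).1
    by_cases htl : h.tl = e :: rest
    · obtain ⟨O, f, h1, h2, h3, h4⟩ := inner h hh htl
      have key : ∀ h' ∈ O, ∀ x ∈ h'.K, ∀ y ∈ C, G.Adj x y → y ∈ h.K := by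
        intro h' hh' x hx y hy hxy
        by_contra hyK
        have hyp := ho.bdry x ((h1 h' hh').1.sub hx) y hy hxy hyK
        exact (h1 h' hh').2.2.1 y hyp x hx ((Near.of_adj hxy.symm (.inr hyp)
          (.inl ((h1 h' hh').1.sub hx))).mono subset_rfl (by omega))
      refine ⟨O, f, .inr ⟨fun h' hh' => ⟨(h1 h' hh').1.sub, key h' hh'⟩, h3, h4⟩, h2,
        fun h' hh' => ⟨?_, (h1 h' hh').2.1, (h1 h' hh').2.2.2, (h1 h' hh').1.sub⟩⟩
      have := (h1 h' hh').1
      exact ⟨this.sub.trans ho.sub, fun x hx y hy hxy hyK =>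
        this.bdry x hx y (key h' hh' x hx y hy hxy) hxy hyK, this.subA,
        this.ambient.trans ho.ambient, this.oneDim, this.tl_ne, this.suffix⟩
    · refine ⟨{h}, fun _ => 0, .inl rfl, ?_, ?_⟩
      · rintro h' rfl h'' rfl - - - - -
        rfl
      · rintro h' rfl
        obtain ⟨pre, hpre, hfar⟩ := ho.suffix
        cases pre with
        | nil => exact (htl hpre.symm).elim
        | cons a pre =>
          simp only [List.cons_append, List.cons.injEq] at hpre
          obtain ⟨rfl, hpre⟩ := hpre
          exact ⟨⟨ho.sub, ho.bdry, ho.subA, ho.ambient, ho.oneDim, ho.tl_ne,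
            pre, hpre, fun e he => hfar e (List.mem_cons_of_mem _ he)⟩, (hole h' hh).2,
            hfar e List.mem_cons_self, subset_rfl⟩
  choose! O f hO hOsep hOhole using ex
  have := base.glue O f rfl sep (fun h hh => (hole h hh).1.bdry) (fun h hh => (hole h hh).1.subA)
    (fun h hh => (hole h hh).1.ambient) hO
  refine ⟨_, _, ?_, ?_, this, ?_⟩
  · rintro h' ⟨h, hh, hh'⟩
    obtain ⟨h1, h2, h3, h4⟩ := hOhole h hh h' hh'
    exact ⟨h1, h2, h3, h, hh, h4⟩
  · rintro h₁ ⟨h, hh, hh₁⟩ h₂ ⟨h', hh', hh₂⟩ x hx y hy hxy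
    obtain rfl := sep h hh h' hh' x ((hOhole h hh h₁ hh₁).2.2.2 hx) y
      ((hOhole h' hh' h₂ hh₂).2.2.2 hy) hxy
    exact hOsep h hh h₁ hh₁ h₂ hh₂ x hx y hy hxy
  · intro x hx
    exact dif_neg hx.2

/-- The bound in `innerCol_of_partialCol`. -/
def innerBound (D : ℕ → ℕ) (N : ℕ) : ℕ := barrierBound D N + 2 * (barD D + 1)

lemma innerCol_of_partialCol [Finite V]
    (hcol : ∀ K p B, Good G M D ((K, p) :: e :: rest) B → PartialCol G M D N K p (e :: rest) B) :
    ∀ K p B, Good G M D ((K, p) :: e :: rest) B → OneDim G B p D → K ∪ p ⊆ B →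
      InnerCol G M D (innerBound D N) K p e rest B := by
  intro K
  induction hn : K.ncard using Nat.strong_induction_on generalizing K with
  | _ n ih =>
  intro p B hgood hp hKpB
  obtain ⟨H, c', hH, hsep, ⟨w, hwK, hwH⟩, hc'⟩ := hcol K p B hgood
  obtain ⟨c, hc, hbar⟩ := exists_barrier hKpB hp (fun h hh => (hH h hh).1.sub)
    (fun h hh => (hH h hh).2.2) (fun h hh => (hH h hh).1.ambient) hc'
  obtain ⟨O, f, hO, hOsep, hf, hfc⟩ := exists_fill (N := innerBound D N)
    (fun h hh => ⟨(hH h hh).1, (hH h hh).2.1⟩) hsep hc (fun h hh htl => by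
      refine ih _ ?_ h.K rfl h.p h.A ?_ (hH h hh).1.oneDim (hH h hh).1.subA
      · rw [← hn]
        refine Set.ncard_lt_ncard ⟨(hH h hh).1.sub, fun hsub => hwH ⟨h, hh, hsub hwK⟩⟩
      · rw [← htl]; exact (hH h hh).2.1)
  have hfarO : ∀ h ∈ O, h.K ⊆ K ∧ Far G 4 (K, p) h.K := fun h hh => by
    obtain ⟨h1, -, -, h₀, hh₀, h2⟩ := hO h hh
    exact ⟨h1.sub, fun y hy x hx => (hH h₀ hh₀).2.2 y hy x (h2 hx)⟩
  refine ⟨O, f, fun h hh => ?_, hOsep, ?_, ?_⟩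
  · obtain ⟨h1, h2, h3, h₀, hh₀, h4⟩ := hO h hh
    exact ⟨h1, h2, (hfarO h hh).2, h3⟩
  · have e : max (innerBound D N) (barrierBound D N + 2 * (barD D + 1)) = innerBound D N :=
      max_self _
    rwa [e] at hf
  · intro x hx hadj y hxy
    refine hbar (K \ holeUnion O) O f Set.sdiff_subset (fun x hx hlev => hfc x ⟨hx.1, ?_⟩)
      hfarO x hx hadj y hxy
    rintro ⟨h, hh, hxh⟩
    exact not_lev_of_far (hH h hh).2.2 hxh (hlev.mono (by omega))

lemma boolColor_inj {a b : Bool} (h : (if a then 1 else 0 : Fin 3) = if b then 1 else 0) :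
    a = b := by
  cases a <;> cases b <;> simp at h <;> rfl

lemma partialCol_of_innerCol (hgood : Good G M D ((C, p) :: rest) A)
    (inner : ∀ K q B, Good G M D ((K, q) :: (C, p) :: rest) B → OneDim G B q D → K ∪ q ⊆ B →
      InnerCol G M D N K q (C, p) rest B) :
    PartialCol G M D (max N (D (relD D) + 2 * (barD D + 1))) C p rest A := by
  cases hgood with
  | node _ _ _ _ W kids hlen hW hWC hCA cover sep hole hKW hpW good color =>
  have eW : C \ holeUnion kids = W := by
    ext x
    constructor
    · rintro ⟨hx, hxk⟩
      by_contra hxW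
      exact hxk (cover x hx hxW)
    · exact fun hx => ⟨hWC hx, fun ⟨h, hh, hxh⟩ => hKW h hh x hxh hx⟩
  have base : ∃ cb : V → Fin 3, BddCol G A (hrel G (relD D) kids) (C \ holeUnion kids) cb
      (D (relD D)) := by
    rw [eW]
    rcases color with h | ⟨⟨g, hg⟩, hsub⟩
    · obtain ⟨g, hg⟩ := h (relD D)
      refine ⟨fun x => if g x then 1 else 0, hg.mono subset_rfl subset_rfl le_rfl ?_ ?_⟩
      · rintro x hx y hy - (h | ⟨h, hh, -, -, h3⟩)
        · exact (Near.of_adj h (hCA (hWC hx)) (hCA (hWC hy))).mono subset_rfl (by simp [relD])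
        · exact h3.mono (hole h hh).ambient le_rfl
      · exact fun x hx y hy h => boolColor_inj h
    · refine ⟨fun x => if g x then 1 else 0, fun x hx y hxy => ?_⟩
      have : y = x := by
        induction hxy with
        | refl => rfl
        | tail _ hyz ih =>
          subst ih
          obtain ⟨hy, hz, hc, h | ⟨h, hh, ⟨k, hk, hyk⟩, ⟨k', hk', hzk⟩, -⟩⟩ := hyz
          · exact (hg _ hy _ hz h (boolColor_inj hc)).elim
          · exact hsub h hh ((hole h hh).bdry k' hk' _ (hWC hz) hzk.symm fun h' => hKW h hh _ h' hz)
              ((hole h hh).bdry k hk _ (hWC hy) hyk.symm fun h' => hKW h hh _ h' hy)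
      rw [this]
      exact .refl (hCA (hWC hx)) _
  obtain ⟨cb, hcb⟩ := base
  obtain ⟨O, f, hO, hOsep, hf, -⟩ := exists_fill (N := N)
    (fun h hh => ⟨hole h hh, good h hh⟩) sep hcb (fun h hh htl =>
      inner h.K h.p h.A (htl ▸ good h hh) (hole h hh).oneDim (hole h hh).subA)
  obtain ⟨w, hw⟩ := hW
  refine ⟨O, f, fun h hh => ⟨(hO h hh).1, (hO h hh).2.1, (hO h hh).2.2.1⟩, hOsep,
    ⟨w, hWC hw, ?_⟩, hf⟩
  rintro ⟨h, hh, hwh⟩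
  obtain ⟨h₀, hh₀, hsub⟩ := (hO h hh).2.2.2
  exact hKW h₀ hh₀ w (hsub hwh) hw

lemma exists_partialCol (M : ℕ) (D : ℕ → ℕ) (k : ℕ) : ∃ N, ∀ (V : Type u) [Finite V]
    (G : SimpleGraph V) (C p : Set V) (rest : List (Set V × Set V)) (A : Set V),
    M < rest.length + 1 + k → Good G M D ((C, p) :: rest) A → PartialCol G M D N C p rest A := by
  induction k with
  | zero =>
    refine ⟨0, fun V _ G C p rest A hk hgood => ?_⟩
    cases hgood
    omega
  | succ k ih =>
    obtain ⟨N, hN⟩ := ih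
    refine ⟨_, fun V _ G C p rest A hk hgood => partialCol_of_innerCol hgood
      (innerCol_of_partialCol (N := N) fun K q B hg => hN V G K q _ B ?_ hg)⟩
    simp only [List.length_cons]
    omega

/-- A recursive decomposition of a set yields a coloring with bounded monochromatic components. -/
lemma exists_coloring_of_good (M : ℕ) (D : ℕ → ℕ) : ∃ N, ∀ (V : Type u) [Finite V]
    (G : SimpleGraph V) (C p A : Set V), Good G M D [(C, p)] A →
    ∃ c : V → Fin 3, BddCol G A G.Adj C c N := by
  obtain ⟨N, hN⟩ := exists_partialCol.{u} M D M
  refine ⟨N, fun V _ G C p A hgood => ?_⟩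
  obtain ⟨H, c, hH, -, -, hc⟩ := hN V G C p [] A (by simp) hgood
  have hempty : holeUnion H = ∅ := by
    ext x
    simp only [Set.mem_empty_iff_false, iff_false]
    rintro ⟨h, hh, -⟩
    obtain ⟨pre, hpre, -⟩ := (hH h hh).1.suffix
    exact (hH h hh).1.tl_ne (List.append_eq_nil_iff.1 hpre.symm).2
  rw [hempty, Set.sdiff_empty] at hc
  exact ⟨c, hc.mono subset_rfl subset_rfl le_rfl (fun _ _ _ _ _ h => .inl h) fun _ _ _ _ h => h⟩

end PartialColoring

section Bichromatic

variable {V : Type*} {G G' : SimpleGraph V} {A B Z Z' E F : Set V} {g g' col : V → Bool} {x y : V}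

lemma Near.map {n : ℕ} (h : Near G A n x y)
    (hG : ∀ a ∈ A, ∀ b ∈ A, G.Adj a b → G'.Adj a b) : Near G' A n x y :=
  h.induct (Q := fun n y => Near G' A n x y) (fun hx => .refl hx _)
    (fun _ _ h => h.mono subset_rfl (by omega))
    fun _ a b _ _ ha hab hb => ha.snoc (hG a ha.mem_right b hb hab) hb

lemma Linked.map (h : Linked G A x y)
    (hG : ∀ a ∈ A, ∀ b ∈ A, G.Adj a b → G'.Adj a b) : Linked G' A x y :=
  h.imp fun _ h => h.map hG

/-- The bichromatic edges of `G`. -/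
def bi (G : SimpleGraph V) (g : V → Bool) : SimpleGraph V where
  Adj x y := G.Adj x y ∧ g x ≠ g y
  symm := ⟨fun _ _ h => ⟨h.1.symm, h.2.symm⟩⟩
  loopless := ⟨fun _ h => h.2 rfl⟩

/-- `Z` is nonempty and connected by bichromatic edges. -/
def BC (G : SimpleGraph V) (g : V → Bool) (Z : Set V) : Prop :=
  Z.Nonempty ∧ ConnSet (bi G g) Z

lemma BC.congr (h : BC G g Z) (hg : ∀ x ∈ Z, ∀ y ∈ Z, G.Adj x y → g x ≠ g y → g' x ≠ g' y) :
    BC G g' Z :=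
  ⟨h.1, fun x hx y hy => (h.2 x hx y hy).map fun a ha b hb hab =>
    ⟨hab.1, hg a ha b hb hab.1 hab.2⟩⟩

lemma BC.connSet (h : BC G g Z) : ConnSet G Z :=
  fun x hx y hy => (h.2 x hx y hy).map fun _ _ _ _ hab => hab.1

lemma BC.union (h : BC G g Z) (h' : BC G g Z') (hx : x ∈ Z) (hy : y ∈ Z') (hxy : G.Adj x y)
    (hg : g x ≠ g y) : BC G g (Z ∪ Z') := by
  refine ⟨h.1.mono Set.subset_union_left, .of_base (x := x) fun z hz => ?_⟩
  rcases hz with hz | hz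
  · exact (h.2 x hx z hz).mono Set.subset_union_left
  · exact (Linked.of_adj (G := bi G g) ⟨hxy, hg⟩ (.inl hx) (.inr hy)).trans
      ((h'.2 y hy z hz).mono Set.subset_union_right)

lemma BC.singleton (g : V → Bool) (x : V) : BC G g {x} :=
  ⟨⟨x, rfl⟩, .of_base (x := x) fun y hy => by rw [Set.mem_singleton_iff.1 hy]; exact .refl rfl⟩

lemma Linked.diff_singleton {z : V} (h : Linked G A x y) (hxz : x ≠ z) :
    Linked G (A \ {z}) x y ∨ ∃ a, Linked G (A \ {z}) x a ∧ G.Adj a z := by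
  have hx := h.mem_left
  refine h.induct (Q := fun y => Linked G (A \ {z}) x y ∨ ∃ a, Linked G (A \ {z}) x a ∧ G.Adj a z)
    (.inl (.refl ⟨hx, hxz⟩)) fun a b _ ih hab hb => ?_
  rcases ih with ih | ih
  · by_cases hbz : b = z
    · exact .inr ⟨a, ih, hbz ▸ hab⟩
    · exact .inl (ih.snoc hab ⟨hb, hbz⟩)
  · exact .inr ih

/-- Disjoint bichromatically connected sets can be grown to cover a set linked to them. -/
lemma exists_absorb [Finite V] {ι : Type*} (Z : ι → Set V) (col : V → Bool) (F : Set V)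
    (hdisj : ∀ i j, i ≠ j → Disjoint (Z i) (Z j)) (hBC : ∀ i, BC G col (Z i))
    (hF : ∀ i, Disjoint (Z i) F)
    (hlink : ∀ x ∈ F, ∃ y i, Linked G F x y ∧ ∃ z ∈ Z i, G.Adj y z) :
    ∃ (Z' : ι → Set V) (col' : V → Bool), (∀ i, Z i ⊆ Z' i) ∧ (∀ i, Z' i ⊆ Z i ∪ F) ∧
      (∀ i j, i ≠ j → Disjoint (Z' i) (Z' j)) ∧ (∀ x, x ∉ F → col' x = col x) ∧
      (∀ i, BC G col' (Z' i)) ∧ ∀ x ∈ F, ∃ i, x ∈ Z' i := by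
  classical
  induction hn : F.ncard generalizing F Z col with
  | zero =>
    rw [Set.ncard_eq_zero] at hn
    subst hn
    exact ⟨Z, col, fun _ => subset_rfl, fun _ => Set.subset_union_left, hdisj, fun _ _ => rfl, hBC,
      by simp⟩
  | succ n ih =>
    obtain ⟨x, hx⟩ : F.Nonempty := by
      rw [Set.nonempty_iff_ne_empty]; rintro rfl; simp at hn
    obtain ⟨y, i, hxy, z, hz, hyz⟩ := hlink x hx
    have hyF := hxy.mem_right
    have hyZ : ∀ j, y ∉ Z j := fun j hj => Set.disjoint_left.1 (hF j) hj hyF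
    set Z₁ : ι → Set V := fun j => if j = i then Z i ∪ {y} else Z j with hZ₁
    set col₁ : V → Bool := fun v => if v = y then !col z else col v with hcol₁
    have hcol : ∀ j, ∀ v ∈ Z j, col₁ v = col v := fun j v hv =>
      if_neg fun h : v = y => hyZ j (h ▸ hv)
    have hZZ₁ : ∀ j, Z j ⊆ Z₁ j := fun j => by
      by_cases hj : j = i
      · subst hj; simp [hZ₁]
      · simp [hZ₁, hj]
    have hZ₁Z : ∀ j, Z₁ j ⊆ Z j ∪ {y} := fun j => by
      by_cases hj : j = i
      · subst hj; simp [hZ₁]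
      · simp [hZ₁, hj]
    have hZ₁y : ∀ j, j ≠ i → y ∉ Z₁ j := fun j hj => by simpa [hZ₁, hj] using hyZ j
    have key := ih Z₁ col₁ (F \ {y}) ?_ ?_ ?_ ?_ ?_
    obtain ⟨Z', col', h1, h2, h3, h4, h5, h6⟩ := key
    · refine ⟨Z', col', fun j => (hZZ₁ j).trans (h1 j), fun j v hv => ?_, h3, fun v hv => ?_, h5,
        fun v hv => ?_⟩
      · rcases h2 j hv with h | h
        · exact (hZ₁Z j h).elim .inl fun h => .inr (Set.mem_singleton_iff.1 h ▸ hyF)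
        · exact .inr h.1
      · rw [h4 v fun h => hv h.1]
        exact if_neg fun h : v = y => hv (h ▸ hyF)
      · by_cases hvy : v = y
        · exact ⟨i, h1 i (by simp [hZ₁, hvy])⟩
        · exact h6 v ⟨hv, hvy⟩
    · intro j k hjk
      rw [Set.disjoint_left]
      intro v hvj hvk
      rcases hZ₁Z j hvj with h | h
      · rcases hZ₁Z k hvk with h' | h'
        · exact Set.disjoint_left.1 (hdisj j k hjk) h h'
        · exact hyZ j (Set.mem_singleton_iff.1 h' ▸ h)
      · obtain rfl := Set.mem_singleton_iff.1 h
        by_cases hj : j = i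
        · exact hZ₁y k (fun hk => hjk (hj.trans hk.symm)) hvk
        · exact hZ₁y j hj hvj
    · intro j
      have hb : BC G col₁ (Z j) := (hBC j).congr fun a ha b hb _ hab => by
        rwa [hcol j a ha, hcol j b hb]
      by_cases hj : j = i
      · subst hj
        simp only [hZ₁, if_true]
        refine hb.union (.singleton col₁ y) hz rfl hyz.symm ?_
        rw [hcol j z hz]
        simp [hcol₁]
      · simpa [hZ₁, hj] using hb
    · intro j
      rw [Set.disjoint_left]
      rintro v hv ⟨hvF, hvy⟩
      rcases hZ₁Z j hv with h | h
      · exact Set.disjoint_left.1 (hF j) h hvF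
      · exact hvy h
    · rintro v ⟨hvF, hvy⟩
      obtain ⟨w, j, hvw, u, hu, hwu⟩ := hlink v hvF
      rcases hvw.diff_singleton (z := y) hvy with h | ⟨a, h, ha⟩
      · exact ⟨w, j, h, u, hZZ₁ j hu, hwu⟩
      · exact ⟨a, i, h, y, by simp [hZ₁], ha⟩
    · rw [Set.ncard_sdiff_singleton_of_mem hyF, hn]; rfl

/-- Growing a single bichromatically connected set to a connected set containing it. -/
lemma BC.extend [Finite V] (h : BC G g E) (hZ : ConnSet G Z) (hEZ : E ⊆ Z) :
    ∃ g' : V → Bool, (∀ x, x ∉ Z \ E → g' x = g x) ∧ BC G g' Z := by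
  obtain ⟨Z', g', h1, h2, -, h4, h5, h6⟩ := exists_absorb (fun _ : Unit => E) g (Z \ E)
    (fun i j hij => (hij rfl).elim) (fun _ => h) (fun _ => Set.disjoint_sdiff_right)
    (fun x hx => by
      obtain ⟨e, he⟩ := h.1
      obtain ⟨a, b, h1, h2, h3, h4, h5, h6⟩ := (hZ e (hEZ he) x hx.1).exit (P := E) he hx.2
      exact ⟨b, (), h6.symm, a, h2, h5.symm⟩)
  have : Z' () = Z := by
    refine Set.Subset.antisymm ((h2 ()).trans (by simpa using hEZ)) fun x hx => ?_
    by_cases hxE : x ∈ E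
    · exact h1 () hxE
    · exact (h6 x ⟨hx, hxE⟩).elim fun _ h => h
  exact ⟨g', h4, this ▸ h5 ()⟩

/-- Some bichromatically connected subset of `Z'` has edges of both kinds to `Z`. -/
def Odd (G : SimpleGraph V) (col : V → Bool) (Z' Z : Set V) : Prop :=
  ∃ E ⊆ Z', ∃ g : V → Bool, BC G g E ∧ (∃ e ∈ E, ∃ w ∈ Z, G.Adj e w ∧ g e ≠ col w) ∧
    ∃ e ∈ E, ∃ w ∈ Z, G.Adj e w ∧ g e = col w

lemma Odd.mono {col' : V → Bool} {Y Y' : Set V} (h : Odd G col Z' Z) (h' : Z' ⊆ Y') (hZY : Z ⊆ Y)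
    (hcol : ∀ x ∈ Z, col' x = col x) : Odd G col' Y' Y := by
  obtain ⟨E, hE, g, h1, ⟨e, he, w, hw, h2⟩, e', he', w', hw', h3⟩ := h
  exact ⟨E, hE.trans h', g, h1, ⟨e, he, w, hZY hw, by rwa [hcol w hw]⟩,
    e', he', w', hZY hw', by rwa [hcol w' hw']⟩

/-- A sequence of disjoint bichromatically connected sets, each attached oddly to the previous
ones. -/
structure OddSystem (G : SimpleGraph V) (I : Finset ℕ) (Z : ℕ → Set V) (col : V → Bool) :
    Prop where
  bc : ∀ i ∈ I, BC G col (Z i)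
  disj : ∀ i ∈ I, ∀ j ∈ I, i ≠ j → Disjoint (Z i) (Z j)
  odd : ∀ i ∈ I, ∀ j ∈ I, i < j → Odd G col (Z j) (Z i)

/-- The length of a system guaranteeing an odd complete minor of order `r`. -/
def extractSize : ℕ → ℕ
  | 0 => 0
  | r + 1 => 2 * extractSize r + 2

lemma OddSystem.extract [Finite V] (r : ℕ) {I : Finset ℕ} {Z : ℕ → Set V} {col : V → Bool}
    (h : OddSystem G I Z col) (hI : extractSize r ≤ I.card) :
    ∃ (X : Fin r → Set V) (col' : V → Bool), (∀ k, BC G col' (X k)) ∧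
      (∀ k l, k ≠ l → Disjoint (X k) (X l)) ∧
      (∀ k l, k ≠ l → ∃ x ∈ X k, ∃ y ∈ X l, G.Adj x y ∧ col' x = col' y) ∧
      (∀ k, ∀ x ∈ X k, ∃ i ∈ I, x ∈ Z i) ∧
      ∀ k, ∃ i ∈ I, Z i ⊆ X k ∧ ∀ x ∈ Z i, col' x = col x := by
  classical
  induction r generalizing I col with
  | zero => exact ⟨Fin.elim0, col, Fin.rec0, Fin.rec0, Fin.rec0, Fin.rec0, Fin.rec0⟩
  | succ r ih =>
    simp only [extractSize] at hI
    have hne : I.Nonempty := Finset.card_pos.1 (by omega)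
    set b := I.max' hne with hb
    have hbI : b ∈ I := Finset.max'_mem _ _
    have hI' : (I.erase b).card = I.card - 1 := Finset.card_erase_of_mem hbI
    obtain ⟨a, ha⟩ : (I.erase b).Nonempty := Finset.card_pos.1 (by omega)
    have haI : a ∈ I := Finset.mem_of_mem_erase ha
    have hab : a ≠ b := Finset.ne_of_mem_erase ha
    have hlt : ∀ i ∈ I, i ≠ b → i < b := fun i hi hib => lt_of_le_of_ne (I.le_max' i hi) hib
    have hI'' : ((I.erase b).erase a).card = I.card - 2 := by
      rw [Finset.card_erase_of_mem ha]; omega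
    set J := (I.erase b).erase a with hJ
    have hJI : ∀ i ∈ J, i ∈ I ∧ i ≠ a ∧ i ≠ b := fun i hi => by
      simp only [hJ, Finset.mem_erase] at hi; tauto
    obtain ⟨E, hE, g, hg, ⟨e, he, w, hw, hew, hgew⟩, e', he', w', hw', hew', hgew'⟩ :=
      h.odd a haI b hbI (hlt a haI hab)
    obtain ⟨g₀, hg₀, hBCg₀⟩ := hg.extend (h.bc b hbI).connSet hE
    have hedge : ∀ i ∈ J, ∃ x ∈ Z b, ∃ y ∈ Z i, G.Adj x y := fun i hi => by
      obtain ⟨hi1, -, hi2⟩ := hJI i hi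
      obtain ⟨E, hE, g, hg, ⟨e, he, w, hw, hew, hgew⟩, -⟩ := h.odd i hi1 b hbI (hlt i hi1 hi2)
      exact ⟨e, hE he, w, hw, hew⟩
    have : Nonempty V := ⟨e⟩
    choose! p hp q hq hpq using hedge
    have hsplit := Finset.card_filter_add_card_filter_not (s := J) (fun i => g₀ (p i) = col (q i))
    obtain ⟨s, J', hJ', hJ'card, hs⟩ : ∃ (s : Bool) (J' : Finset ℕ), J' ⊆ J ∧
        extractSize r ≤ J'.card ∧ ∀ i ∈ J', xor s (g₀ (p i)) = col (q i) := by
      by_cases hc : extractSize r ≤ (J.filter fun i => g₀ (p i) = col (q i)).card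
      · exact ⟨false, _, Finset.filter_subset _ _, hc, fun i hi => by
          simpa using (Finset.mem_filter.1 hi).2⟩
      · exact ⟨true, _, Finset.filter_subset (fun i => ¬ g₀ (p i) = col (q i)) J, by omega,
          fun i hi => by
            have := (Finset.mem_filter.1 hi).2
            cases h1 : g₀ (p i) <;> cases h2 : col (q i) <;> simp_all⟩
    have hJ'I : ∀ i ∈ J', i ∈ I ∧ i ≠ a ∧ i ≠ b := fun i hi => hJI i (hJ' hi)
    obtain ⟨X, col', h1, h2, h3, h4, h5⟩ := ih (I := J') (col := col)
      ⟨fun i hi => h.bc i (hJ'I i hi).1, fun i hi j hj => h.disj i (hJ'I i hi).1 j (hJ'I j hj).1,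
        fun i hi j hj => h.odd i (hJ'I i hi).1 j (hJ'I j hj).1⟩ hJ'card
    have hdab : ∀ x ∈ Z a, x ∉ Z b := fun x hx hx' =>
      Set.disjoint_left.1 (h.disj a haI b hbI hab) hx hx'
    have hXa : ∀ k, ∀ x ∈ X k, x ∉ Z a ∧ x ∉ Z b := fun k x hx => by
      obtain ⟨i, hi, hxi⟩ := h4 k x hx
      obtain ⟨hi1, hi2, hi3⟩ := hJ'I i hi
      exact ⟨fun hx' => Set.disjoint_left.1 (h.disj i hi1 a haI hi2) hxi hx',
        fun hx' => Set.disjoint_left.1 (h.disj i hi1 b hbI hi3) hxi hx'⟩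
    set colN : V → Bool := fun x => if x ∈ Z b then xor s (g₀ x) else if x ∈ Z a then col x else
      col' x with hcolN
    have hNb : ∀ x ∈ Z b, colN x = xor s (g₀ x) := fun x hx => by simp [hcolN, hx]
    have hNa : ∀ x ∈ Z a, colN x = col x := fun x hx => by simp [hcolN, hx, hdab x hx]
    have hNX : ∀ k, ∀ x ∈ X k, colN x = col' x := fun k x hx => by
      simp [hcolN, (hXa k x hx).1, (hXa k x hx).2]
    have hBCX : ∀ k, BC G colN (X k) := fun k => (h1 k).congr fun x hx y hy _ hxy => by
      rwa [hNX k x hx, hNX k y hy]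
    have hBCb : BC G colN (Z b) := hBCg₀.congr fun x hx y hy _ hxy => by
      rw [hNb x hx, hNb y hy]; simpa using hxy
    have hBCa : BC G colN (Z a) := (h.bc a haI).congr fun x hx y hy _ hxy => by
      rwa [hNa x hx, hNa y hy]
    have hgE : ∀ x ∈ E, g₀ x = g x := fun x hx => hg₀ x fun h => h.2 hx
    have hBCab : BC G colN (Z a ∪ Z b) := by
      cases s
      · refine hBCa.union hBCb hw (hE he) hew.symm ?_
        rw [hNa w hw, hNb e (hE he), hgE e he]; simpa using hgew.symm
      · refine hBCa.union hBCb hw' (hE he') hew'.symm ?_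
        rw [hNa w' hw', hNb e' (hE he'), hgE e' he', hgew']; simp
    have hXedge : ∀ k, ∃ x ∈ Z a ∪ Z b, ∃ y ∈ X k, G.Adj x y ∧ colN x = colN y := fun k => by
      obtain ⟨i, hi, hiX, hicol⟩ := h5 k
      refine ⟨p i, .inr (hp i (hJ' hi)), q i, hiX (hq i (hJ' hi)), hpq i (hJ' hi), ?_⟩
      rw [hNb _ (hp i (hJ' hi)), hNX k _ (hiX (hq i (hJ' hi))), hicol _ (hq i (hJ' hi)), hs i hi]
    have hXdisj : ∀ k, Disjoint (Z a ∪ Z b) (X k) := fun k => Set.disjoint_right.2 fun x hx =>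
      by rw [Set.mem_union]; have := hXa k x hx; tauto
    refine ⟨Fin.cons (Z a ∪ Z b) X, colN, ?_, ?_, ?_, ?_, ?_⟩
    · exact Fin.cases hBCab hBCX
    · refine Fin.cases (Fin.cases (fun h => (h rfl).elim) fun l _ => hXdisj l) fun k =>
        Fin.cases (fun _ => (hXdisj k).symm) fun l hkl => h2 k l fun h => hkl (h ▸ rfl)
    · refine Fin.cases (Fin.cases (fun h => (h rfl).elim) fun l _ => hXedge l) fun k =>
        Fin.cases (fun _ => ?_) fun l hkl => ?_
      · obtain ⟨x, hx, y, hy, hxy, hc⟩ := hXedge k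
        exact ⟨y, hy, x, hx, hxy.symm, hc.symm⟩
      · obtain ⟨x, hx, y, hy, hxy, hc⟩ := h3 k l fun h => hkl (h ▸ rfl)
        refine ⟨x, hx, y, hy, hxy, ?_⟩
        rw [hNX k x hx, hNX l y hy, hc]
    · refine Fin.cases (fun x hx => ?_) fun k x hx => ?_
      · exact hx.elim (fun hx => ⟨a, haI, hx⟩) fun hx => ⟨b, hbI, hx⟩
      · obtain ⟨i, hi, hxi⟩ := h4 k x hx
        exact ⟨i, (hJ'I i hi).1, hxi⟩
    · refine Fin.cases ⟨a, haI, Set.subset_union_left, hNa⟩ fun k => ?_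
      obtain ⟨i, hi, hiX, hicol⟩ := h5 k
      exact ⟨i, (hJ'I i hi).1, hiX, fun x hx => by rw [hNX k x (hiX hx), hicol x hx]⟩

end Bichromatic

section Extract

variable {V : Type*} {G : SimpleGraph V} {g col : V → Bool} {Z : Set V}

lemma BC.exists_tree (h : BC G g Z) : ∃ F : SimpleGraph V, F ≤ G ∧
    (∀ x y, F.Adj x y → x ∈ Z ∧ y ∈ Z) ∧ (F.induce Z).Connected ∧ F.IsAcyclic ∧
    ∀ x y, F.Adj x y → g x ≠ g y := by
  let K : SimpleGraph V :=
    { Adj := fun x y => (x ∈ Z ∧ y ∈ Z) ∧ (bi G g).Adj x y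
      symm := ⟨fun _ _ h => ⟨h.1.symm, h.2.symm⟩⟩
      loopless := ⟨fun _ h => h.2.ne rfl⟩ }
  obtain ⟨F, hF, hac, hreach⟩ := K.exists_isAcyclic_reachable_eq_le
  refine ⟨F, fun _ _ h => (hF h).2.1, fun _ _ h => (hF h).1, ?_, hac, fun _ _ h => (hF h).2.2⟩
  have key : ∀ x y : V, F.Walk x y → ∀ (hx : x ∈ Z) (hy : y ∈ Z),
      (F.induce Z).Reachable ⟨x, hx⟩ ⟨y, hy⟩ := by
    intro x y w
    induction w with
    | nil => exact fun _ _ => .rfl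
    | cons hab w ih =>
      intro hx hy
      have hb := (hF hab).1.2
      exact (Adj.reachable (G := F.induce Z) (u := ⟨_, hx⟩) (v := ⟨_, hb⟩) hab).trans (ih hb hy)
  have : Nonempty Z := h.1.to_subtype
  refine ⟨fun ⟨x, hx⟩ ⟨y, hy⟩ => ?_⟩
  have hK : K.Reachable x y := (h.2 x hx y hy).induct (Q := fun z => z ∈ Z ∧ K.Reachable x z)
    ⟨hx, .rfl⟩ (fun a b _ ih hab hb => ⟨hb, ih.2.trans (Adj.reachable ⟨⟨ih.1, hb⟩, hab⟩)⟩) |>.2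
  rw [← hreach] at hK
  exact key x y hK.some hx hy

lemma OddSystem.isOddMinor [Finite V] {W : Type*} [Fintype W] (H : SimpleGraph W) {I : Finset ℕ}
    {Z : ℕ → Set V} (h : OddSystem G I Z col) (hI : extractSize (Fintype.card W) ≤ I.card) :
    IsOddMinor H G := by
  obtain ⟨X, g, h1, h2, h3, -⟩ := h.extract _ hI
  have e := Fintype.equivFin W
  choose F hF using fun w => (h1 (e w)).exists_tree
  exact ⟨fun w => X (e w), F, g, fun w => (h1 _).1, fun w => (hF w).1, fun w => (hF w).2.1,
    fun w => (hF w).2.2.1, fun w => (hF w).2.2.2.1, fun w₁ w₂ hw => h2 _ _ (e.injective.ne hw),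
    fun w => (hF w).2.2.2.2, fun w₁ w₂ hw => h3 _ _ (e.injective.ne hw.ne)⟩

end Extract

section Bfs

variable {V : Type*} {r : V → V → Prop} {s Q : Set V} {δ : V → ℕ} {par : V → V} {x y z : V}

/-- `δ` is the distance from `s` along `r`, defined on the set `Q` of vertices reachable from `s`,
and `par` is a parent function. -/
structure Bfs (r : V → V → Prop) (s Q : Set V) (δ : V → ℕ) (par : V → V) : Prop where
  sub : s ⊆ Q
  closed : ∀ a ∈ Q, ∀ b, r a b → b ∈ Q
  zero : ∀ b ∈ Q, δ b = 0 ↔ b ∈ s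
  par_mem : ∀ b ∈ Q, δ b ≠ 0 → par b ∈ Q
  par_rel : ∀ b ∈ Q, δ b ≠ 0 → r (par b) b
  par_lev : ∀ b ∈ Q, δ b ≠ 0 → δ (par b) + 1 = δ b
  lip : ∀ a ∈ Q, ∀ b, r a b → δ b ≤ δ a + 1

lemma exists_bfs (r : V → V → Prop) (s : Set V) :
    ∃ (Q : Set V) (δ : V → ℕ) (par : V → V), Bfs r s Q δ par := by
  classical
  let L : ℕ → Set V := fun n => Nat.rec s (fun _ S => {b | ∃ a ∈ S, r a b}) n
  have hL : ∀ n b, b ∈ L (n + 1) ↔ ∃ a ∈ L n, r a b := fun n b => Iff.rfl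
  have hpar : ∀ b, ∃ a, ∀ n, sInf {n | b ∈ L n} = n + 1 → a ∈ L n ∧ r a b := fun b => by
    by_cases h : ∃ n, sInf {n | b ∈ L n} = n + 1
    · obtain ⟨n, hn⟩ := h
      have hb : b ∈ L (n + 1) := by
        rw [← hn]; exact Nat.sInf_mem (Nat.nonempty_of_sInf_eq_succ hn)
      obtain ⟨a, ha, hab⟩ := (hL n b).1 hb
      exact ⟨a, fun m hm => by obtain rfl : n = m := by omega
                               exact ⟨ha, hab⟩⟩
    · exact ⟨b, fun n hn => (h ⟨n, hn⟩).elim⟩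
  choose par hpar using hpar
  have hlip : ∀ a, (∃ n, a ∈ L n) → ∀ b, r a b → sInf {n | b ∈ L n} ≤ sInf {n | a ∈ L n} + 1 :=
    fun a ha b hab => Nat.sInf_le ((hL _ _).2 ⟨a, Nat.sInf_mem (s := {n | a ∈ L n}) ha, hab⟩)
  have key : ∀ b, sInf {n | b ∈ L n} ≠ 0 →
      par b ∈ L (sInf {n | b ∈ L n} - 1) ∧ r (par b) b := fun b hb =>
    hpar b _ (by omega)
  refine ⟨{b | ∃ n, b ∈ L n}, fun b => sInf {n | b ∈ L n}, par, fun b hb => ⟨0, hb⟩,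
    fun a ⟨n, ha⟩ b hab => ⟨n + 1, (hL n b).2 ⟨a, ha, hab⟩⟩, fun b hb => ⟨fun h => ?_, fun h => ?_⟩,
    fun b _ h => ⟨_, (key b h).1⟩, fun b _ h => (key b h).2, fun b _ h => ?_, hlip⟩
  · have : b ∈ L (sInf {n | b ∈ L n}) := Nat.sInf_mem (s := {n | b ∈ L n}) hb
    rw [h] at this; exact this
  · exact Nat.le_zero.1 (Nat.sInf_le (s := {n | b ∈ L n}) h)
  · have h1 := hlip (par b) ⟨_, (key b h).1⟩ b (key b h).2
    have h2 := Nat.sInf_le (s := {n | par b ∈ L n}) (key b h).1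
    omega

/-- The vertices on the path of parents starting at `x`. -/
def branch (δ : V → ℕ) (par : V → V) (x : V) : Set V := {v | ∃ i ≤ δ x, par^[i] x = v}

lemma mem_branch_self : x ∈ branch δ par x := ⟨0, Nat.zero_le _, rfl⟩

namespace Bfs

variable (h : Bfs r s Q δ par)
include h

lemma iterate (hx : x ∈ Q) (i : ℕ) (hi : i ≤ δ x) :
    par^[i] x ∈ Q ∧ δ (par^[i] x) + i = δ x := by
  induction i with
  | zero => exact ⟨hx, rfl⟩
  | succ i ih =>
    obtain ⟨h1, h2⟩ := ih (by omega)
    rw [Function.iterate_succ_apply']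
    have h3 : δ (par^[i] x) ≠ 0 := by omega
    have := h.par_lev _ h1 h3
    exact ⟨h.par_mem _ h1 h3, by omega⟩

lemma branch_sub (hx : x ∈ Q) (hy : y ∈ branch δ par x) : y ∈ Q := by
  obtain ⟨i, hi, rfl⟩ := hy
  exact (h.iterate hx i hi).1

lemma branch_le (hx : x ∈ Q) (hy : y ∈ branch δ par x) : δ y ≤ δ x := by
  obtain ⟨i, hi, rfl⟩ := hy
  have := (h.iterate hx i hi).2
  omega

lemma branch_eq (hx : x ∈ Q) (hy : y ∈ branch δ par x) : y = par^[δ x - δ y] x := by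
  obtain ⟨i, hi, rfl⟩ := hy
  have := (h.iterate hx i hi).2
  rw [← this, Nat.add_sub_cancel_left]

lemma branch_inj (hx : x ∈ Q) : Set.InjOn δ (branch δ par x) := fun a ha b hb hab => by
  rw [h.branch_eq hx ha, h.branch_eq hx hb, hab]

lemma branch_par (hx : x ∈ Q) (hy : y ∈ branch δ par x) (hy0 : δ y ≠ 0) :
    par y ∈ branch δ par x := by
  obtain ⟨i, hi, rfl⟩ := hy
  have := (h.iterate hx i hi).2
  exact ⟨i + 1, by omega, Function.iterate_succ_apply' _ _ _⟩

lemma branch_level (hx : x ∈ Q) {j : ℕ} (hj : j ≤ δ x) : ∃ y ∈ branch δ par x, δ y = j :=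
  ⟨_, ⟨δ x - j, by omega, rfl⟩, by have := (h.iterate hx (δ x - j) (by omega)).2; omega⟩

lemma branch_child (hx : x ∈ Q) (hy : y ∈ branch δ par x) (hyx : y ≠ x) :
    ∃ z ∈ branch δ par x, par z = y ∧ δ z = δ y + 1 := by
  obtain ⟨i, hi, rfl⟩ := hy
  have h2 := (h.iterate hx i hi).2
  cases i with
  | zero => exact (hyx rfl).elim
  | succ i =>
    have h3 := (h.iterate hx i (by omega)).2
    exact ⟨par^[i] x, ⟨i, by omega, rfl⟩, (Function.iterate_succ_apply' _ _ _).symm, by omega⟩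

lemma branch_trans (hx : x ∈ Q) (hy : y ∈ branch δ par x) : branch δ par y ⊆ branch δ par x := by
  obtain ⟨i, hi, rfl⟩ := hy
  have h2 := (h.iterate hx i hi).2
  rintro _ ⟨j, hj, rfl⟩
  exact ⟨j + i, by omega, Function.iterate_add_apply _ _ _ _⟩

lemma oneDim_branch {G : SimpleGraph V} {A : Set V} (hx : x ∈ Q)
    (hr : ∀ a ∈ A, ∀ b ∈ A, a ∈ Q → G.Adj a b → r a b) :
    OneDim G A (branch δ par x ∩ A) (fun s => s * s) := by
  refine .of_index Set.inter_subset_right ((h.branch_inj hx).mono Set.inter_subset_left)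
    fun n a ha b hb hab => ?_
  refine (hab.symm.induct (Q := fun n c => c ∈ Q ∧ δ c ≤ δ b + n)
    (fun _ => ⟨h.branch_sub hx hb.1, le_rfl⟩) (fun _ _ h => ⟨h.1, by omega⟩)
    fun n c d _ hc hcQ hcd hd => ?_).2
  have h1 := hr c hc.mem_right d hd hcQ.1 hcd
  have h2 := h.lip c hcQ.1 d h1
  exact ⟨h.closed c hcQ.1 d h1, by omega⟩

end Bfs

end Bfs

section Tail

variable {V : Type*} {r : V → V → Prop} {s Q : Set V} {δ : V → ℕ} {par : V → V} {x y z : V}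

/-- The vertices on the path of parents starting at `x` of level at least `j`. -/
def tail (δ : V → ℕ) (par : V → V) (x : V) (j : ℕ) : Set V := {w | w ∈ branch δ par x ∧ j ≤ δ w}

lemma Bfs.linked_tail (h : Bfs r s Q δ par) {K : SimpleGraph V} (hx : x ∈ Q) {j : ℕ}
    (hK : ∀ w ∈ Q, j < δ w → K.Adj (par w) w) {v : V} (hv : v ∈ tail δ par x j) :
    Linked K (tail δ par x j) x v := by
  obtain ⟨⟨i, hi, rfl⟩, hj⟩ := hv
  have h1 := (h.iterate hx i hi).2
  have : ∀ k ≤ i, Linked K (tail δ par x j) x (par^[k] x) := by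
    intro k hk
    induction k with
    | zero => exact .refl ⟨mem_branch_self, by omega⟩
    | succ k ih =>
      obtain ⟨h2, h3⟩ := h.iterate hx k (by omega)
      have h4 := (h.iterate hx (k + 1) (by omega)).2
      refine (ih (by omega)).snoc ?_ ⟨⟨k + 1, by omega, rfl⟩, by omega⟩
      rw [Function.iterate_succ_apply']
      exact (hK _ h2 (by omega)).symm
  exact this i le_rfl

end Tail

section Fan

variable {V : Type*} {G : SimpleGraph V} {Y O A P Q : Set V} {g t : V → Bool} {a b c r x y z : V}

/-- Two disjoint connected sets attached to `r`, both meeting `O`. -/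
structure Fan (G : SimpleGraph V) (Y O : Set V) (r : V) (Q₁ Q₂ : Set V) : Prop where
  sub₁ : Q₁ ⊆ Y
  sub₂ : Q₂ ⊆ Y
  disj : Disjoint Q₁ Q₂
  conn₁ : ConnSet G Q₁
  conn₂ : ConnSet G Q₂
  not₁ : r ∉ Q₁
  not₂ : r ∉ Q₂
  adj₁ : ∃ q ∈ Q₁, G.Adj r q
  adj₂ : ∃ q ∈ Q₂, G.Adj r q
  meet₁ : ∃ o ∈ Q₁, o ∈ O
  meet₂ : ∃ o ∈ Q₂, o ∈ O

lemma Fan.swap {Q₁ Q₂ : Set V} (h : Fan G Y O r Q₁ Q₂) : Fan G Y O r Q₂ Q₁ :=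
  ⟨h.sub₂, h.sub₁, h.disj.symm, h.conn₂, h.conn₁, h.not₂, h.not₁, h.adj₂, h.adj₁, h.meet₂, h.meet₁⟩

lemma Fan.step_aux {Q₁ Q₂ : Set V} (h : Fan G Y O r Q₁ Q₂) (hr : r ∈ Y) (har : G.Adj a r)
    (haO : a ∉ O) (hb : b ∈ O) (hl : Linked G ((Y \ {r}) \ Q₂) a b) :
    ∃ Q₁' Q₂' : Set V, Fan G Y O a Q₁' Q₂' := by
  have hne : a ≠ b := fun h => haO (h ▸ hb)
  obtain ⟨a', c, h1, h2, h3, h4, h5, h6⟩ := hl.exit (P := {a}) rfl hne.symm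
  obtain rfl : a' = a := h2
  have hsub : ∀ z, Linked G (((Y \ {r}) \ Q₂) \ {a'}) c z → ((z ∈ Y ∧ z ≠ r) ∧ z ∉ Q₂) ∧ z ≠ a' :=
    fun z hz => hz.mem_right
  obtain ⟨q, hq, hrq⟩ := h.adj₂
  obtain ⟨o, ho, hoO⟩ := h.meet₂
  refine ⟨{z | Linked G (((Y \ {r}) \ Q₂) \ {a'}) c z}, insert r Q₂, fun z hz => (hsub z hz).1.1.1,
    Set.insert_subset hr h.sub₂, ?_, connSet_component, .of_base (x := r) ?_,
    fun hz => (hsub _ hz).2 rfl, ?_, ⟨c, .refl h6.mem_left, h5⟩, ⟨r, .inl rfl, har⟩, ⟨b, h6, hb⟩,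
    ⟨o, .inr ho, hoO⟩⟩
  · rw [Set.disjoint_right]
    rintro z (rfl | hz) hz'
    · exact (hsub _ hz').1.1.2 rfl
    · exact (hsub _ hz').1.2 hz
  · rintro z (rfl | hz)
    · exact .refl (.inl rfl)
    · exact (Linked.of_adj hrq (.inl rfl) (.inr hq)).trans
        ((h.conn₂ q hq z hz).mono (Set.subset_insert _ _))
  · rintro (rfl | hz)
    · exact har.ne rfl
    · exact hl.mem_left.2 hz

lemma Fan.step {Q₁ Q₂ : Set V} (h : Fan G Y O r Q₁ Q₂) (hr : r ∈ Y) (har : G.Adj a r)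
    (haO : a ∉ O) (hb : b ∈ O) (hl : Linked G (Y \ {r}) a b) :
    ∃ Q₁' Q₂' : Set V, Fan G Y O a Q₁' Q₂' := by
  have sub : ∀ {Q₁ Q₂ : Set V}, Fan G Y O r Q₁ Q₂ → Q₁ ⊆ (Y \ {r}) \ Q₂ := fun h z hz =>
    ⟨⟨h.sub₁ hz, fun hzr => h.not₁ (hzr ▸ hz)⟩, Set.disjoint_left.1 h.disj hz⟩
  have fin : ∀ {Q₁ Q₂ : Set V} {c : V}, Fan G Y O r Q₁ Q₂ → c ∈ Q₁ →
      ∃ o ∈ O, Linked G ((Y \ {r}) \ Q₂) c o := fun h hc => by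
    obtain ⟨o, ho, hoO⟩ := h.meet₁
    exact ⟨o, hoO, (h.conn₁ _ hc o ho).mono (sub h)⟩
  have key : ((∃ o ∈ O, Linked G ((Y \ {r}) \ Q₂) a o) ∨ ∃ o ∈ O, Linked G ((Y \ {r}) \ Q₁) a o) ∨
      Linked G ((Y \ {r}) \ (Q₁ ∪ Q₂)) a b := by
    refine hl.induct (Q := fun b => ((∃ o ∈ O, Linked G ((Y \ {r}) \ Q₂) a o) ∨
      ∃ o ∈ O, Linked G ((Y \ {r}) \ Q₁) a o) ∨ Linked G ((Y \ {r}) \ (Q₁ ∪ Q₂)) a b) ?_ ?_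
    · by_cases h1 : a ∈ Q₁
      · exact .inl (.inl (fin h h1))
      by_cases h2 : a ∈ Q₂
      · exact .inl (.inr (fin h.swap h2))
      exact .inr (.refl ⟨hl.mem_left, by simp [h1, h2]⟩)
    · intro c d hc ih hcd hd
      rcases ih with ih | ih
      · exact .inl ih
      by_cases h1 : d ∈ Q₁
      · obtain ⟨o, ho, hdo⟩ := fin h h1
        exact .inl (.inl ⟨o, ho, ((ih.mono (Set.sdiff_subset_sdiff_right
          Set.subset_union_right)).snoc hcd hdo.mem_left).trans hdo⟩)
      by_cases h2 : d ∈ Q₂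
      · obtain ⟨o, ho, hdo⟩ := fin h.swap h2
        exact .inl (.inr ⟨o, ho, ((ih.mono (Set.sdiff_subset_sdiff_right
          Set.subset_union_left)).snoc hcd hdo.mem_left).trans hdo⟩)
      exact .inr (ih.snoc hcd ⟨hd, by simp [h1, h2]⟩)
  rcases key with (⟨o, ho, hao⟩ | ⟨o, ho, hao⟩) | hab
  · exact h.step_aux hr har haO ho hao
  · exact h.swap.step_aux hr har haO ho hao
  · exact h.step_aux hr har haO hb
      (hab.mono (Set.sdiff_subset_sdiff_right Set.subset_union_right))

/-- A connected set meeting `O` can be shrunk so as to meet `O` only once. -/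
lemma ConnSet.shrink (hP : ConnSet G P) (hc : c ∈ P) (ho : ∃ o ∈ P, o ∈ O) :
    ∃ P' ⊆ P, ConnSet G P' ∧ c ∈ P' ∧ ∃ o ∈ P', o ∈ O ∧ ∀ o' ∈ P', o' ∈ O → o' = o := by
  by_cases hcO : c ∈ O
  · exact ⟨{c}, by simpa, .of_base (x := c) (by rintro _ rfl; exact .refl rfl), rfl, c, rfl, hcO,
      fun _ h _ => h⟩
  obtain ⟨o, ho, hoO⟩ := ho
  obtain ⟨a, b, h1, h2, h3, h4, h5, h6⟩ := (hP c hc o ho).exit' (P := Oᶜ) hcO (by simpa)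
  refine ⟨insert b {z | Linked G (P ∩ Oᶜ) c z}, ?_, .of_base (x := c) ?_, .inr (.refl ⟨hc, hcO⟩),
    b, .inl rfl, by simpa using h4, ?_⟩
  · rintro z (rfl | hz)
    · exact h3
    · exact hz.mem_right.1
  · rintro z (rfl | hz)
    · exact (h6.component.mono (Set.subset_insert _ _)).snoc h5 (.inl rfl)
    · exact hz.component.mono (Set.subset_insert _ _)
  · rintro z (rfl | hz) hzO
    · rfl
    · exact (hz.mem_right.2 hzO).elim

/-- `E` carries an odd closed walk through `z`, where edges at `z` have parity `t`. -/
def OddEar (G : SimpleGraph V) (z : V) (t : V → Bool) (E : Set V) : Prop :=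
  ∃ g, BC G g E ∧ (∃ e ∈ E, G.Adj z e ∧ g e ≠ t e) ∧ ∃ e ∈ E, G.Adj z e ∧ g e = t e

lemma BC.xor (s : Bool) (h : BC G g A) : BC G (fun v => Bool.xor s (g v)) A :=
  h.congr fun _ _ _ _ _ hxy => by simpa using hxy

lemma oddEar_of_fan [Finite V] {P₁ P₂ : Set V} {o₁ o₂ c₁ c₂ : V}
    (hO : ∀ o₁ ∈ O, ∀ o₂ ∈ O, o₁ ≠ o₂ → ∀ s, ∃ g, BC G g O ∧ Bool.xor (g o₁) (g o₂) = s)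
    (hP₁ : ConnSet G P₁) (hP₂ : ConnSet G P₂) (hd : Disjoint P₁ P₂)
    (ho₁ : o₁ ∈ P₁) (ho₁O : o₁ ∈ O) (hu₁ : ∀ o ∈ P₁, o ∈ O → o = o₁)
    (ho₂ : o₂ ∈ P₂) (ho₂O : o₂ ∈ O) (hu₂ : ∀ o ∈ P₂, o ∈ O → o = o₂)
    (hc₁ : c₁ ∈ P₁) (hc₂ : c₂ ∈ P₂) (hz₁ : G.Adj z c₁) (hz₂ : G.Adj z c₂) :
    OddEar G z t (O ∪ P₁ ∪ P₂) := by
  classical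
  obtain ⟨g₁, -, hg₁⟩ := (BC.singleton (G := G) (fun _ => false) o₁).extend hP₁ (by simpa)
  obtain ⟨g₂, -, hg₂⟩ := (BC.singleton (G := G) (fun _ => false) o₂).extend hP₂ (by simpa)
  have hne : o₁ ≠ o₂ := fun h => Set.disjoint_left.1 hd ho₁ (h ▸ ho₂)
  obtain ⟨g, hg, hs⟩ := hO o₁ ho₁O o₂ ho₂O hne
    (!(Bool.xor (Bool.xor (Bool.xor (g₁ o₁) (g₁ c₁)) (t c₁))
      (Bool.xor (Bool.xor (g₂ o₂) (g₂ c₂)) (t c₂))))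
  set f : V → Bool := fun v => if v ∈ P₁ then Bool.xor (Bool.xor (g o₁) (g₁ o₁)) (g₁ v) else
    if v ∈ P₂ then Bool.xor (Bool.xor (g o₂) (g₂ o₂)) (g₂ v) else g v with hf
  have hf₁ : ∀ v ∈ P₁, f v = Bool.xor (Bool.xor (g o₁) (g₁ o₁)) (g₁ v) := fun v hv => by
    simp [hf, hv]
  have hf₂ : ∀ v ∈ P₂, f v = Bool.xor (Bool.xor (g o₂) (g₂ o₂)) (g₂ v) := fun v hv => by
    simp [hf, hv, Set.disjoint_right.1 hd hv]
  have hfO : ∀ v ∈ O, f v = g v := fun v hv => by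
    by_cases h1 : v ∈ P₁
    · rw [hf₁ v h1, hu₁ v h1 hv]; simp
    by_cases h2 : v ∈ P₂
    · rw [hf₂ v h2, hu₂ v h2 hv]; simp
    simp [hf, h1, h2]
  have b₁ : BC G f P₁ := (hg₁.xor (Bool.xor (g o₁) (g₁ o₁))).congr fun x hx y hy _ hxy => by
    rwa [hf₁ x hx, hf₁ y hy]
  have b₂ : BC G f P₂ := (hg₂.xor (Bool.xor (g o₂) (g₂ o₂))).congr fun x hx y hy _ hxy => by
    rwa [hf₂ x hx, hf₂ y hy]
  have bO : BC G f O := hg.congr fun x hx y hy _ hxy => by rwa [hfO x hx, hfO y hy]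
  have hbc : BC G f (O ∪ P₁ ∪ P₂) := by
    refine ⟨⟨o₁, .inl (.inl ho₁O)⟩, .of_base (x := o₁) ?_⟩
    have hO' : ∀ y ∈ O, Linked (bi G f) (O ∪ P₁ ∪ P₂) o₁ y := fun y hy =>
      (bO.2 o₁ ho₁O y hy).mono fun z hz => .inl (.inl hz)
    rintro y ((hy | hy) | hy)
    · exact hO' y hy
    · exact (b₁.2 o₁ ho₁ y hy).mono fun z hz => .inl (.inr hz)
    · exact (hO' o₂ ho₂O).trans ((b₂.2 o₂ ho₂ y hy).mono fun z hz => .inr hz)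
  have hm₁ : c₁ ∈ O ∪ P₁ ∪ P₂ := .inl (.inr hc₁)
  have hm₂ : c₂ ∈ O ∪ P₁ ∪ P₂ := .inr hc₂
  have hx : Bool.xor (Bool.xor (f c₁) (t c₁)) (Bool.xor (f c₂) (t c₂)) = true := by
    rw [hf₁ c₁ hc₁, hf₂ c₂ hc₂]
    revert hs
    generalize g o₁ = b1; generalize g o₂ = b2; generalize g₁ o₁ = b3; generalize g₂ o₂ = b4
    generalize g₁ c₁ = b5; generalize g₂ c₂ = b6; generalize t c₁ = b7; generalize t c₂ = b8
    revert b1 b2 b3 b4 b5 b6 b7 b8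
    decide
  refine ⟨f, hbc, ?_⟩
  by_cases h1 : f c₁ = t c₁
  · exact ⟨⟨c₂, hm₂, hz₂, fun h2 => by simp [h1, h2] at hx⟩, c₁, hm₁, hz₁, h1⟩
  · refine ⟨⟨c₁, hm₁, hz₁, h1⟩, c₂, hm₂, hz₂, ?_⟩
    revert hx h1
    generalize f c₁ = b1; generalize t c₁ = b2; generalize f c₂ = b3; generalize t c₂ = b4
    revert b1 b2 b3 b4
    decide

end Fan

section BadEdge

variable {V : Type*} {G : SimpleGraph V} {z : V} {Q : Set V} {δ : V → ℕ} {par : V → V}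
  {g t : V → Bool} {x y p : V}

/-- A monochromatic edge `xy` in a breadth first coloring; `p` is the last common ancestor. -/
structure BadEdge (G : SimpleGraph V) (z : V) (Q : Set V) (δ : V → ℕ) (par : V → V)
    (g : V → Bool) (x y p : V) : Prop where
  bfs : Bfs G.Adj {z} Q δ par
  col : ∀ v ∈ Q, 1 < δ v → g (par v) ≠ g v
  memx : x ∈ Q
  memy : y ∈ Q
  adj : G.Adj x y
  bad : g x = g y
  notx : x ∉ branch δ par y
  noty : y ∉ branch δ par x
  px : p ∈ branch δ par x
  py : p ∈ branch δ par y
  top : ∀ v ∈ branch δ par x, v ∈ branch δ par y → v ∈ branch δ par p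

/-- The odd cycle closed by a bad edge. -/
def oddCycle (δ : V → ℕ) (par : V → V) (x y p : V) : Set V :=
  tail δ par x (δ p) ∪ tail δ par y (δ p)

lemma Bfs.root {G : SimpleGraph V} (h : Bfs G.Adj {z} Q δ par) {v : V}
    (hv : v ∈ Q) : z ∈ branch δ par v := by
  obtain ⟨w, hw, hw0⟩ := h.branch_level hv (Nat.zero_le _)
  rwa [← Set.mem_singleton_iff.1 ((h.zero w (h.branch_sub hv hw)).1 hw0)]

lemma exists_badEdge (h : Bfs G.Adj {z} Q δ par)
    (hcol : ∀ v ∈ Q, 1 < δ v → g (par v) ≠ g v) (hx : x ∈ Q) (hy : y ∈ Q) (hxz : x ≠ z)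
    (hyz : y ≠ z) (hadj : G.Adj x y) (hbad : g x = g y) :
    ∃ p, BadEdge G z Q δ par g x y p := by
  have not : ∀ {x y : V}, x ∈ Q → y ∈ Q → x ≠ z → G.Adj x y → g x = g y → x ∉ branch δ par y := by
    intro x y hx hy hxz hadj hbad hxy
    obtain ⟨w, hw, rfl, hwx⟩ := h.branch_child hy hxy hadj.ne
    have h1 := h.lip _ hx _ hadj
    have h2 := h.branch_le hy hw
    obtain rfl := h.branch_inj hy hw mem_branch_self (by omega)
    have h3 : δ (par w) ≠ 0 := fun h0 => hxz ((h.zero _ hx).1 h0)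
    exact hcol w hy (by omega) hbad
  let S : Set ℕ := {n | ∃ v ∈ branch δ par x, v ∈ branch δ par y ∧ δ v = n}
  have hS : S.Nonempty := ⟨_, z, h.root hx, h.root hy, rfl⟩
  have hSb : BddAbove S := ⟨δ x, fun n ⟨v, hv, _, hn⟩ => hn ▸ h.branch_le hx hv⟩
  obtain ⟨p, hpx, hpy, hp⟩ := Nat.sSup_mem hS hSb
  refine ⟨p, h, hcol, hx, hy, hadj, hbad, not hx hy hxz hadj hbad,
    not hy hx hyz hadj.symm hbad.symm, hpx, hpy, fun v hvx hvy => ?_⟩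
  have h1 : δ v ≤ δ p := hp ▸ le_csSup hSb ⟨v, hvx, hvy, rfl⟩
  obtain ⟨w, hw, hwv⟩ := h.branch_level (h.branch_sub hx hpx) h1
  rwa [← h.branch_inj hx (h.branch_trans hx hpx hw) hvx hwv]

namespace BadEdge

lemma swap (h : BadEdge G z Q δ par g x y p) : BadEdge G z Q δ par g y x p :=
  ⟨h.bfs, h.col, h.memy, h.memx, h.adj.symm, h.bad.symm, h.noty, h.notx, h.py, h.px,
    fun v h1 h2 => h.top v h2 h1⟩

variable (h : BadEdge G z Q δ par g x y p)
include h

lemma memp : p ∈ Q := h.bfs.branch_sub h.memx h.px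

lemma mem_iff {v : V} (hv : v ∈ branch δ par x) : v ∈ branch δ par p ↔ δ v ≤ δ p := by
  refine ⟨fun hvp => h.bfs.branch_le h.memp hvp, fun hle => ?_⟩
  obtain ⟨w, hw, hwv⟩ := h.bfs.branch_level h.memp hle
  rwa [← h.bfs.branch_inj h.memx (h.bfs.branch_trans h.memx h.px hw) hv hwv]

lemma lt_x : δ p < δ x := by
  by_contra hlt
  exact h.notx (h.bfs.branch_trans h.memy h.py ((h.mem_iff mem_branch_self).2 (not_lt.1 hlt)))

lemma disj_tail {v : V} (hx : v ∈ branch δ par x) (hy : v ∈ branch δ par y) : δ v ≤ δ p :=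
  (h.mem_iff hx).1 (h.top v hx hy)

lemma linked_tail {v w : V} {j : ℕ} (hj : 1 ≤ j) (hw : w ∈ Q) (hv : v ∈ tail δ par w j) :
    Linked (bi G g) (tail δ par w j) w v :=
  h.bfs.linked_tail (K := bi G g) hw
    (fun w hw hjw => ⟨h.bfs.par_rel w hw (by omega), h.col w hw (by omega)⟩) hv

lemma linked_cycle (hp : 1 ≤ δ p) {v : V} (hv : v ∈ oddCycle δ par x y p) :
    Linked (bi G g) (tail δ par v (δ p)) v p := by
  have key : ∀ {x y : V}, BadEdge G z Q δ par g x y p → v ∈ tail δ par x (δ p) →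
      Linked (bi G g) (tail δ par v (δ p)) v p := by
    intro x y h hv
    refine h.linked_tail hp (h.bfs.branch_sub h.memx hv.1) ⟨?_, le_rfl⟩
    obtain ⟨w, hw, hwv⟩ := h.bfs.branch_level (h.bfs.branch_sub h.memx hv.1) hv.2
    rwa [← h.bfs.branch_inj h.memx (h.bfs.branch_trans h.memx hv.1 hw) h.px hwv]
  exact hv.elim (key h) (key h.swap)

lemma tail_sub_cycle {v : V} (hv : v ∈ oddCycle δ par x y p) :
    tail δ par v (δ p) ⊆ oddCycle δ par x y p := fun _ hw =>
  hv.imp (fun hv => ⟨h.bfs.branch_trans h.memx hv.1 hw.1, hw.2⟩)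
    fun hv => ⟨h.bfs.branch_trans h.memy hv.1 hw.1, hw.2⟩

lemma bc_cycle (hp : 1 ≤ δ p) : BC G g (oddCycle δ par x y p) :=
  ⟨⟨p, .inl ⟨h.px, le_rfl⟩⟩, .of_base (x := p) fun _ hv =>
    ((h.linked_cycle hp hv).mono (h.tail_sub_cycle hv)).symm⟩

lemma flip_cycle (hp : 1 ≤ δ p) {o o' : V} (ho : o ∈ branch δ par x) (hpo : δ p < δ o)
    (ho'o : δ o' ≤ δ o) (hne : o ≠ o') :
    ∃ g', BC G g' (oddCycle δ par x y p) ∧ g' o = !g o ∧ g' o' = g o' := by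
  classical
  set T := tail δ par x (δ o) with hT
  set g' : V → Bool := fun v => if v ∈ T then !g v else g v with hg'
  have h1 : ∀ v ∈ T, g' v = !g v := fun v hv => if_pos hv
  have h0 : ∀ v, v ∉ T → g' v = g v := fun v hv => if_neg hv
  have hyT : ∀ v ∈ branch δ par y, v ∉ T := fun v hv hvT => by
    have := h.disj_tail hvT.1 hv
    have := hvT.2
    omega
  have hxT : x ∈ T := ⟨mem_branch_self, h.bfs.branch_le h.memx ho⟩
  have hTsub : T ⊆ oddCycle δ par x y p := fun v hv => .inl ⟨hv.1, hpo.le.trans hv.2⟩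
  have hlow : ∀ v ∈ oddCycle δ par x y p, v ∉ T →
      Linked (bi G g') (oddCycle δ par x y p) v p := by
    intro v hv hvT
    have hd : ∀ w ∈ tail δ par v (δ p), w ∉ T := by
      intro w hw hwT
      rcases hv with hv | hv
      · exact hvT ⟨hv.1, hwT.2.trans (h.bfs.branch_le (h.bfs.branch_sub h.memx hv.1) hw.1)⟩
      · exact hyT w (h.bfs.branch_trans h.memy hv.1 hw.1) hwT
    refine ((h.linked_cycle hp hv).map (G' := bi G g') fun a ha b hb hab => ⟨hab.1, ?_⟩).mono
      (h.tail_sub_cycle hv)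
    rw [h0 a (hd a ha), h0 b (hd b hb)]
    exact hab.2
  have hymem : y ∈ oddCycle δ par x y p := .inr ⟨mem_branch_self, h.swap.lt_x.le⟩
  refine ⟨g', ⟨⟨p, .inl ⟨h.px, le_rfl⟩⟩, .of_base (x := p) fun v hv => ?_⟩, h1 o ⟨ho, le_rfl⟩,
    h0 o' fun ho' => hne (h.bfs.branch_inj h.memx ho ho'.1 (le_antisymm ho'.2 ho'o))⟩
  by_cases hvT : v ∈ T
  · have h2 := hlow y hymem (hyT y mem_branch_self)
    have h3 : Linked (bi G g') (oddCycle δ par x y p) x v :=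
      ((h.linked_tail (by omega) h.memx hvT).map (G' := bi G g')
        fun a ha b hb hab => ⟨hab.1, by rw [h1 a ha, h1 b hb]; simpa using hab.2⟩).mono hTsub
    refine (h2.symm.snoc ⟨h.adj.symm, ?_⟩ (hTsub hxT)).trans h3
    rw [h1 x hxT, h0 y (hyT y mem_branch_self), h.bad]
    simp
  · exact (hlow v hv hvT).symm

lemma cycle_odd (hp : 1 ≤ δ p) {o o' : V} (ho : o ∈ oddCycle δ par x y p)
    (ho' : o' ∈ oddCycle δ par x y p) (hne : o ≠ o') (s : Bool) :
    ∃ g', BC G g' (oddCycle δ par x y p) ∧ Bool.xor (g' o) (g' o') = s := by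
  by_cases hs : Bool.xor (g o) (g o') = s
  · exact ⟨g, h.bc_cycle hp, hs⟩
  have key : ∀ {x y o o' : V}, BadEdge G z Q δ par g x y p → o ∈ tail δ par x (δ p) →
      δ p ≤ δ o' → δ o' ≤ δ o → o ≠ o' → o' ∈ oddCycle δ par x y p →
      ∃ g', BC G g' (oddCycle δ par x y p) ∧ g' o = !g o ∧ g' o' = g o' := by
    intro x y o o' h ho h1 h2 hne ho'
    refine h.flip_cycle hp ho.1 (lt_of_le_of_ne ho.2 fun heq => hne ?_) h2 hne
    have e1 := h.bfs.branch_inj h.memx ho.1 h.px heq.symm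
    have e2 : o' = p := ho'.elim
      (fun ho' => h.bfs.branch_inj h.memx ho'.1 h.px (by omega))
      (fun ho' => h.bfs.branch_inj h.memy ho'.1 h.py (by omega))
    rw [e1, e2]
  have hcomm : oddCycle δ par y x p = oddCycle δ par x y p := Set.union_comm _ _
  have key' : ∀ {o o' : V}, o ∈ oddCycle δ par x y p → o' ∈ oddCycle δ par x y p → δ o' ≤ δ o →
      o ≠ o' → ∃ g', BC G g' (oddCycle δ par x y p) ∧ g' o = !g o ∧ g' o' = g o' := by
    intro o o' ho ho' hle hne
    have hpo : δ p ≤ δ o' := ho'.elim (fun h => h.2) fun h => h.2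
    rcases ho with ho | ho
    · exact key h ho hpo hle hne ho'
    · simpa only [hcomm] using key h.swap ho hpo hle hne (by rwa [hcomm])
  rcases le_total (δ o') (δ o) with hle | hle
  · obtain ⟨g', hg', e1, e2⟩ := key' ho ho' hle hne
    refine ⟨g', hg', ?_⟩
    rw [e1, e2]
    cases h1 : g o <;> cases h2 : g o' <;> cases s <;> simp_all
  · obtain ⟨g', hg', e1, e2⟩ := key' ho' ho hle hne.symm
    refine ⟨g', hg', ?_⟩
    rw [e1, e2]
    cases h1 : g o <;> cases h2 : g o' <;> cases s <;> simp_all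

/-- If the common ancestor is the root, the two branches form an odd ear. -/
lemma oddEar_of_root (ht : ∀ v ∈ Q, δ v = 1 → g v ≠ t v) (hp : δ p = 0) :
    OddEar G z t (tail δ par x 1 ∪ tail δ par y 1) := by
  classical
  set g' : V → Bool := fun v => if v ∈ tail δ par y 1 then !g v else g v with hg'
  have h1 : ∀ v ∈ tail δ par y 1, g' v = !g v := fun v hv => if_pos hv
  have h0 : ∀ v ∈ tail δ par x 1, g' v = g v := fun v hv => if_neg fun hvy => by
    have := h.disj_tail hv.1 hvy.1
    have := hv.2
    omega
  have hx : x ∈ tail δ par x 1 := ⟨mem_branch_self, by have := h.lt_x; omega⟩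
  have hy : y ∈ tail δ par y 1 := ⟨mem_branch_self, by have := h.swap.lt_x; omega⟩
  have bx : BC G g' (tail δ par x 1) := ⟨⟨x, hx⟩, .of_base (x := x) fun v hv =>
    (h.linked_tail le_rfl h.memx hv).map fun a ha b hb hab =>
      ⟨hab.1, by rw [h0 a ha, h0 b hb]; exact hab.2⟩⟩
  have bY : BC G g' (tail δ par y 1) := ⟨⟨y, hy⟩, .of_base (x := y) fun v hv =>
    (h.linked_tail le_rfl h.memy hv).map fun a ha b hb hab =>
      ⟨hab.1, by rw [h1 a ha, h1 b hb]; simpa using hab.2⟩⟩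
  have contact : ∀ v ∈ Q, δ v = 1 → G.Adj z v := fun v hv hv1 => by
    have h2 := h.bfs.par_rel v hv (by omega)
    have h3 := h.bfs.par_lev v hv (by omega)
    rwa [Set.mem_singleton_iff.1 ((h.bfs.zero _ (h.bfs.par_mem v hv (by omega))).1 (by omega))]
      at h2
  obtain ⟨a, ha, ha1⟩ := h.bfs.branch_level h.memx hx.2
  obtain ⟨b, hb, hb1⟩ := h.bfs.branch_level h.memy hy.2
  have hca := contact a (h.bfs.branch_sub h.memx ha) ha1
  have hcb := contact b (h.bfs.branch_sub h.memy hb) hb1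
  refine ⟨g', bx.union bY hx hy h.adj (by rw [h0 x hx, h1 y hy, h.bad]; simp),
    ⟨a, .inl ⟨ha, ha1.ge⟩, hca, ?_⟩, b, .inr ⟨hb, hb1.ge⟩, hcb, ?_⟩
  · rw [h0 a ⟨ha, ha1.ge⟩]
    exact ht a (h.bfs.branch_sub h.memx ha) ha1
  · rw [h1 b ⟨hb, hb1.ge⟩]
    have := ht b (h.bfs.branch_sub h.memy hb) hb1
    cases h2 : g b <;> cases h3 : t b <;> simp_all

end BadEdge

end BadEdge

section Ear

variable {V : Type*} {G : SimpleGraph V} {z : V} {Q : Set V} {δ : V → ℕ} {par : V → V}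
  {g t : V → Bool} {x y p : V}

/-- `v` is attached at level `i` of the common part of the branches of `x` and `y`, or at level
`δ p + 1` to the rest of the two branches. -/
def Attached (G : SimpleGraph V) (δ : V → ℕ) (par : V → V) (x y p : V) (i : ℕ) (v : V) : Prop :=
  (∃ s ∈ branch δ par p, δ s = i ∧ G.Adj v s) ∨
    (i = δ p + 1 ∧ ∃ o ∈ branch δ par x ∪ branch δ par y, o ∉ branch δ par p ∧ G.Adj v o)

/-- A step avoiding the two branches: an edge or a jump back along the common part. -/
def Step (G : SimpleGraph V) (δ : V → ℕ) (par : V → V) (x y p : V) (a b : V) : Prop :=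
  a ∉ branch δ par x ∪ branch δ par y ∧ b ∉ branch δ par x ∪ branch δ par y ∧
    (G.Adj a b ∨ ∃ i i', i < i' ∧ Attached G δ par x y p i b ∧ Attached G δ par x y p i' a)

/-- The vertices off the two branches that are attached to the root. -/
def Start (G : SimpleGraph V) (δ : V → ℕ) (par : V → V) (x y p : V) : Set V :=
  {v | v ∉ branch δ par x ∪ branch δ par y ∧ Attached G δ par x y p 0 v}

lemma OddEar.sub {E : Set V} (h : OddEar G z t E) (hz : z ∈ Q)
    (hQ : ∀ a ∈ Q, ∀ b, G.Adj a b → b ∈ Q) : E ⊆ Q := fun v hv => by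
  obtain ⟨g, hg, ⟨e, he, hze, -⟩, -⟩ := h
  exact (hg.2 e he v hv).induct (hQ z hz e hze) fun a b _ ha hab _ => hQ a ha b hab.1

lemma notMem_of_bfs {Q' : Set V} {δ' : V → ℕ} {par' : V → V}
    (hb : Bfs (Step G δ par x y p) (Start G δ par x y p) Q' δ' par') {v : V}
    (hv : v ∈ Q') : v ∉ branch δ par x ∪ branch δ par y := by
  by_cases h0 : δ' v = 0
  · exact ((hb.zero v hv).1 h0).1
  · exact (hb.par_rel v hv h0).2.1

namespace BadEdge

variable {Q' : Set V} {δ' : V → ℕ} {par' : V → V} {e r : V}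
variable (h : BadEdge G z Q δ par g x y p)
include h

lemma lt_of_notMem {o : V} (ho : o ∈ branch δ par x ∪ branch δ par y) (hop : o ∉ branch δ par p) :
    δ p < δ o := by
  by_contra hlt
  exact ho.elim (fun ho => hop ((h.mem_iff ho).2 (not_lt.1 hlt)))
    fun ho => hop ((h.swap.mem_iff ho).2 (not_lt.1 hlt))

lemma branch_p_sub : branch δ par p ⊆ branch δ par x ∪ branch δ par y := fun _ hv =>
  .inl (h.bfs.branch_trans h.memx h.px hv)

lemma exists_attached (hp : 1 ≤ δ p)
    (hb : Bfs (Step G δ par x y p) (Start G δ par x y p) Q' δ' par')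
    (hx : ∀ v, v ≠ x → v ≠ z → Linked G {v}ᶜ z x) :
    ∃ e ∈ Q', Attached G δ par x y p (δ p + 1) e := by
  by_contra! hno
  let S : Set ℕ := {i | i = 1 ∨ ∃ e ∈ Q', Attached G δ par x y p i e}
  have hSp : ∀ i ∈ S, i ≤ δ p := by
    rintro i (rfl | ⟨e, he, ⟨s, hs, rfl, -⟩ | hi⟩)
    · exact hp
    · exact h.bfs.branch_le h.memp hs
    · exact (hno e he (hi.1 ▸ .inr hi)).elim
  have hSb : BddAbove S := ⟨δ p, hSp⟩
  have hS : S.Nonempty := ⟨1, .inl rfl⟩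
  obtain ⟨t, ht, hmax⟩ : ∃ t ∈ S, ∀ i ∈ S, i ≤ t :=
    ⟨sSup S, Nat.sSup_mem hS hSb, fun i hi => le_csSup hSb hi⟩
  have htp := hSp t ht
  have ht1 := hmax 1 (.inl rfl)
  obtain ⟨r, hr, hrt⟩ := h.bfs.branch_level h.memp htp
  have hz0 : δ z = 0 := (h.bfs.zero z (h.bfs.sub rfl)).2 rfl
  have hrx : r ≠ x := fun hrx => by have := h.lt_x; rw [← hrx] at this; omega
  have hrz : r ≠ z := fun hrz => by rw [hrz] at hrt; omega
  have hinj : ∀ b ∈ branch δ par p, b ≠ r → δ b ≤ t → δ b < t := fun b hb hbr hle =>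
    lt_of_le_of_ne hle fun heq => hbr (h.bfs.branch_inj h.memp hb hr (by omega))
  have key : (x ∈ branch δ par p ∧ δ x < t) ∨ x ∈ Q' := by
    refine (hx r hrx hrz).induct (Q := fun v => (v ∈ branch δ par p ∧ δ v < t) ∨ v ∈ Q')
      (.inl ⟨h.bfs.root h.memp, by omega⟩) ?_
    rintro a b - (⟨ha, hat⟩ | ha) hab hbr
    · have haQ := h.bfs.branch_sub h.memp ha
      have hl := h.bfs.lip a haQ b hab
      by_cases hbp : b ∈ branch δ par p
      · exact .inl ⟨hbp, hinj b hbp hbr (by omega)⟩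
      have hbJ : b ∉ branch δ par x ∪ branch δ par y := fun hbJ => by
        have := h.lt_of_notMem hbJ hbp
        omega
      have hatt : Attached G δ par x y p (δ a) b := .inl ⟨a, ha, rfl, hab.symm⟩
      by_cases ha0 : δ a = 0
      · exact .inr (hb.sub ⟨hbJ, ha0 ▸ hatt⟩)
      · rcases ht with rfl | ⟨e, he, hte⟩
        · omega
        · exact .inr (hb.closed e he b ⟨notMem_of_bfs hb he, hbJ, .inr ⟨_, _, hat, hatt, hte⟩⟩)
    · by_cases hbp : b ∈ branch δ par p
      · exact .inl ⟨hbp, hinj b hbp hbr (hmax _ (.inr ⟨a, ha, .inl ⟨b, hbp, rfl, hab⟩⟩))⟩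
      have hbJ : b ∉ branch δ par x ∪ branch δ par y := fun hbJ =>
        hno a ha (.inr ⟨rfl, b, hbJ, hbp, hab⟩)
      exact .inr (hb.closed a ha b ⟨notMem_of_bfs hb ha, hbJ, .inl hab⟩)
  rcases key with ⟨-, hlt⟩ | hxQ
  · have := h.lt_x
    omega
  · exact notMem_of_bfs hb hxQ (.inl mem_branch_self)

lemma linked_root {v : V} (hv : v ∈ branch δ par x ∪ branch δ par y) {A : Set V}
    (hA : ∀ w ∈ branch δ par x ∪ branch δ par y, δ w ≤ δ v → w ∈ A) : Linked G A z v := by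
  have hvQ : v ∈ Q := hv.elim (h.bfs.branch_sub h.memx) (h.bfs.branch_sub h.memy)
  have h1 := h.bfs.linked_tail (K := G) hvQ (j := 0) (fun w hw hj => h.bfs.par_rel w hw (by omega))
    ⟨h.bfs.root hvQ, Nat.zero_le _⟩
  refine h1.symm.mono fun w hw => hA w ?_ (h.bfs.branch_le hvQ hw.1)
  exact hv.imp (fun hv => h.bfs.branch_trans h.memx hv hw.1)
    fun hv => h.bfs.branch_trans h.memy hv hw.1

lemma exists_linked (hb : Bfs (Step G δ par x y p) (Start G δ par x y p) Q' δ' par')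
    (he : e ∈ Q') (hea : Attached G δ par x y p (δ p + 1) e) (hr : r ∈ branch δ par p)
    (hr0 : 1 ≤ δ r) :
    ∃ o ∈ branch δ par x ∪ branch δ par y, o ∉ branch δ par p ∧
      Linked G ((branch δ par x ∪ branch δ par y ∪ branch δ' par' e) \ {r}) z o := by
  set A := (branch δ par x ∪ branch δ par y ∪ branch δ' par' e) \ {r} with hA
  by_contra! hno
  have hrp := h.bfs.branch_le h.memp hr
  have hnot : ∀ {u o : V}, o ∈ branch δ par x ∪ branch δ par y → o ∉ branch δ par p →
      G.Adj u o → ¬ Linked G A z u := fun ho hop huo hu =>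
    hno _ ho hop (hu.snoc huo ⟨.inl ho, fun h => hop (h ▸ hr)⟩)
  have key : ∀ n, ∀ v ∈ branch δ' par' e, δ' v = n → Linked G A z v := by
    intro n
    induction n with
    | zero =>
      intro v hv hv0
      have hvQ := hb.branch_sub he hv
      have hvA : v ∈ A := ⟨.inr hv, fun h' => notMem_of_bfs hb hvQ (h.branch_p_sub (h' ▸ hr))⟩
      obtain ⟨-, ⟨s, hs, hs0, hvs⟩ | hK⟩ := (hb.zero v hvQ).1 hv0
      · exact (h.linked_root (h.branch_p_sub hs) (A := A) fun w hw hws =>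
          ⟨.inl hw, fun hwr => by rw [hwr] at hws; omega⟩).snoc hvs.symm hvA
      · omega
    | succ n ih =>
      intro v hv hvn
      have hvQ := hb.branch_sub he hv
      have hvA : v ∈ A := ⟨.inr hv, fun h' => notMem_of_bfs hb hvQ (h.branch_p_sub (h' ▸ hr))⟩
      have hl := hb.par_lev v hvQ (by omega)
      have hu := ih _ (hb.branch_par he hv (by omega)) (by omega)
      obtain ⟨-, -, huv | ⟨i, i', hi, hiv, hiu⟩⟩ := hb.par_rel v hvQ (by omega)
      · exact hu.snoc huv hvA
      by_cases hir : i < δ r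
      · rcases hiv with ⟨s, hs, rfl, hvs⟩ | hK
        · exact (h.linked_root (h.branch_p_sub hs) (A := A) fun w hw hws =>
            ⟨.inl hw, fun hwr => by rw [hwr] at hws; omega⟩).snoc hvs.symm hvA
        · omega
      · rcases hiu with ⟨s, hs, rfl, hus⟩ | ⟨-, o, ho, hop, huo⟩
        · have htail : tail δ par x (δ s) ⊆ A := fun w hw =>
            ⟨.inl (.inl hw.1), fun hwr => by have := hw.2; rw [hwr] at this; omega⟩
          have hsx := h.bfs.branch_trans h.memx h.px hs
          have h1 := h.bfs.linked_tail (K := G) h.memx (j := δ s)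
            (fun w hw hj => h.bfs.par_rel w hw (by omega)) ⟨hsx, le_rfl⟩
          refine (hno x (.inl mem_branch_self) (fun hxp => ?_)
            ((hu.snoc hus (htail ⟨hsx, le_rfl⟩)).trans (h1.symm.mono htail))).elim
          exact absurd (h.bfs.branch_le h.memp hxp) (not_le.2 h.lt_x)
        · exact (hnot ho hop huo hu).elim
  rcases hea with ⟨s, hs, hsp, -⟩ | ⟨-, o, ho, hop, heo⟩
  · have := h.bfs.branch_le h.memp hs
    omega
  · exact hnot ho hop heo (key _ e mem_branch_self rfl)

lemma exists_fan (hb : Bfs (Step G δ par x y p) (Start G δ par x y p) Q' δ' par')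
    (he : e ∈ Q') (hea : Attached G δ par x y p (δ p + 1) e) (i : ℕ) (hi : i ≤ δ p) :
    ∃ Q₁ Q₂, Fan G (branch δ par x ∪ branch δ par y ∪ branch δ' par' e)
      (oddCycle δ par x y p) (par^[i] p) Q₁ Q₂ := by
  induction i with
  | zero =>
    have conn : ∀ {w : V}, w ∈ Q → ConnSet G (tail δ par w (δ p + 1)) := fun hw =>
      .of_base fun v hv => h.bfs.linked_tail (K := G) hw
        (fun w hw hj => h.bfs.par_rel w hw (by omega)) hv
    have adj : ∀ {x y : V}, BadEdge G z Q δ par g x y p →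
        ∃ q ∈ tail δ par x (δ p + 1), G.Adj p q := fun h => by
      obtain ⟨q, hq, rfl, hqp⟩ := h.bfs.branch_child h.memx h.px fun hpx => by
        have := h.lt_x; rw [hpx] at this; omega
      exact ⟨q, ⟨hq, hqp.ge⟩, h.bfs.par_rel q (h.bfs.branch_sub h.memx hq) (by omega)⟩
    refine ⟨tail δ par x (δ p + 1), tail δ par y (δ p + 1), fun v hv => .inl (.inl hv.1),
      fun v hv => .inl (.inr hv.1), Set.disjoint_left.2 fun v hv hv' => ?_, conn h.memx,
      conn h.memy, fun hv => ?_, fun hv => ?_, adj h, adj h.swap,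
      ⟨x, ⟨mem_branch_self, h.lt_x⟩, .inl ⟨mem_branch_self, h.lt_x.le⟩⟩,
      ⟨y, ⟨mem_branch_self, h.swap.lt_x⟩, .inr ⟨mem_branch_self, h.swap.lt_x.le⟩⟩⟩
    · have := h.disj_tail hv.1 hv'.1
      have := hv.2
      omega
    · exact absurd hv.2 (by simp)
    · exact absurd hv.2 (by simp)
  | succ i ih =>
    obtain ⟨Q₁, Q₂, hF⟩ := ih (by omega)
    have hr : par^[i] p ∈ branch δ par p := ⟨i, by omega, rfl⟩
    have hrQ := (h.bfs.iterate h.memp i (by omega)).1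
    have hri := (h.bfs.iterate h.memp i (by omega)).2
    rw [Function.iterate_succ_apply']
    set r := par^[i] p with hrdef
    have hl := h.bfs.par_lev r hrQ (by omega)
    obtain ⟨o, ho, hop, hzo⟩ := h.exists_linked hb he hea hr (by omega)
    have hpo := h.lt_of_notMem ho hop
    have ha := h.branch_p_sub (h.bfs.branch_par h.memp hr (by omega))
    refine hF.step (.inl (h.branch_p_sub hr)) (h.bfs.par_rel r hrQ (by omega)) ?_
      (b := o) (ho.imp (fun ho => ⟨ho, hpo.le⟩) fun ho => ⟨ho, hpo.le⟩)
      ((h.linked_root ha (A := (branch δ par x ∪ branch δ par y ∪ branch δ' par' e) \ {r})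
        fun w hw hwa => ⟨.inl hw, fun hwr => by rw [hwr] at hwa; omega⟩).symm.trans hzo)
    rintro (hO | hO) <;> · have := hO.2; omega

end BadEdge

/-- The control function of ears. -/
def earCtl : ℕ → ℕ :=
  extendCtl (fun s => s * s) (extendCtl (fun s => s * s) (fun s => s * s))

lemma oneDim_three {A E X₁ X₂ X₃ : Set V} (hE : E ⊆ X₁ ∪ X₂ ∪ X₃)
    (h₁ : ∀ B ⊆ A, OneDim G B (X₁ ∩ B) (fun s => s * s))
    (h₂ : ∀ B ⊆ A, OneDim G B (X₂ ∩ B) (fun s => s * s))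
    (h₃ : ∀ B ⊆ A, (∀ v ∈ B, v ∉ X₁ ∪ X₂) → OneDim G B (X₃ ∩ B) (fun s => s * s)) :
    OneDim G A (E ∩ A) earCtl := by
  refine ((h₁ A subset_rfl).extend ((h₂ _ Set.sdiff_subset).extend (h₃ _
    (Set.sdiff_subset.trans Set.sdiff_subset) fun v hv hv' => ?_))).mono (fun v hv => ?_)
    fun _ => le_rfl
  · obtain ⟨⟨h1, h2⟩, h3⟩ := hv
    rcases hv' with h4 | h4
    · exact h2 ⟨h4, h1⟩
    · exact h3 ⟨h4, h1, h2⟩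
  · have := hv.2
    have := hE hv.1
    simp only [Set.mem_union, Set.mem_inter_iff, Set.mem_sdiff] at this ⊢
    tauto

lemma oneDim_sq_empty {A : Set V} : OneDim G A (∅ ∩ A) (fun s => s * s) := fun _ =>
  ⟨fun _ => false, fun _ hx => hx.1.elim⟩

/-- A bad edge at a vertex that no other vertex separates from the root yields an odd ear. -/
lemma BadEdge.exists_oddEar [Finite V] (h : BadEdge G z Q δ par g x y p)
    (ht : ∀ v ∈ Q, δ v = 1 → g v ≠ t v) (hx : ∀ v, v ≠ x → v ≠ z → Linked G {v}ᶜ z x) :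
    ∃ E, z ∉ E ∧ E ⊆ Q ∧ OddEar G z t E ∧ ∀ (K : SimpleGraph V) (A : Set V),
      (∀ a ∈ A, ∀ b ∈ A, K.Adj a b → G.Adj a b) → OneDim K A (E ∩ A) earCtl := by
  have hz0 : δ z = 0 := (h.bfs.zero z (h.bfs.sub rfl)).2 rfl
  rcases Nat.eq_zero_or_pos (δ p) with hp | hp
  · have hear := h.oddEar_of_root ht hp
    refine ⟨_, ?_, hear.sub (h.bfs.sub rfl) h.bfs.closed, hear, fun K A hK => ?_⟩
    · rintro (hz | hz) <;> · have := hz.2; omega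
    · refine oneDim_three (X₁ := branch δ par x) (X₂ := branch δ par y) (X₃ := ∅) ?_
        (fun B hB => h.bfs.oneDim_branch h.memx fun a ha b hb _ => hK a (hB ha) b (hB hb))
        (fun B hB => h.bfs.oneDim_branch h.memy fun a ha b hb _ => hK a (hB ha) b (hB hb))
        fun _ _ _ => oneDim_sq_empty
      exact fun v hv => .inl (hv.imp And.left And.left)
  · obtain ⟨Q', δ', par', hb⟩ := exists_bfs (Step G δ par x y p) (Start G δ par x y p)
    obtain ⟨e, he, hea⟩ := h.exists_attached hp hb hx
    obtain ⟨Q₁, Q₂, hF⟩ := h.exists_fan hb he hea (δ p) le_rfl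
    have hroot : par^[δ p] p = z := by
      have := h.bfs.iterate h.memp (δ p) le_rfl
      exact (h.bfs.zero _ this.1).1 (by omega)
    rw [hroot] at hF
    obtain ⟨c₁, hc₁, hz₁⟩ := hF.adj₁
    obtain ⟨c₂, hc₂, hz₂⟩ := hF.adj₂
    obtain ⟨P₁, hPQ₁, hP₁, hcP₁, o₁, ho₁, ho₁O, hu₁⟩ := hF.conn₁.shrink hc₁ hF.meet₁
    obtain ⟨P₂, hPQ₂, hP₂, hcP₂, o₂, ho₂, ho₂O, hu₂⟩ := hF.conn₂.shrink hc₂ hF.meet₂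
    have hear := oddEar_of_fan (t := t) (fun o ho o' ho' hne s => h.cycle_odd hp ho ho' hne s)
      hP₁ hP₂ (hF.disj.mono hPQ₁ hPQ₂) ho₁ ho₁O hu₁ ho₂ ho₂O hu₂ hcP₁ hcP₂ hz₁ hz₂
    refine ⟨_, ?_, hear.sub (h.bfs.sub rfl) h.bfs.closed, hear, fun K A hK => ?_⟩
    · rintro (((hz | hz) | hz) | hz)
      · have := hz.2; omega
      · have := hz.2; omega
      · exact hF.not₁ (hPQ₁ hz)
      · exact hF.not₂ (hPQ₂ hz)
    · refine oneDim_three (X₁ := branch δ par x) (X₂ := branch δ par y) (X₃ := branch δ' par' e)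
        ?_
        (fun B hB => h.bfs.oneDim_branch h.memx fun a ha b hb _ => hK a (hB ha) b (hB hb))
        (fun B hB => h.bfs.oneDim_branch h.memy fun a ha b hb _ => hK a (hB ha) b (hB hb))
        fun B hB hBJ => hb.oneDim_branch he fun a ha b hb _ hab =>
          ⟨hBJ a ha, hBJ b hb, .inl (hK a (hB ha) b (hB hb) hab)⟩
      rintro v ((hv | hv) | hv)
      · exact .inl (hv.imp And.left And.left)
      · exact hF.sub₁ (hPQ₁ hv)
      · exact hF.sub₂ (hPQ₂ hv)

end Ear

section Core

variable {V : Type*} {G : SimpleGraph V} {C R Z : Set V} {x y z : V}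

/-- The vertices of `C` that cannot be separated from `R` by another vertex of `C`. -/
def core (G : SimpleGraph V) (C R : Set V) : Set V :=
  {x | x ∈ C ∧ ∀ v ∈ C, v ≠ x → ∃ c ∈ R, Linked G (C \ {v}) x c}

lemma mem_core_of_mem (hx : x ∈ C) (hxR : x ∈ R) : x ∈ core G C R :=
  ⟨hx, fun _ _ hv => ⟨x, hxR, .refl ⟨hx, hv.symm⟩⟩⟩

lemma core_attachment_unique {a a' u u' : V} (h : Linked G (C \ core G C R) a a')
    (hu : u ∈ core G C R) (hu' : u' ∈ core G C R) (hau : G.Adj a u) (hau' : G.Adj a' u') :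
    u' = u := by
  by_contra hne
  obtain ⟨haC, ha⟩ := h.mem_left
  have : ∃ v ∈ C, v ≠ a ∧ ∀ c ∈ R, ¬ Linked G (C \ {v}) a c := by
    by_contra! hno
    exact ha ⟨haC, hno⟩
  obtain ⟨v, hvC, hva, hv⟩ := this
  by_cases hvu : v = u
  · subst hvu
    have h1 : Linked G (C \ {v}) a a' := h.mono fun w hw => ⟨hw.1, fun hwv => hw.2 (hwv ▸ hu)⟩
    obtain ⟨c, hc, hl⟩ := hu'.2 v hvC (Ne.symm hne)
    exact hv c hc ((h1.snoc hau' hl.mem_left).trans hl)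
  · obtain ⟨c, hc, hl⟩ := hu.2 v hvC hvu
    exact hv c hc ((Linked.of_adj (A := C \ {v}) hau ⟨haC, hva.symm⟩ hl.mem_left).trans hl)

lemma core_linked (hC : ConnSet G C) (hRC : R ⊆ C) (hR : R.Nonempty) (hx : x ∈ core G C R) :
    ∃ c ∈ R, Linked G (core G C R) x c := by
  obtain ⟨c, hc⟩ := hR
  refine ⟨c, hc, ?_⟩
  have key := (hC x hx.1 c (hRC hc)).induct (Q := fun b =>
    (b ∈ core G C R → Linked G (core G C R) x b) ∧ (b ∉ core G C R → ∃ u b',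
      Linked G (core G C R) x u ∧ Linked G (C \ core G C R) b b' ∧ G.Adj b' u))
    ⟨fun h => .refl h, fun h => (h hx).elim⟩
    fun a b ha ih hab hb => ?_
  · exact key.1 (mem_core_of_mem (hRC hc) hc)
  · by_cases haW : a ∈ core G C R
    · have hxa := ih.1 haW
      exact ⟨fun hbW => hxa.snoc hab hbW, fun hbW => ⟨a, b, hxa, .refl ⟨hb, hbW⟩, hab.symm⟩⟩
    · obtain ⟨u, a', hu, haa', ha'u⟩ := ih.2 haW
      refine ⟨fun hbW => ?_, fun hbW => ⟨u, a', hu, ?_, ha'u⟩⟩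
      · rwa [core_attachment_unique haa'.symm hu.mem_right hbW ha'u hab]
      · exact (Linked.of_adj (A := C \ core G C R) hab.symm ⟨hb, hbW⟩ ⟨ha, haW⟩).trans haa'

/-- The graph on `C` and a further vertex `z` joined to `R`. -/
def contract (G : SimpleGraph V) (C R : Set V) (z : V) : SimpleGraph V where
  Adj a b := a ≠ b ∧ ((a ∈ C ∧ b ∈ C ∧ G.Adj a b) ∨ (a = z ∧ b ∈ R) ∨ (b = z ∧ a ∈ R))
  symm := ⟨fun _ _ h => ⟨h.1.symm, by have := h.2; simp only [G.adj_comm] at this ⊢; tauto⟩⟩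
  loopless := ⟨fun _ h => h.1 rfl⟩

lemma contract_of_adj {a b : V} (ha : a ∈ C) (hb : b ∈ C) (h : G.Adj a b) :
    (contract G C R z).Adj a b := ⟨h.ne, .inl ⟨ha, hb, h⟩⟩

lemma adj_of_contract (hz : z ∉ C) {a b : V} (ha : a ∈ C) (hb : b ∈ C)
    (h : (contract G C R z).Adj a b) : G.Adj a b := by
  obtain ⟨-, h | ⟨rfl, -⟩ | ⟨rfl, -⟩⟩ := h
  · exact h.2.2
  · exact (hz ha).elim
  · exact (hz hb).elim

/-- The coloring of a breadth first search alternating on branches, starting opposite to `t`. -/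
lemma Bfs.exists_coloring {r : V → V → Prop} {s Q : Set V} {δ : V → ℕ} {par : V → V}
    (h : Bfs r s Q δ par) (t : V → Bool) :
    ∃ g : V → Bool, (∀ v ∈ Q, δ v = 1 → g v ≠ t v) ∧ ∀ v ∈ Q, 1 < δ v → g (par v) ≠ g v := by
  refine ⟨fun v => Bool.xor (t (par^[δ v - 1] v)) (decide (δ v % 2 = 1)), fun v _ hv1 => ?_,
    fun v hv hv1 => ?_⟩
  · simp [hv1]
  · have hl := h.par_lev v hv (by omega)
    have hroot : par^[δ (par v) - 1] (par v) = par^[δ v - 1] v := by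
      rw [← Function.iterate_succ_apply]
      congr 1
      omega
    have hpar : decide (δ (par v) % 2 = 1) = !decide (δ v % 2 = 1) := by
      rw [← decide_not]
      congr 1
      simp only [eq_iff_iff]
      omega
    simp only [hroot, hpar]
    cases t (par^[δ v - 1] v) <;> cases decide (δ v % 2 = 1) <;> simp

/-- Either the core of `C` with respect to `Z` is bipartite, or `C` contains a thin set attached
oddly to `Z`. -/
lemma bipartite_or_exists_odd [Finite V] (hC : ConnSet G C) (hCZ : Disjoint C Z)
    (hR : {c | c ∈ C ∧ ∃ w ∈ Z, G.Adj c w}.Nonempty) (col : V → Bool) :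
    (∃ g : V → Bool, ∀ x ∈ core G C {c | c ∈ C ∧ ∃ w ∈ Z, G.Adj c w},
      ∀ y ∈ core G C {c | c ∈ C ∧ ∃ w ∈ Z, G.Adj c w}, G.Adj x y → g x ≠ g y) ∨
    ∃ E ⊆ C, ConnSet G E ∧ Odd G col E Z ∧ ∀ A ⊆ C, OneDim G A (E ∩ A) earCtl := by
  set R := {c | c ∈ C ∧ ∃ w ∈ Z, G.Adj c w} with hRdef
  have hRC : R ⊆ C := fun c hc => hc.1
  obtain ⟨c₀, hc₀⟩ := hR
  obtain ⟨z, hzZ, hcz⟩ := hc₀.2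
  have hzC : z ∉ C := fun hz => Set.disjoint_left.1 hCZ hz hzZ
  have hzR : ∀ c ∈ R, (contract G C R z).Adj z c := fun c hc =>
    ⟨fun h => hzC (h ▸ hRC hc), .inr (.inl ⟨rfl, hc⟩)⟩
  choose! w hwZ hw using fun c (hc : c ∈ R) => hc.2
  obtain ⟨Q, δ, par, hb⟩ := exists_bfs (contract G C R z).Adj {z}
  obtain ⟨g, hg1, hg2⟩ := hb.exists_coloring fun c => col (w c)
  have lift : ∀ {A : Set V} {a b : V}, A ⊆ C → Linked G A a b → Linked (contract G C R z) A a b :=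
    fun hA h => h.map fun a ha b hb hab => contract_of_adj (hA ha) (hA hb) hab
  have hCQ : C ⊆ Q := fun v hv =>
    (lift subset_rfl (hC c₀ hc₀.1 v hv)).induct (hb.closed z (hb.sub rfl) c₀ (hzR _ hc₀))
      fun a b _ ha hab _ => hb.closed a ha b hab
  have hQC : ∀ v ∈ Q, v ≠ z → v ∈ C := fun v hv hvz => by
    have h0 : δ v ≠ 0 := fun h0 => hvz ((hb.zero v hv).1 h0)
    obtain ⟨-, h | ⟨-, h⟩ | ⟨h, -⟩⟩ := hb.par_rel v hv h0
    · exact h.2.1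
    · exact hRC h
    · exact (hvz h).elim
  by_cases hprop : ∀ x ∈ core G C R, ∀ y ∈ core G C R, G.Adj x y → g x ≠ g y
  · exact .inl ⟨g, hprop⟩
  push Not at hprop
  obtain ⟨x, hx, y, hy, hxy, hgxy⟩ := hprop
  obtain ⟨p, hp⟩ := exists_badEdge hb hg2 (hCQ hx.1) (hCQ hy.1) (fun h => hzC (h ▸ hx.1))
    (fun h => hzC (h ▸ hy.1)) (contract_of_adj hx.1 hy.1 hxy) hgxy
  obtain ⟨E, hzE, hEQ, ⟨g', hbc, ⟨e, he, hze, hge⟩, e', he', hze', hge'⟩, hdim⟩ :=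
    hp.exists_oddEar hg1 fun v hvx hvz => by
      have : ∃ c ∈ R, Linked G (C \ {v}) x c := by
        by_cases hvC : v ∈ C
        · exact hx.2 v hvC hvx
        · exact ⟨c₀, hc₀, by rw [Set.sdiff_singleton_eq_self hvC]; exact hC x hx.1 c₀ hc₀.1⟩
      obtain ⟨c, hc, hl⟩ := this
      have hl' := (lift Set.sdiff_subset hl.symm).mono (B := {v}ᶜ) fun w hw => hw.2
      exact (Linked.of_adj (hzR c hc) (Ne.symm hvz) hl'.mem_left).trans hl'
  have hEC : E ⊆ C := fun v hv => hQC v (hEQ hv) fun h => hzE (h ▸ hv)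
  have hzadj : ∀ {e : V}, e ∈ E → (contract G C R z).Adj z e → e ∈ R := fun he h => by
    obtain ⟨hne, h | h | h⟩ := h
    · exact (hzC h.1).elim
    · exact h.2
    · exact (hne h.1.symm).elim
  have hbcG : BC G g' E := ⟨hbc.1, fun a ha b hb => (hbc.2 a ha b hb).map
    fun a ha b hb hab => ⟨adj_of_contract hzC (hEC ha) (hEC hb) hab.1, hab.2⟩⟩
  exact .inr ⟨E, hEC, hbcG.connSet, ⟨E, subset_rfl, g', hbcG,
    ⟨e, he, w e, hwZ _ (hzadj he hze), hw _ (hzadj he hze), hge⟩,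
    e', he', w e', hwZ _ (hzadj he' hze'), hw _ (hzadj he' hze'), hge'⟩,
    fun A hA => hdim G A fun a ha b hb hab => contract_of_adj (hA ha) (hA hb) hab⟩

end Core

section Connector

variable {V : Type*} {G : SimpleGraph V} {C : Set V}

/-- The control function of a connected set containing `m` given ears. -/
def connectorIter : ℕ → ℕ → ℕ
  | 0 => fun s => s * s
  | m + 1 => extendCtl (connectorIter m) (extendCtl earCtl (fun s => s * s))

/-- The control function of a connected set containing at most `n` given ears. -/
def connectorCtl (n s : ℕ) : ℕ := (Finset.range (n + 1)).sup fun m => connectorIter m s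

lemma OneDim.extend_inter {A S₁ S₂ : Set V} {D₁ D₂ : ℕ → ℕ}
    (h₁ : ∀ B ⊆ A, OneDim G B (S₁ ∩ B) D₁) (h₂ : ∀ B ⊆ A, OneDim G B (S₂ ∩ B) D₂) :
    ∀ B ⊆ A, OneDim G B ((S₁ ∪ S₂) ∩ B) (extendCtl D₁ D₂) := fun B hB => by
  refine ((h₁ B hB).extend (h₂ (B \ (S₁ ∩ B)) (Set.sdiff_subset.trans hB))).mono (fun v hv => ?_)
    fun _ => le_rfl
  simp only [Set.mem_union, Set.mem_inter_iff, Set.mem_sdiff] at hv ⊢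
  tauto

lemma exists_connector (hC : ConnSet G C) (hne : C.Nonempty) (I : Finset ℕ) (E : ℕ → Set V)
    (hE : ∀ i ∈ I, E i ⊆ C ∧ (E i).Nonempty ∧ ConnSet G (E i) ∧
      ∀ A ⊆ C, OneDim G A (E i ∩ A) earCtl) {n : ℕ} (hn : I.card ≤ n) :
    ∃ Y ⊆ C, Y.Nonempty ∧ ConnSet G Y ∧ (∀ i ∈ I, E i ⊆ Y) ∧
      ∀ A ⊆ C, OneDim G A (Y ∩ A) (connectorCtl n) := by
  classical
  obtain ⟨v, hv⟩ := hne
  obtain ⟨Q, δ, par, hb⟩ := exists_bfs (fun a b => a ∈ C ∧ b ∈ C ∧ G.Adj a b) {v}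
  have hCQ : C ⊆ Q := fun x hx => (hC v hv x hx).induct (hb.sub rfl)
    fun a b ha haQ hab hbC => hb.closed a haQ b ⟨ha, hbC, hab⟩
  have hQC : Q ⊆ C := fun x hx => by
    by_cases h0 : δ x = 0
    · rw [(hb.zero x hx).1 h0]; exact hv
    · exact (hb.par_rel x hx h0).2.1
  have hbr : ∀ x ∈ C, ∀ A ⊆ C, OneDim G A (branch δ par x ∩ A) (fun s => s * s) :=
    fun x hx A hA => hb.oneDim_branch (hCQ hx) fun a ha b hb _ hab => ⟨hA ha, hA hb, hab⟩
  have hroot : ∀ x ∈ C, v ∈ branch δ par x := fun x hx => by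
    obtain ⟨w, hw, hw0⟩ := hb.branch_level (hCQ hx) (Nat.zero_le _)
    rwa [← Set.mem_singleton_iff.1 ((hb.zero w (hb.branch_sub (hCQ hx) hw)).1 hw0)]
  have hlink : ∀ x ∈ C, ∀ y ∈ branch δ par x, Linked G (branch δ par x) x y := fun x hx y hy =>
    (hb.linked_tail (K := G) (hCQ hx) (j := 0)
      (fun w hw hj => (hb.par_rel w hw (by omega)).2.2) ⟨hy, Nat.zero_le _⟩).mono fun w hw => hw.1
  have key : ∃ Y ⊆ C, v ∈ Y ∧ ConnSet G Y ∧ (∀ i ∈ I, E i ⊆ Y) ∧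
      ∀ A ⊆ C, OneDim G A (Y ∩ A) (connectorIter I.card) := by
    clear hn
    induction I using Finset.induction with
    | empty =>
      have hv0 : branch δ par v = {v} := by
        have : δ v = 0 := (hb.zero v (hCQ hv)).2 rfl
        ext w
        simp [branch, this, eq_comm]
      exact ⟨{v}, by simpa, rfl, .of_base (x := v) (by rintro _ rfl; exact .refl rfl), by simp,
        fun A hA => hv0 ▸ hbr v hv A hA⟩
    | insert i I hi ih =>
      obtain ⟨Y, hYC, hvY, hY, hEY, hdim⟩ := ih fun j hj => hE j (Finset.mem_insert_of_mem hj)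
      obtain ⟨hEC, ⟨e, he⟩, hEconn, hEdim⟩ := hE i (Finset.mem_insert_self _ _)
      have heC := hEC he
      refine ⟨Y ∪ (E i ∪ branch δ par e), Set.union_subset hYC (Set.union_subset hEC
        fun w hw => hQC (hb.branch_sub (hCQ heC) hw)), .inl hvY, .of_base (x := v) ?_, ?_, ?_⟩
      · have hve : Linked G (Y ∪ (E i ∪ branch δ par e)) v e :=
          (hlink e heC v (hroot e heC)).symm.mono fun w hw => .inr (.inr hw)
        rintro y (hy | hy | hy)
        · exact (hY v hvY y hy).mono Set.subset_union_left
        · exact hve.trans ((hEconn e he y hy).mono fun w hw => .inr (.inl hw))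
        · exact hve.trans ((hlink e heC y hy).mono fun w hw => .inr (.inr hw))
      · intro j hj
        rcases Finset.mem_insert.1 hj with rfl | hj
        · exact fun w hw => .inr (.inl hw)
        · exact (hEY j hj).trans Set.subset_union_left
      · rw [Finset.card_insert_of_notMem hi]
        exact OneDim.extend_inter hdim (OneDim.extend_inter hEdim (hbr e heC))
  obtain ⟨Y, hYC, hvY, hY, hEY, hdim⟩ := key
  exact ⟨Y, hYC, ⟨v, hvY⟩, hY, hEY, fun A hA => (hdim A hA).mono subset_rfl fun s =>
    Finset.le_sup (f := fun m => connectorIter m s) (Finset.mem_range.2 (by omega))⟩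

end Connector

section System

variable {V : Type*} {G : SimpleGraph V} {I : Finset ℕ} {Z : ℕ → Set V} {col : V → Bool}

lemma OddSystem.subset {J : Finset ℕ} (h : OddSystem G I Z col) (hJ : J ⊆ I) :
    OddSystem G J Z col :=
  ⟨fun i hi => h.bc i (hJ hi), fun i hi j hj => h.disj i (hJ hi) j (hJ hj),
    fun i hi j hj => h.odd i (hJ hi) j (hJ hj)⟩

lemma OddSystem.absorb [Finite V] (h : OddSystem G I Z col) {F : Set V} (P : ℕ → Prop)
    (hF : ∀ i ∈ I, Disjoint (Z i) F)
    (hlink : ∀ x ∈ F, ∃ y, Linked G F x y ∧ ∃ i ∈ I, P i ∧ ∃ z ∈ Z i, G.Adj y z) :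
    ∃ (Z' : ℕ → Set V) (col' : V → Bool), OddSystem G I Z' col' ∧ (∀ i ∈ I, Z i ⊆ Z' i) ∧
      (∀ i ∈ I, Z' i ⊆ Z i ∪ F) ∧ (∀ i ∈ I, ¬ P i → Z' i = Z i) ∧ ∀ x ∈ F, ∃ i ∈ I, x ∈ Z' i := by
  classical
  obtain ⟨Z₁, col', h1, h2, h3, h4, h5, h6⟩ :=
    exists_absorb (fun i : {i // i ∈ I ∧ P i} => Z i) col F
      (fun i j hij => h.disj i i.2.1 j j.2.1 fun e => hij (Subtype.ext e))
      (fun i => h.bc i i.2.1) (fun i => hF i i.2.1) fun x hx => by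
        obtain ⟨y, hy, i, hi, hP, hz⟩ := hlink x hx
        exact ⟨y, ⟨i, hi, hP⟩, hy, hz⟩
  have hZcol : ∀ i ∈ I, ∀ x ∈ Z i, col' x = col x := fun i hi x hx =>
    h4 x (Set.disjoint_left.1 (hF i hi) hx)
  set Z' : ℕ → Set V := fun i => if hi : i ∈ I ∧ P i then Z₁ ⟨i, hi⟩ else Z i with hZ'
  have hpos : ∀ i (hi : i ∈ I ∧ P i), Z' i = Z₁ ⟨i, hi⟩ := fun i hi => dif_pos hi
  have hneg : ∀ i, ¬ (i ∈ I ∧ P i) → Z' i = Z i := fun i hi => dif_neg hi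
  have hsub : ∀ i ∈ I, Z i ⊆ Z' i := fun i hi => by
    by_cases hP : i ∈ I ∧ P i
    · rw [hpos i hP]; exact h1 ⟨i, hP⟩
    · rw [hneg i hP]
  have hsup : ∀ i ∈ I, Z' i ⊆ Z i ∪ F := fun i hi => by
    by_cases hP : i ∈ I ∧ P i
    · rw [hpos i hP]; exact h2 ⟨i, hP⟩
    · rw [hneg i hP]; exact Set.subset_union_left
  refine ⟨Z', col', ⟨fun i hi => ?_, fun i hi j hj hij => ?_, fun i hi j hj hij => ?_⟩, hsub, hsup,
    fun i hi hP => hneg i fun h => hP h.2, fun x hx => ?_⟩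
  · by_cases hP : i ∈ I ∧ P i
    · rw [hpos i hP]; exact h5 ⟨i, hP⟩
    · rw [hneg i hP]
      exact (h.bc i hi).congr fun x hx y hy _ hxy => by
        rwa [hZcol i hi x hx, hZcol i hi y hy]
  · by_cases hPi : i ∈ I ∧ P i
    · by_cases hPj : j ∈ I ∧ P j
      · rw [hpos i hPi, hpos j hPj]
        exact h3 _ _ fun e => hij (congrArg Subtype.val e)
      · rw [hneg j hPj]
        exact (Set.disjoint_union_left.2 ⟨h.disj i hi j hj hij, (hF j hj).symm⟩).mono_left
          (hsup i hi)
    · rw [hneg i hPi]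
      exact (Set.disjoint_union_right.2 ⟨h.disj i hi j hj hij, hF i hi⟩).mono_right (hsup j hj)
  · exact (h.odd i hi j hj hij).mono (hsub j hj) (hsub i hi) (hZcol i hi)
  · obtain ⟨⟨i, hi⟩, hx⟩ := h6 x hx
    exact ⟨i, hi.1, by rwa [hpos i hi]⟩

/-- A new set attached oddly to all members of a system can be added. -/
lemma OddSystem.push [Finite V] (h : OddSystem G I Z col) {Y : Set V} (hY : ConnSet G Y)
    (hne : Y.Nonempty) (hd : ∀ i ∈ I, Disjoint (Z i) Y) (ho : ∀ i ∈ I, Odd G col Y (Z i)) :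
    ∃ (j : ℕ) (Z' : ℕ → Set V) (col' : V → Bool), j ∉ I ∧ OddSystem G (insert j I) Z' col' ∧
      Z' j = Y ∧ ∀ i ∈ I, Z' i = Z i := by
  classical
  obtain ⟨y, hy⟩ := hne
  obtain ⟨g, -, hg⟩ := (BC.singleton (G := G) (fun _ => false) y).extend hY (by simpa)
  set j := I.sup id + 1 with hj
  have hlt : ∀ i ∈ I, i < j := fun i hi => Nat.lt_succ_of_le (Finset.le_sup (f := id) hi)
  have hjI : j ∉ I := fun hjI => lt_irrefl _ (hlt j hjI)
  set col' : V → Bool := fun v => if v ∈ Y then g v else col v with hcol'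
  have hcY : ∀ v ∈ Y, col' v = g v := fun v hv => if_pos hv
  have hcZ : ∀ i ∈ I, ∀ v ∈ Z i, col' v = col v := fun i hi v hv =>
    if_neg (Set.disjoint_left.1 (hd i hi) hv)
  set Z' : ℕ → Set V := Function.update Z j Y with hZ'
  have hZj : Z' j = Y := Function.update_self _ _ _
  have hZi : ∀ i ∈ I, Z' i = Z i := fun i hi => Function.update_of_ne (hlt i hi).ne _ _
  refine ⟨j, Z', col', hjI, ⟨fun i hi => ?_, fun i hi k hk hik => ?_, fun i hi k hk hik => ?_⟩, hZj,
    hZi⟩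
  · rcases Finset.mem_insert.1 hi with rfl | hi
    · rw [hZj]
      exact hg.congr fun x hx y hy _ hxy => by rwa [hcY x hx, hcY y hy]
    · rw [hZi i hi]
      exact (h.bc i hi).congr fun x hx y hy _ hxy => by rwa [hcZ i hi x hx, hcZ i hi y hy]
  · rcases Finset.mem_insert.1 hi with rfl | hi <;> rcases Finset.mem_insert.1 hk with rfl | hk
    · exact (hik rfl).elim
    · rw [hZj, hZi k hk]; exact (hd k hk).symm
    · rw [hZj, hZi i hi]; exact hd i hi
    · rw [hZi i hi, hZi k hk]; exact h.disj i hi k hk hik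
  · rcases Finset.mem_insert.1 hi with rfl | hi
    · rcases Finset.mem_insert.1 hk with rfl | hk
      · exact (lt_irrefl _ hik).elim
      · exact (lt_asymm hik (hlt k hk)).elim
    · rw [hZi i hi]
      rcases Finset.mem_insert.1 hk with rfl | hk
      · rw [hZj]; exact (ho i hi).mono subset_rfl subset_rfl (hcZ i hi)
      · rw [hZi k hk]; exact (h.odd i hi k hk hik).mono subset_rfl subset_rfl (hcZ i hi)

end System

section Decomposition

/-- Control function for a union of `m` sets with control function `D`. -/
def extIter : ℕ → (ℕ → ℕ) → ℕ → ℕ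
  | 0, _ => fun _ => 0
  | m + 1, D => extendCtl (extIter m D) D

/-- Control function for a union of at most `M` sets with control function `D`. -/
def hullCtl (M : ℕ) (D : ℕ → ℕ) (s : ℕ) : ℕ :=
  (Finset.range (M + 1)).sup fun m => extIter m D s

lemma extIter_le_hullCtl {m M : ℕ} (h : m ≤ M) (D : ℕ → ℕ) (s : ℕ) :
    extIter m D s ≤ hullCtl M D s :=
  Finset.le_sup (f := fun m => extIter m D s) (Finset.mem_range.2 (by omega))

/-- Control functions for the hulls of a stack. -/
def levelCtl (n M : ℕ) : ℕ → ℕ → ℕ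
  | 0 => connectorCtl n
  | k + 1 => fun s => max (levelCtl n M k s)
      (max (hullCtl M (levelCtl n M k) s) (thick 4 (hullCtl M (levelCtl n M k)) s))

/-- Control function for the whole decomposition. -/
def finalCtl (n M : ℕ) (s : ℕ) : ℕ :=
  max (levelCtl n M (M + 1) s) (extendCtl (hullCtl M (levelCtl n M M)) (connectorCtl n) s)

lemma levelCtl_mono (n M : ℕ) {k l : ℕ} (h : k ≤ l) (s : ℕ) :
    levelCtl n M k s ≤ levelCtl n M l s :=
  monotone_nat_of_le_succ (f := fun k => levelCtl n M k s) (fun _ => le_max_left _ _) h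

lemma hullCtl_le_levelCtl (n M k s : ℕ) :
    hullCtl M (levelCtl n M k) s ≤ levelCtl n M (k + 1) s :=
  (le_max_left _ _).trans (le_max_right _ _)

lemma thick_le_levelCtl (n M k s : ℕ) :
    thick 4 (hullCtl M (levelCtl n M k)) s ≤ levelCtl n M (k + 1) s :=
  (le_max_right _ _).trans (le_max_right _ _)

/-- An entry of a stack: a domain, its boundary, and a hull containing the boundary. -/
structure Entry (V : Type*) where
  /-- the domain -/
  dom : Set V
  /-- the boundary -/
  p : Set V
  /-- the hull -/
  h : Set V

variable {V : Type*} {G : SimpleGraph V} {n M : ℕ} {L L₁ L₂ : List (Entry V)} {B C C' W A : Set V}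
  {e : Entry V} {x y : V}

/-- The stack of pairs belonging to a list of entries. -/
def fullStack (L : List (Entry V)) (B : Set V) : List (Set V × Set V) :=
  L.map (fun e => (e.dom, e.p)) ++ [(B, ∅)]

/-- The union of the hulls of a list of entries. -/
def hullU (L : List (Entry V)) : Set V := {x | ∃ e ∈ L, x ∈ e.h}

@[simp] lemma hullU_nil : hullU ([] : List (Entry V)) = ∅ := by simp [hullU]

@[simp] lemma hullU_cons : hullU (e :: L) = e.h ∪ hullU L := by
  ext x
  simp [hullU]

@[simp] lemma hullU_append : hullU (L₁ ++ L₂) = hullU L₁ ∪ hullU L₂ := by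
  ext x
  simp [hullU, or_and_right, exists_or]

lemma OneDim.empty {D : ℕ → ℕ} : OneDim G A ∅ D :=
  fun _ => ⟨fun _ => true, fun _ h => h.elim⟩

lemma OneDim.subsingleton {S : Set V} {D : ℕ → ℕ} (hS : S.Subsingleton) (hSA : S ⊆ A) :
    OneDim G A S D :=
  fun _ => ⟨fun _ => true, fun x hx y hxy => by
    rw [hS (hxy.mem hx) hx]
    exact .refl (hSA hx) _⟩

/-- The hulls of a stack are disjoint, and each is one-dimensional in the region above it. -/
def Hulls (G : SimpleGraph V) (n M : ℕ) : List (Entry V) → Set V → Prop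
  | [], _ => True
  | e :: L, C => e.p ⊆ e.h ∧ Disjoint e.h C ∧ (∀ A, e.h ⊆ A → A ⊆ e.h ∪ C →
      OneDim G A e.h (levelCtl n M (M - L.length))) ∧ Hulls G n M L (e.h ∪ C)

lemma Hulls.mono (h : Hulls G n M L C) (hC : C' ⊆ C) : Hulls G n M L C' := by
  induction L generalizing C C' with
  | nil => trivial
  | cons e L ih =>
    have hu : e.h ∪ C' ⊆ e.h ∪ C := Set.union_subset_union_right _ hC
    exact ⟨h.1, h.2.1.mono_right hC, fun A h1 h2 => h.2.2.1 A h1 (h2.trans hu), ih h.2.2.2 hu⟩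

lemma Hulls.append (h : Hulls G n M (L₁ ++ L₂) C) : Hulls G n M L₂ (hullU L₁ ∪ C) := by
  induction L₁ generalizing C with
  | nil => simpa using h
  | cons e L ih =>
    have := ih h.2.2.2
    rwa [hullU_cons, Set.union_comm e.h, Set.union_assoc]

lemma Hulls.disjoint (h : Hulls G n M (L₁ ++ L₂) C) : Disjoint (hullU L₁) C := by
  induction L₁ generalizing C with
  | nil => simp
  | cons e L ih =>
    rw [hullU_cons]
    exact h.2.1.union_left ((ih h.2.2.2).mono_right Set.subset_union_right)

lemma subset_hullU (he : e ∈ L) : e.h ⊆ hullU L := fun _ hx => ⟨e, he, hx⟩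

lemma Hulls.p_subset (h : Hulls G n M L C) (he : e ∈ L) : e.p ⊆ e.h := by
  induction L generalizing C with
  | nil => simp at he
  | cons f L ih =>
    rcases List.mem_cons.1 he with rfl | he
    · exact h.1
    · exact ih h.2.2.2 he

lemma Hulls.oneDim_iter {D : ℕ → ℕ} (h : Hulls G n M (L₁ ++ L₂) C)
    (hD : ∀ l, L₂.length ≤ l → ∀ s, levelCtl n M (M - l) s ≤ D s)
    (h1 : hullU L₁ ⊆ A) (h2 : A ⊆ hullU L₁ ∪ C) :
    OneDim G A (hullU L₁) (extIter L₁.length D) := by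
  induction L₁ generalizing C with
  | nil => simpa using OneDim.empty
  | cons e L ih =>
    have hd : Disjoint (hullU L) (e.h ∪ C) := h.2.2.2.disjoint
    rw [hullU_cons] at h1 h2 ⊢
    have key := ih h.2.2.2 (Set.subset_union_right.trans h1) (h2.trans fun x hx => by
      simp only [Set.mem_union] at hx ⊢; tauto)
    rw [Set.union_comm]
    refine key.extend ((h.2.2.1 (A \ hullU L) (fun x hx => ⟨h1 (.inl hx), fun hx' => ?_⟩)
      fun x hx => ?_).mono subset_rfl (hD _ (by simp)))
    · exact Set.disjoint_left.1 hd hx' (.inl hx)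
    · have := h2 hx.1
      have := hx.2
      simp only [Set.mem_union] at *
      tauto

lemma Hulls.oneDim {k : ℕ} (h : Hulls G n M (L₁ ++ L₂) C) (hM : L₁.length ≤ M)
    (hk : M - L₂.length ≤ k) (h1 : hullU L₁ ⊆ A) (h2 : A ⊆ hullU L₁ ∪ C) :
    OneDim G A (hullU L₁) (hullCtl M (levelCtl n M k)) :=
  (h.oneDim_iter (fun _ hl s => levelCtl_mono n M (by omega) s) h1 h2).mono subset_rfl
    (extIter_le_hullCtl hM _)

/-- A partially decomposed graph: a connected set `C` to be colored, a stack of entries above it,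
and an odd system whose members all touch `C` and cover its neighborhood. -/
structure State (G : SimpleGraph V) (n M : ℕ) (B : Set V) (L : List (Entry V)) (C : Set V)
    (I : Finset ℕ) (Z : ℕ → Set V) (col : V → Bool) : Prop where
  nonempty : C.Nonempty
  conn : ConnSet G C
  head : ∃ p tl, fullStack L B = (C, p) :: tl
  top : ∀ e L', L = e :: L' → ∃ w ∈ e.p, ∃ x ∈ C, G.Adj x w
  nested : L.Pairwise fun e f => e.dom ∪ e.p ⊆ f.dom
  disj_dom : ∀ e ∈ L, Disjoint e.p e.dom
  sub_dom : ∀ e ∈ L, C ⊆ e.dom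
  hulls : Hulls G n M L C
  len : L.length + 1 ≤ M
  sys : OddSystem G I Z col
  disj : ∀ i ∈ I, Disjoint (Z i) C
  touch : ∀ i ∈ I, ∃ x ∈ C, ∃ y ∈ Z i, G.Adj x y
  cover : ∀ x ∈ C, ∀ y, y ∉ C → G.Adj x y → (∃ i ∈ I, y ∈ Z i) ∧ ∃ e ∈ L, y ∈ e.p
  single : ∀ i ∈ I, ∃ e ∈ L, ∀ x ∈ C, ∀ y ∈ Z i, G.Adj x y → y ∈ e.p

/-- The vertices of `W` with a neighbor in `D`. -/
def attach (G : SimpleGraph V) (W D : Set V) : Set V := {w | w ∈ W ∧ ∃ x ∈ D, G.Adj x w}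

variable {I : Finset ℕ} {Z : ℕ → Set V} {col : V → Bool}

/-- Removing a set `W` from `C`, and popping `L₁` from the stack. -/
structure Pop (G : SimpleGraph V) (n M : ℕ) (L₁ L₂ : List (Entry V)) (C W : Set V)
    (J : Finset ℕ) (Z : ℕ → Set V) (col : V → Bool) (hull : Set V → Set V) : Prop where
  nonempty : W.Nonempty
  sub : W ⊆ C
  len : L₂.length + 2 ≤ M
  far : ∀ e ∈ L₁, ∀ x ∈ C \ W, ∀ y ∈ e.p, ¬ Near G (e.dom ∪ e.p) 4 y x
  sys : OddSystem G J Z col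
  disj : ∀ i ∈ J, Disjoint (Z i) (C \ W)
  absorbed : ∀ x ∈ W, ∃ i ∈ J, x ∈ Z i
  cover : ∀ x ∈ C \ W, ∀ y, y ∉ C → G.Adj x y → (∃ i ∈ J, y ∈ Z i) ∧ ∃ e ∈ L₂, y ∈ e.p
  single : ∀ i ∈ J, (∀ x ∈ C \ W, ∀ y ∈ Z i, G.Adj x y → y ∈ W) ∨
    ∃ e ∈ L₂, ∀ x ∈ C \ W, ∀ y ∈ Z i, G.Adj x y → y ∈ e.p
  hull_sup : ∀ D, attach G W D ⊆ hull D
  hull_sub : ∀ D, hull D ⊆ hullU L₁ ∪ C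
  hull_disj : ∀ D ⊆ C \ W, Disjoint (hull D) D
  hull_dim : ∀ z ∈ C \ W, ∀ A, hull {y | Linked G (C \ W) z y} ⊆ A →
    A ⊆ hull {y | Linked G (C \ W) z y} ∪ {y | Linked G (C \ W) z y} →
    OneDim G A (hull {y | Linked G (C \ W) z y}) (levelCtl n M (M - L₂.length))

variable {hull : Set V → Set V}

open Classical in
lemma Pop.state (st : State G n M B (L₁ ++ L₂) C I Z col) {J : Finset ℕ} {Z' : ℕ → Set V}
    {col' : V → Bool} (sp : Pop G n M L₁ L₂ C W J Z' col' hull) {z : V} (hz : z ∈ C \ W) :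
    State G n M B (⟨{y | Linked G (C \ W) z y}, attach G W {y | Linked G (C \ W) z y},
        hull {y | Linked G (C \ W) z y}⟩ :: L₂) {y | Linked G (C \ W) z y}
      {i ∈ J | ∃ x ∈ {y | Linked G (C \ W) z y}, ∃ y ∈ Z' i, G.Adj x y} Z' col' := by
  set D : Set V := {y | Linked G (C \ W) z y} with hD
  have hDC : D ⊆ C \ W := fun y hy => Linked.mem_right hy
  have hDC' : D ⊆ C := fun y hy => (hDC hy).1
  have hzD : z ∈ D := Linked.refl hz
  have hsubd : ∀ f ∈ L₂, C ⊆ f.dom := fun f hf => st.sub_dom f (by simp [hf])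
  have hcl : ∀ x ∈ D, ∀ y ∈ C, y ∉ D → G.Adj x y → y ∈ W := fun x hx y hy hyD hxy => by
    by_contra hyW
    exact hyD (Linked.snoc hx hxy ⟨hy, hyW⟩)
  refine ⟨⟨z, hzD⟩, connSet_component, ⟨_, _, rfl⟩, ?_, ?_, ?_, ?_, ⟨sp.hull_sup D,
    sp.hull_disj D hDC, sp.hull_dim z hz, st.hulls.append.mono
    (Set.union_subset (sp.hull_sub D) (hDC'.trans Set.subset_union_right))⟩, ?_,
    sp.sys.subset (Finset.filter_subset _ _), ?_, ?_, ?_, ?_⟩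
  · rintro e L' h
    obtain ⟨rfl, rfl⟩ := List.cons.inj h
    obtain ⟨w, hw⟩ := sp.nonempty
    obtain ⟨a, b, h1, h2, h3, h4, h5, -⟩ := (st.conn z hz.1 w (sp.sub hw)).exit (P := D) hzD
      fun hwD => (hDC hwD).2 hw
    have := hcl a h2 b h3 h4 h5
    exact ⟨b, ⟨this, a, h2, h5⟩, a, h2, h5⟩
  · refine List.pairwise_cons.2 ⟨fun f hf => Set.union_subset (hDC'.trans (hsubd f hf))
      fun w hw => hsubd f hf (sp.sub hw.1), (List.pairwise_append.1 st.nested).2.1⟩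
  · intro e he
    rcases List.mem_cons.1 he with rfl | he
    · exact Set.disjoint_left.2 fun w hw hwD => (hDC hwD).2 hw.1
    · exact st.disj_dom e (by simp [he])
  · intro e he
    rcases List.mem_cons.1 he with rfl | he
    · exact subset_rfl
    · exact hDC'.trans (hsubd e he)
  · have := sp.len
    simp only [List.length_cons]
    omega
  · exact fun i hi => (sp.disj i (Finset.mem_filter.1 hi).1).mono_right hDC
  · exact fun i hi => (Finset.mem_filter.1 hi).2
  · intro x hx y hy hxy
    by_cases hyC : y ∈ C
    · have hyW := hcl x hx y hyC hy hxy
      obtain ⟨i, hi, hyi⟩ := sp.absorbed y hyW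
      exact ⟨⟨i, Finset.mem_filter.2 ⟨hi, x, hx, y, hyi, hxy⟩, hyi⟩, _, List.mem_cons_self,
        hyW, x, hx, hxy⟩
    · obtain ⟨⟨i, hi, hyi⟩, e, he, hye⟩ := sp.cover x (hDC hx) y hyC hxy
      exact ⟨⟨i, Finset.mem_filter.2 ⟨hi, x, hx, y, hyi, hxy⟩, hyi⟩, e,
        List.mem_cons_of_mem _ he, hye⟩
  · intro i hi
    rcases sp.single i (Finset.mem_filter.1 hi).1 with h | ⟨e, he, h⟩
    · exact ⟨_, List.mem_cons_self, fun x hx y hy hxy => ⟨h x (hDC hx) y hy hxy, x, hx, hxy⟩⟩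
    · exact ⟨e, List.mem_cons_of_mem _ he, fun x hx => h x (hDC hx)⟩

lemma Pop.good [Finite V] (st : State G n M B (L₁ ++ L₂) C I Z col) {J : Finset ℕ}
    {Z' : ℕ → Set V} {col' : V → Bool} (sp : Pop G n M L₁ L₂ C W J Z' col' hull)
    (color : OneDim G (hullU (L₁ ++ L₂) ∪ C) W (finalCtl n M) ∨
      ((∃ g : V → Bool, ∀ x ∈ W, ∀ y ∈ W, G.Adj x y → g x ≠ g y) ∧
        ∀ z ∈ C \ W, (attach G W {y | Linked G (C \ W) z y}).Subsingleton))
    (ih : ∀ L' C' I' Z' col', C'.ncard < C.ncard → State G n M B L' C' I' Z' col' →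
      Good G M (finalCtl n M) (fullStack L' B) (hullU L' ∪ C')) :
    Good G M (finalCtl n M) (fullStack (L₁ ++ L₂) B) (hullU (L₁ ++ L₂) ∪ C) := by
  let D : V → Set V := fun z => {y | Linked G (C \ W) z y}
  let ent : V → Entry V := fun z => ⟨D z, attach G W (D z), hull (D z)⟩
  let hole : V → Hole V := fun z =>
    ⟨D z, attach G W (D z), hullU (ent z :: L₂) ∪ D z, fullStack L₂ B⟩
  have hDC : ∀ z, D z ⊆ C \ W := fun z y hy => Linked.mem_right hy
  have kst : ∀ z ∈ C \ W, State G n M B (ent z :: L₂) (D z) _ Z' col' :=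
    fun z hz => sp.state st hz
  have hfull : fullStack (L₁ ++ L₂) B = L₁.map (fun e => (e.dom, e.p)) ++ fullStack L₂ B := by
    simp [fullStack]
  have hlen : (fullStack (L₁ ++ L₂) B).length = (L₁ ++ L₂).length + 1 := by
    simp [fullStack, add_assoc]
  have hstlen := st.len
  obtain ⟨p, rest, hhead⟩ := st.head
  rw [hhead] at hfull hlen ⊢
  refine Good.node C p rest _ W (hole '' (C \ W)) (by simp only [List.length_cons] at hlen; omega)
    sp.nonempty sp.sub Set.subset_union_right ?_ ?_ ?_ ?_ ?_ ?_ ?_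
  · exact fun x hx hxW => ⟨_, ⟨x, ⟨hx, hxW⟩, rfl⟩, Linked.refl (A := C \ W) ⟨hx, hxW⟩⟩
  · rintro _ ⟨z, hz, rfl⟩ _ ⟨z', hz', rfl⟩ x hx y hy hxy
    have hx : Linked G (C \ W) z x := hx
    have hy : Linked G (C \ W) z' y := hy
    have hzz : Linked G (C \ W) z z' := by
      rcases hxy with rfl | hxy
      · exact hx.trans hy.symm
      · exact (hx.snoc hxy hy.mem_right).trans hy.symm
    have : D z = D z' := Set.ext fun v => ⟨fun h => hzz.symm.trans h, fun h => hzz.trans h⟩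
    simp only [hole, ent, this]
  · rintro _ ⟨z, hz, rfl⟩
    have kh := (kst z hz).hulls
    refine ⟨fun x hx => (hDC z hx).1, ?_, ?_, ?_, ?_, ?_, ?_⟩
    · intro x hx y hy hxy hyD
      refine ⟨?_, x, hx, hxy⟩
      by_contra hyW
      exact hyD (Linked.snoc (A := C \ W) hx hxy ⟨hy, hyW⟩)
    · exact Set.union_subset Set.subset_union_right
        (((kh.p_subset List.mem_cons_self).trans (subset_hullU List.mem_cons_self)).trans
          Set.subset_union_left)
    · refine Set.union_subset ?_ fun x hx => .inr (hDC z hx).1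
      rw [hullU_cons, hullU_append]
      refine Set.union_subset ((sp.hull_sub _).trans ?_) ?_
      · exact Set.union_subset_union_left _ Set.subset_union_left
      · exact Set.subset_union_right.trans Set.subset_union_left
    · have := (kst z hz).len
      refine (Hulls.oneDim (L₂ := []) (k := M) (by simpa using kh) (by omega) (by simp)
        Set.subset_union_left subset_rfl).mono ((kh.p_subset List.mem_cons_self).trans
          (subset_hullU List.mem_cons_self)) fun s => ?_
      exact (hullCtl_le_levelCtl n M M s).trans (le_max_left _ _)
    · simp [hole, fullStack]
    · refine ⟨_, hfull, fun e he y hy x hx => ?_⟩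
      obtain ⟨f, hf, rfl⟩ := List.mem_map.1 he
      exact sp.far f hf x (hDC z hx) y hy
  · rintro _ ⟨z, hz, rfl⟩ x hx
    exact (hDC z hx).2
  · rintro _ ⟨z, hz, rfl⟩ x hx
    exact hx.1
  · rintro _ ⟨z, hz, rfl⟩
    refine ih (ent z :: L₂) (D z) _ Z' col' (Set.ncard_lt_ncard ?_) (kst z hz)
    obtain ⟨w, hw⟩ := sp.nonempty
    exact ⟨fun x hx => (hDC z hx).1, fun h => (hDC z (h (sp.sub hw))).2 hw⟩
  · refine color.imp id fun h => ⟨h.1, ?_⟩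
    rintro _ ⟨z, hz, rfl⟩
    exact h.2 z hz

end Decomposition

section Cases

variable {V : Type*} {G : SimpleGraph V} {n M : ℕ} {L : List (Entry V)} {B C P S A : Set V}
  {I : Finset ℕ} {Z : ℕ → Set V} {col : V → Bool} {e f : Entry V} {x y : V}

/-- The vertices of `C` at distance at most `4` from `P` through `C`. -/
def nbhd (G : SimpleGraph V) (C P : Set V) : Set V :=
  {v | ∃ a ∈ C, (∃ y ∈ P, G.Adj y a) ∧ Near G C 3 a v}

lemma nbhd_subset : nbhd G C P ⊆ C := fun _ ⟨_, _, _, h⟩ => h.mem_right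

lemma near_nbhd {a v : V} (hP : ∃ y ∈ P, G.Adj y a) (h : Near G C 3 a v) :
    Near G (nbhd G C P) 3 a v :=
  have mem : ∀ {k b}, k ≤ 3 → Near G C k a b → b ∈ nbhd G C P :=
    fun hk hb => ⟨a, hb.mem_left, hP, hb.mono subset_rfl hk⟩
  h.induct (Q := fun k b => Near G (nbhd G C P) k a b)
    (fun ha => .refl (mem (Nat.zero_le _) (.refl ha 0)) _)
    (fun _ _ h => h.mono subset_rfl (by omega))
    fun _ _ _ hk hab ih hbc hc => ih.snoc hbc (mem (by omega) (hab.snoc hbc hc))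

lemma OneDim.nbhd {D : ℕ → ℕ} (h : OneDim G A S D) (hPS : P ⊆ S) (hSA : S ⊆ A)
    (hA : nbhd G C P ⊆ A) : OneDim G A (nbhd G C P ∪ S) (OddMinorColoring.thick 4 D) := by
  refine (h.thick 4).mono (Set.union_subset ?_ fun x hx => ⟨x, hx, .refl (hSA hx) _⟩)
    fun _ => le_rfl
  rintro v ⟨a, -, ⟨y, hy, hya⟩, hav⟩
  exact ⟨y, hPS hy, (((near_nbhd ⟨y, hy, hya⟩ hav).mono hA le_rfl).cons hya (hSA (hPS hy))).symm⟩

lemma State.eq_of_mem (st : State G n M B L C I Z col) (he : e ∈ L) (hf : f ∈ L) (hx : x ∈ e.p)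
    (hx' : x ∈ f.p) : e = f := by
  by_contra hne
  have : Std.Symm fun e f : Entry V => Disjoint e.p f.p := ⟨fun _ _ h => h.symm⟩
  have key : ∀ e ∈ L, ∀ f ∈ L, e ≠ f → Disjoint e.p f.p := fun e he f hf hne =>
    (st.nested.imp_of_mem (S := fun e f => Disjoint e.p f.p) fun {a b} _ hb hab =>
      (st.disj_dom b hb).symm.mono_left (Set.subset_union_right.trans hab)).forall he hf hne
  exact Set.disjoint_left.1 (key e he f hf hne) hx hx'

/-- Continuing when the boundary of some entry has no neighbor in `C`. -/
lemma State.good_of_ghost [Finite V] (st : State G n M B L C I Z col)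
    (hg : ∃ g ∈ L, ∀ x ∈ C, ∀ y ∈ g.p, ¬ G.Adj x y)
    (ih : ∀ L' C' I' Z' col', C'.ncard < C.ncard → State G n M B L' C' I' Z' col' →
      Good G M (finalCtl n M) (fullStack L' B) (hullU L' ∪ C')) :
    Good G M (finalCtl n M) (fullStack L B) (hullU L ∪ C) := by
  obtain ⟨g, hgL, hg⟩ := hg
  obtain ⟨New, older, rfl⟩ : ∃ New older, L = New ++ [g] ++ older := by
    simpa using List.append_of_mem hgL
  set P : Set V := {y | ∃ e ∈ New, y ∈ e.p} with hP
  set F := nbhd G C P with hF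
  have hlen := st.len
  simp only [List.length_append, List.length_singleton] at hlen
  have hnew : ∀ e ∈ New, e ∈ New ++ [g] ++ older := fun e he => by simp [he]
  have hPH : P ⊆ hullU New := fun y ⟨e, he, hy⟩ =>
    subset_hullU he (st.hulls.p_subset (hnew e he) hy)
  have nbr_new : ∀ x ∈ C, ∀ y ∈ P, G.Adj x y → x ∈ F := fun x hx y hy hxy =>
    ⟨x, hx, ⟨y, hy, hxy.symm⟩, .refl hx _⟩
  have P_not_C : ∀ y ∈ P, y ∉ C := fun y ⟨e, he, hy⟩ hyC =>
    Set.disjoint_left.1 (st.disj_dom e (hnew e he)) hy (st.sub_dom e (hnew e he) hyC)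
  have cases_nbr : ∀ x ∈ C, ∀ y, G.Adj x y → ∀ e ∈ New ++ [g] ++ older, y ∈ e.p →
      x ∈ F ∧ e ∈ New ∨ e ∈ older := by
    intro x hx y hxy e he hye
    simp only [List.mem_append, List.mem_singleton] at he
    rcases he with (he | rfl) | he
    · exact .inl ⟨nbr_new x hx y ⟨e, he, hye⟩ hxy, he⟩
    · exact (hg x hx y hye hxy).elim
    · exact .inr he
  let Q : ℕ → Prop := fun i => ∃ x ∈ C, ∃ y ∈ Z i, G.Adj x y ∧ y ∈ P
  obtain ⟨Z', col', sys, hZ, hZ', hZQ, habs⟩ := st.sys.absorb (F := F) Q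
    (fun i hi => (st.disj i hi).mono_right nbhd_subset) (by
      rintro x ⟨a, ha, ⟨y, hy, hya⟩, hax⟩
      obtain ⟨⟨i, hi, hyi⟩, -⟩ := st.cover a ha y (P_not_C y hy) hya.symm
      exact ⟨a, ⟨3, (near_nbhd ⟨y, hy, hya⟩ hax).symm⟩, i, hi, ⟨a, ha, y, hyi, hya.symm, hy⟩,
        y, hyi, hya.symm⟩)
  have hdisj : Disjoint (hullU New) C :=
    Hulls.disjoint (L₂ := g :: older) (by simpa using st.hulls)
  refine Pop.good st (W := F) (J := I) (hull := fun _ => F ∪ hullU New) ⟨?_, nbhd_subset, by omega,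
    ?_, sys, ?_, habs, ?_, ?_, fun D => ?_, fun D => ?_, fun D hD => ?_, fun z hz A h1 h2 => ?_⟩
    (.inl ?_) ih
  · cases New with
    | nil =>
      obtain ⟨w, hw, x, hx, hxw⟩ := st.top g older rfl
      exact (hg x hx w hw hxw).elim
    | cons e New =>
      obtain ⟨w, hw, x, hx, hxw⟩ := st.top e (New ++ [g] ++ older) rfl
      exact ⟨x, nbr_new x hx w ⟨e, List.mem_cons_self, hw⟩ hxw⟩
  · intro e he x hx y hy h
    have heL : e ∈ New ++ [g] ++ older := List.mem_append_left _ he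
    have hyC : y ∉ C := fun hyC =>
      Set.disjoint_left.1 (st.disj_dom e heL) hy (st.sub_dom e heL hyC)
    obtain ⟨a, b, k, l, h1, haC, hbC, hab, h2, hkl⟩ :=
      h.last_exit (P := Cᶜ) hyC (by simpa using hx.1)
    have hbC : b ∈ C := by simpa using hbC
    obtain ⟨-, f, hf, haf⟩ := st.cover b hbC a haC hab.symm
    rcases cases_nbr b hbC a hab.symm f hf haf with ⟨-, hf'⟩ | hf'
    · refine hx.2 ⟨b, hbC, ⟨a, ⟨f, hf', haf⟩, hab⟩, h2.mono (fun v hv => ?_) (by omega)⟩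
      simpa using hv.2
    · have := (List.pairwise_append.1 st.nested).2.2 e he f hf'
      exact Set.disjoint_left.1 (st.disj_dom f hf) haf (this h1.mem_right)
  · refine fun i hi => Set.disjoint_left.2 fun x hx hxC => ?_
    exact (hZ' i hi hx).elim (fun h => Set.disjoint_left.1 (st.disj i hi) h hxC.1) hxC.2
  · intro x hx y hy hxy
    obtain ⟨⟨i, hi, hyi⟩, e, he, hye⟩ := st.cover x hx.1 y hy hxy
    exact ⟨⟨i, hi, hZ i hi hyi⟩, e, ((cases_nbr x hx.1 y hxy e he hye).resolve_left
      fun h => hx.2 h.1), hye⟩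
  · intro i hi
    obtain ⟨e, he, hei⟩ := st.single i hi
    by_cases hQ : Q i
    · refine .inl fun x hx y hy hxy => (hZ' i hi hy).resolve_left fun hyi => ?_
      obtain ⟨x', hx', y', hy', hxy', f, hf, hyf⟩ := hQ
      obtain rfl := st.eq_of_mem he (hnew f hf) (hei x' hx' y' hy' hxy') hyf
      exact hx.2 (nbr_new x hx.1 y ⟨e, hf, hei x hx.1 y hyi hxy⟩ hxy)
    · rw [hZQ i hi hQ]
      by_cases htouch : ∃ x ∈ C \ F, ∃ y ∈ Z i, G.Adj x y
      · obtain ⟨x, hx, y, hy, hxy⟩ := htouch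
        exact .inr ⟨e, (cases_nbr x hx.1 y hxy e he (hei x hx.1 y hy hxy)).resolve_left
          fun h => hx.2 h.1, fun x hx => hei x hx.1⟩
      · push Not at htouch
        exact .inl fun x hx y hy hxy => (htouch x hx y hy hxy).elim
  · exact fun w hw => .inl hw.1
  · refine Set.union_subset (nbhd_subset.trans Set.subset_union_right) ?_
    rw [hullU_append]
    exact Set.subset_union_left.trans Set.subset_union_left
  · exact Set.disjoint_union_left.2 ⟨Set.disjoint_left.2 fun x hx hxD => (hD hxD).2 hx,
      hdisj.mono_right fun x hx => (hD hx).1⟩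
  · have hone : OneDim G A (hullU New) (hullCtl M (levelCtl n M (M - (older.length + 1)))) := by
      refine Hulls.oneDim (L₂ := g :: older) (by simpa using st.hulls) (by omega) le_rfl
        (Set.subset_union_right.trans h1) (h2.trans ?_)
      rintro x ((hx | hx) | hx)
      · exact .inr (nbhd_subset hx)
      · exact .inl hx
      · exact .inr (Linked.mem_right hx).1
    refine (hone.nbhd hPH (Set.subset_union_right.trans h1) (Set.subset_union_left.trans h1)).mono
      subset_rfl fun s => ?_
    rw [show M - older.length = M - (older.length + 1) + 1 by omega]
    exact thick_le_levelCtl _ _ _ _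
  · have hone : OneDim G (hullU (New ++ [g] ++ older) ∪ C) (hullU (New ++ [g] ++ older))
        (hullCtl M (levelCtl n M M)) :=
      Hulls.oneDim (L₂ := []) (by simpa using st.hulls)
        (by simp only [List.length_append, List.length_cons, List.length_nil]; omega)
        (by simp) Set.subset_union_left subset_rfl
    refine (hone.nbhd (C := C) (P := P) (hPH.trans ?_) Set.subset_union_left
      (nbhd_subset.trans Set.subset_union_right)).mono Set.subset_union_left fun s =>
      (thick_le_levelCtl _ _ _ _).trans (le_max_left _ _)
    rw [hullU_append, hullU_append]
    exact Set.subset_union_left.trans Set.subset_union_left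

end Cases

section Cases

variable {V : Type*} {G : SimpleGraph V} {n M : ℕ} {L : List (Entry V)} {B C P S A : Set V}
  {I : Finset ℕ} {Z : ℕ → Set V} {col : V → Bool} {e f : Entry V} {x y : V}

lemma State.length_le_card (st : State G n M B L C I Z col)
    (hg : ∀ g ∈ L, ∃ x ∈ C, ∃ y ∈ g.p, G.Adj x y) : L.length ≤ I.card := by
  classical
  have : Nonempty (Entry V) := ⟨⟨∅, ∅, ∅⟩⟩
  have hnd : L.Nodup := st.nested.imp_of_mem fun {a b} ha _ hab hne => by
    subst hne
    obtain ⟨-, -, y, hy, -⟩ := hg a ha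
    exact Set.disjoint_left.1 (st.disj_dom a ha) hy (hab (.inr hy))
  choose! f hf hfZ using st.single
  rw [← List.toFinset_card_of_nodup hnd]
  refine (Finset.card_le_card fun e he => ?_).trans (Finset.card_image_le (s := I) (f := f))
  have he : e ∈ L := by simpa using he
  obtain ⟨x, hx, y, hy, hxy⟩ := hg e he
  obtain ⟨⟨i, hi, hyi⟩, -⟩ := st.cover x hx y (fun hyC =>
    Set.disjoint_left.1 (st.disj_dom e he) hy (st.sub_dom e he hyC)) hxy
  exact Finset.mem_image.2 ⟨i, hi, st.eq_of_mem (hf i hi) he (hfZ i hi x hx y hyi hxy) hy⟩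

/-- Continuing when the core of `C` with respect to a member of the system is bipartite. -/
lemma State.good_of_bipartite [Finite V] (st : State G n M B L C I Z col)
    (hlen : L.length + 2 ≤ M) {i₀ : ℕ} (hi₀ : i₀ ∈ I)
    (hbip : ∃ g : V → Bool, ∀ x ∈ core G C {c | c ∈ C ∧ ∃ w ∈ Z i₀, G.Adj c w},
      ∀ y ∈ core G C {c | c ∈ C ∧ ∃ w ∈ Z i₀, G.Adj c w}, G.Adj x y → g x ≠ g y)
    (ih : ∀ L' C' I' Z' col', C'.ncard < C.ncard → State G n M B L' C' I' Z' col' →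
      Good G M (finalCtl n M) (fullStack L' B) (hullU L' ∪ C')) :
    Good G M (finalCtl n M) (fullStack L B) (hullU L ∪ C) := by
  set R := {c | c ∈ C ∧ ∃ w ∈ Z i₀, G.Adj c w} with hR
  set W := core G C R with hW
  have hWC : W ⊆ C := fun x hx => hx.1
  have hRC : R ⊆ C := fun x hx => hx.1
  obtain ⟨c, hcC, w, hw, hcw⟩ := st.touch i₀ hi₀
  have hcR : c ∈ R := ⟨hcC, w, hw, hcw⟩
  have sub : ∀ z ∈ C \ W, (attach G W {y | Linked G (C \ W) z y}).Subsingleton := by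
    rintro z - u ⟨hu, x, hx, hxu⟩ u' ⟨hu', x', hx', hxu'⟩
    exact core_attachment_unique (hx'.symm.trans hx) hu' hu hxu' hxu
  obtain ⟨Z', col', sys, hZ, hZ', hZQ, habs⟩ := st.sys.absorb (F := W) (· = i₀)
    (fun i hi => (st.disj i hi).mono_right hWC) fun x hx => by
      obtain ⟨y, hy, hxy⟩ := core_linked st.conn hRC ⟨c, hcR⟩ hx
      obtain ⟨-, w, hw, hyw⟩ := hy
      exact ⟨y, hxy, i₀, hi₀, rfl, w, hw, hyw⟩
  refine Pop.good (L₁ := []) st (W := W) (J := I) (hull := fun D => attach G W D)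
    ⟨⟨c, mem_core_of_mem hcC hcR⟩, hWC, hlen, by simp, sys, ?_, habs, ?_, ?_, fun _ => subset_rfl,
    fun D x hx => .inr (hWC hx.1), fun D hD => Set.disjoint_left.2 fun x hx hxD => (hD hxD).2 hx.1,
    fun z hz A h1 _ => .subsingleton (sub z hz) h1⟩ (.inr ⟨hbip, sub⟩) ih
  · refine fun i hi => Set.disjoint_left.2 fun x hx hxC => ?_
    exact (hZ' i hi hx).elim (fun h => Set.disjoint_left.1 (st.disj i hi) h hxC.1) hxC.2
  · intro x hx y hy hxy
    obtain ⟨⟨i, hi, hyi⟩, h⟩ := st.cover x hx.1 y hy hxy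
    exact ⟨⟨i, hi, hZ i hi hyi⟩, h⟩
  · intro i hi
    by_cases hii : i = i₀
    · subst hii
      exact .inl fun x hx y hy hxy => (hZ' i hi hy).resolve_left fun hyi =>
        hx.2 (mem_core_of_mem hx.1 ⟨hx.1, y, hyi, hxy⟩)
    · rw [hZQ i hi hii]
      obtain ⟨e, he, hei⟩ := st.single i hi
      exact .inr ⟨e, he, fun x hx => hei x hx.1⟩

/-- Continuing when all members of the system can be extended oddly into `C`. -/
lemma State.good_of_odd [Finite V] (st : State G n M B L C I Z col)
    (hlen : L.length + 2 ≤ M) (hI : I.card ≤ n)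
    (hodd : ∀ i ∈ I, ∃ E ⊆ C, ConnSet G E ∧ Odd G col E (Z i) ∧
      ∀ A ⊆ C, OneDim G A (E ∩ A) earCtl)
    (ih : ∀ L' C' I' Z' col', C'.ncard < C.ncard → State G n M B L' C' I' Z' col' →
      Good G M (finalCtl n M) (fullStack L' B) (hullU L' ∪ C')) :
    Good G M (finalCtl n M) (fullStack L B) (hullU L ∪ C) := by
  classical
  choose! E hEC hE hEodd hEdim using hodd
  obtain ⟨Y, hYC, hYne, hY, hEY, hYdim⟩ := exists_connector st.conn st.nonempty I E
    (fun i hi => ⟨hEC i hi, by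
      obtain ⟨_, hsub, _, -, ⟨x, hx, -⟩, -⟩ := hEodd i hi
      exact ⟨x, hsub hx⟩, hE i hi, hEdim i hi⟩) hI
  obtain ⟨j, Z', col', hjI, sys, hZj, hZI⟩ := st.sys.push hY hYne
    (fun i hi => (st.disj i hi).mono_right hYC)
    fun i hi => (hEodd i hi).mono (hEY i hi) subset_rfl fun _ _ => rfl
  refine Pop.good (L₁ := []) st (W := Y) (J := insert j I) (hull := fun D => Y)
    ⟨hYne, hYC, hlen, by simp, sys, ?_, fun x hx => ⟨j, by simp, by rwa [hZj]⟩, ?_, ?_,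
    fun _ _ hx => hx.1, fun _ x hx => .inr (hYC hx),
    fun D hD => Set.disjoint_left.2 fun x hx hxD => (hD hxD).2 hx, fun z hz A h1 h2 => ?_⟩
    (.inl ?_) ih
  · intro i hi
    rcases Finset.mem_insert.1 hi with rfl | hi
    · rw [hZj]
      exact Set.disjoint_sdiff_right
    · rw [hZI i hi]
      exact (st.disj i hi).mono_right Set.sdiff_subset
  · intro x hx y hy hxy
    obtain ⟨⟨i, hi, hyi⟩, h⟩ := st.cover x hx.1 y hy hxy
    exact ⟨⟨i, Finset.mem_insert_of_mem hi, by rwa [hZI i hi]⟩, h⟩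
  · intro i hi
    rcases Finset.mem_insert.1 hi with rfl | hi
    · exact .inl fun x _ y hy _ => by rwa [hZj] at hy
    · obtain ⟨e, he, hei⟩ := st.single i hi
      rw [hZI i hi]
      exact .inr ⟨e, he, fun x hx => hei x hx.1⟩
  · refine (hYdim A (h2.trans (Set.union_subset hYC fun x hx => (Linked.mem_right hx).1))).mono
      (fun x hx => ⟨hx, h1 hx⟩) fun s => ?_
    exact levelCtl_mono n M (Nat.zero_le _) s
  · have hd : Disjoint (hullU L) C := Hulls.disjoint (L₂ := []) (by simpa using st.hulls)
    have hone : OneDim G (hullU L ∪ C) (hullU L) (hullCtl M (levelCtl n M M)) :=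
      Hulls.oneDim (L₂ := []) (by simpa using st.hulls) (by omega) (by simp)
        Set.subset_union_left subset_rfl
    have hsub : (hullU L ∪ C) \ hullU L ⊆ C := fun x hx => hx.1.resolve_left hx.2
    refine (hone.extend (hYdim _ hsub)).mono (fun x hx => .inr ⟨hx, .inr (hYC hx), fun hx' =>
      Set.disjoint_left.1 hd hx' (hYC hx)⟩) fun s => le_max_right _ _

lemma State.good [Finite V] (hn : ∀ I Z col, OddSystem G I Z col → I.card < n)
    (st : State G n (n + 1) B L C I Z col) :
    Good G (n + 1) (finalCtl n (n + 1)) (fullStack L B) (hullU L ∪ C) := by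
  induction hk : C.ncard using Nat.strong_induction_on generalizing L C I Z col with
  | _ k ih =>
  subst hk
  have ih' : ∀ L' C' I' Z' col', C'.ncard < C.ncard → State G n (n + 1) B L' C' I' Z' col' →
      Good G (n + 1) (finalCtl n (n + 1)) (fullStack L' B) (hullU L' ∪ C') :=
    fun L' C' I' Z' col' hlt st' => ih _ hlt st' rfl
  by_cases hg : ∃ g ∈ L, ∀ x ∈ C, ∀ y ∈ g.p, ¬ G.Adj x y
  · exact st.good_of_ghost hg ih'
  push Not at hg
  have hI := hn I Z col st.sys
  have hlen := st.length_le_card hg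
  by_cases hbip : ∃ i ∈ I, ∃ g : V → Bool, ∀ x ∈ core G C {c | c ∈ C ∧ ∃ w ∈ Z i, G.Adj c w},
      ∀ y ∈ core G C {c | c ∈ C ∧ ∃ w ∈ Z i, G.Adj c w}, G.Adj x y → g x ≠ g y
  · obtain ⟨i, hi, hbip⟩ := hbip
    exact st.good_of_bipartite (by omega) hi hbip ih'
  · refine st.good_of_odd (by omega) hI.le (fun i hi => ?_) ih'
    obtain ⟨x, hx, y, hy, hxy⟩ := st.touch i hi
    exact (bipartite_or_exists_odd st.conn (st.disj i hi).symm ⟨x, hx, y, hy, hxy⟩ col).resolve_left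
      fun h => hbip ⟨i, hi, h⟩

lemma good_component [Finite V] (hn : ∀ I Z col, OddSystem G I Z col → I.card < n)
    (hC : ConnSet G C) (hne : C.Nonempty) (hcl : ∀ x ∈ C, ∀ y, G.Adj x y → y ∈ C) :
    Good G (n + 1) (finalCtl n (n + 1)) [(C, ∅)] C := by
  have st : State G n (n + 1) C [] C ∅ (fun _ => ∅) (fun _ => true) :=
    { nonempty := hne
      conn := hC
      head := ⟨∅, [], rfl⟩
      top := by simp
      nested := by simp
      disj_dom := by simp
      sub_dom := by simp
      hulls := trivial
      len := by simp
      sys := ⟨by simp, by simp, by simp⟩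
      disj := by simp
      touch := by simp
      cover := fun x hx y hy hxy => (hy (hcl x hx y hxy)).elim
      single := by simp }
  simpa [fullStack] using st.good hn

end Cases

/-- Graphs without long odd systems have `3`-colorings of bounded weak diameter. -/
lemma exists_three_coloring (n : ℕ) : ∃ N : ℕ, ∀ (V : Type u) [Finite V] (G : SimpleGraph V),
    (∀ I Z col, OddSystem G I Z col → I.card < n) →
      ∃ c : V → Fin 3, HasWeakDiamLE G Set.univ c N := by
  obtain ⟨N, hN⟩ := exists_coloring_of_good.{u} (n + 1) (finalCtl n (n + 1))
  refine ⟨N, fun V _ G hn => ?_⟩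
  let K : G.ConnectedComponent → Set V := fun k => {x | G.connectedComponentMk x = k}
  have hK : ∀ k x, x ∈ K k → ∀ y, G.Adj x y → y ∈ K k := fun k x hx y hxy => by
    rw [← show _ = k from hx]
    exact (ConnectedComponent.connectedComponentMk_eq_of_adj hxy).symm
  have hconn : ∀ k, ConnSet G (K k) := fun k x hx y hy => by
    obtain ⟨w⟩ := ConnectedComponent.exact (hx.trans hy.symm)
    classical
    refine ⟨w.length, w, le_rfl, fun v hv => ?_⟩
    rw [← show _ = k from hx]
    exact ConnectedComponent.sound (w.takeUntil v hv).reachable.symm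
  have hgood : ∀ k, ∃ c : V → Fin 3, BddCol G (K k) G.Adj (K k) c N := fun k => by
    obtain ⟨x, rfl⟩ := k.exists_rep
    exact hN V G _ ∅ _ (good_component hn (hconn _) ⟨x, rfl⟩ (hK _))
  choose c hc using hgood
  have key : ∀ {a b} (w : G.Walk a b) (k) (i : Fin 3), a ∈ K k →
      (∀ v ∈ w.support, c (G.connectedComponentMk v) v = i) → Chain G.Adj (K k) (c k) a b := by
    intro a b w k i ha hw
    induction w with
    | nil => exact .refl
    | @cons a u b hau w ih =>
      have hu := hK k a ha u hau
      have h1 := hw a (by simp)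
      have h2 := hw u (by simp)
      rw [show G.connectedComponentMk _ = k from ha] at h1
      rw [show G.connectedComponentMk _ = k from hu] at h2
      exact .head ⟨ha, hu, h1.trans h2.symm, hau⟩ (ih hu fun v hv => hw v (by simp [hv]))
  refine ⟨fun v => c (G.connectedComponentMk v) v, fun a b ⟨w, hw⟩ => ?_⟩
  exact (hc _ a rfl b (key w _ _ rfl fun v hv => (hw v hv).2)).dist_le

end OddMinorColoring

/-- **Theorem.** For every graph `H`, there exists a positive integer `N` such that every
odd `H`-minor free graph `G` has a 3-coloring with weak diameter in `G` at most `N`. -/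
theorem odd_minor_free_three_coloring_weak_diameter
    {W : Type v} [Fintype W] (H : SimpleGraph W) :
    ∃ N : ℕ, 0 < N ∧
      ∀ (V : Type u) [Fintype V] (G : SimpleGraph V),
        ¬ IsOddMinor H G →
        ∃ c : V → Fin 3, HasWeakDiamLE G Set.univ c N := by
  obtain ⟨N, hN⟩ := OddMinorColoring.exists_three_coloring.{u}
    (OddMinorColoring.extractSize (Fintype.card W))
  refine ⟨N + 1, N.succ_pos, fun V _ G hG => ?_⟩
  obtain ⟨c, hc⟩ := hN V G fun I Z col h => by
    by_contra! hI
    exact hG (h.isOddMinor H hI)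
  exact ⟨c, fun a b hab => (hc a b hab).trans N.le_succ⟩
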